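/- Let X = {f = 0} ⊂ ℙ³(ℂ) be a surface of degree 6 whose only singularities are exactly 9 ordinary triple points P₁, …, P₉. Then the ℂ-vector space of homogeneous polynomials of degree 2 in ℂ[x₀,x₁,x₂,x₃] vanishing at all nine points P₁, …, P₉ is one-dimensional; that is, there is a unique quadric surface through the nine triple points. -/

import Mathlib

open MvPolynomial

noncomputable section

/-- Iterated partial derivative of `f` along a list of variable indices. -/
def pderivList {n : ℕ} (l : List (Fin n)) (f : MvPolynomial (Fin n) ℂ) :
    MvPolynomial (Fin n) ℂ :=
  l.foldl (fun g i => MvPolynomial.pderiv i g) f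

/-- All partial derivatives of `f` of order `< m` vanish at `p`
(`P` has multiplicity `≥ m` on `{f = 0}`). -/
def MultAtLeast {n : ℕ} (f : MvPolynomial (Fin n) ℂ) (p : Fin n → ℂ) (m : ℕ) : Prop :=
  ∀ l : List (Fin n), l.length < m → MvPolynomial.eval p (pderivList l f) = 0

/-- `p` is (a representative of) a singular point of `{f = 0}`. -/
def SingularAt (f : MvPolynomial (Fin 4) ℂ) (p : Fin 4 → ℂ) : Prop :=
  MultAtLeast f p 2

/-- The partial derivatives of `c` have no common zero in `ℂⁿ ∖ {0}`. -/
def NowhereSingular {n : ℕ} (c : MvPolynomial (Fin n) ℂ) : Prop :=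
  ∀ p : Fin n → ℂ, p ≠ 0 → ∃ i, MvPolynomial.eval p (MvPolynomial.pderiv i c) ≠ 0

/-- Linear change of coordinates: `substMatrix B f` is the polynomial `x ↦ f (B.mulVec x)`. -/
def substMatrix {n : ℕ} (B : Matrix (Fin n) (Fin n) ℂ) (f : MvPolynomial (Fin n) ℂ) :
    MvPolynomial (Fin n) ℂ :=
  MvPolynomial.aeval (fun i => ∑ j, MvPolynomial.C (B i j) * MvPolynomial.X j) f

/-- `p` is (a representative of) an ordinary triple point of the degree-`d` surface `{f = 0}`:
all partials of order `≤ 2` vanish at `p`, some third-order partial does not, and after a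
linear change of coordinates taking `(0,0,0,1)` to `p`, writing `f` as
`∑ⱼ x₃^(d-j) fⱼ(x₀,x₁,x₂)` with `fⱼ` homogeneous of degree `j`, the cubic `f₃` is nonsingular. -/
def OrdinaryTriplePointAt (d : ℕ) (f : MvPolynomial (Fin 4) ℂ) (p : Fin 4 → ℂ) : Prop :=
  MultAtLeast f p 3 ∧
  (∃ l : List (Fin 4), l.length = 3 ∧ MvPolynomial.eval p (pderivList l f) ≠ 0) ∧
  ∃ B : Matrix (Fin 4) (Fin 4) ℂ, IsUnit B.det ∧ B.mulVec ![0, 0, 0, 1] = p ∧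
    ∃ g : ℕ → MvPolynomial (Fin 3) ℂ,
      (∀ j, (g j).IsHomogeneous j) ∧
      substMatrix B f =
        ∑ j ∈ Finset.range (d + 1),
          (MvPolynomial.X 3) ^ (d - j) * MvPolynomial.rename Fin.castSucc (g j) ∧
      NowhereSingular (g 3)

/-- The set of singular points of `{f = 0}` in `ℙ³(ℂ)`. -/
def SingSet (f : MvPolynomial (Fin 4) ℂ) : Set (Projectivization ℂ (Fin 4 → ℂ)) :=
  {P | SingularAt f P.rep}

/-- `{f = 0}` has `ν` ordinary triple points as its only singularities. -/
def OnlyTriplePoints (d ν : ℕ) (f : MvPolynomial (Fin 4) ℂ) : Prop :=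
  (SingSet f).Finite ∧ (SingSet f).ncard = ν ∧
  ∀ P ∈ SingSet f, OrdinaryTriplePointAt d f P.rep

/-- The ideal of polynomials vanishing at `v`; its powers measure multiplicity at `v`. -/
def pointIdeal {n : ℕ} (v : Fin n → ℂ) : Ideal (MvPolynomial (Fin n) ℂ) :=
  Ideal.span (Set.range fun i => X i - C (v i))

lemma aeval_mem_pow {n : ℕ} {R : Type*} [CommRing R] [Algebra ℂ R] {v : Fin n → ℂ} {k : ℕ}
    {f : MvPolynomial (Fin n) ℂ} (hf : f ∈ pointIdeal v ^ k) (χ : Fin n → R) (I : Ideal R)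
    (hχ : ∀ i, χ i - algebraMap ℂ R (v i) ∈ I) : aeval χ f ∈ I ^ k := by
  have h1 : Ideal.map (aeval χ : MvPolynomial (Fin n) ℂ →ₐ[ℂ] R) (pointIdeal v) ≤ I := by
    rw [pointIdeal, Ideal.map_span, Ideal.span_le]
    rintro _ ⟨_, ⟨i, rfl⟩, rfl⟩
    simpa [algebraMap_eq] using hχ i
  have h2 := Ideal.mem_map_of_mem (aeval χ : MvPolynomial (Fin n) ℂ →ₐ[ℂ] R) hf
  rw [Ideal.map_pow] at h2
  exact Ideal.pow_right_mono h1 k h2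

lemma derivation_aeval {n : ℕ} {R : Type*} [CommRing R] [Algebra ℂ R] (D : Derivation ℂ R R)
    (χ : Fin n → R) (f : MvPolynomial (Fin n) ℂ) :
    D (aeval χ f) = ∑ i, aeval χ (pderiv i f) * D (χ i) := by
  induction f using MvPolynomial.induction_on with
  | C a => simp
  | add p q hp hq => simp only [map_add, hp, hq, add_mul, Finset.sum_add_distrib]
  | mul_X p j hp =>
    simp only [map_mul, Derivation.leibniz, aeval_X, hp, smul_eq_mul, map_add, add_mul,
      Finset.sum_add_distrib, Finset.mul_sum]
    congr 1
    · rw [Finset.sum_eq_single j]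
      · simp
      · intro i _ hij
        simp [pderiv_X_of_ne hij.symm]
      · simp
    · refine Finset.sum_congr rfl fun i _ => by ring

lemma pderiv_mem_pow {n : ℕ} {v : Fin n → ℂ} {k : ℕ}
    {f : MvPolynomial (Fin n) ℂ} (hf : f ∈ pointIdeal v ^ (k + 1)) (i : Fin n) :
    pderiv i f ∈ pointIdeal v ^ k := by
  induction k generalizing f with
  | zero => simp
  | succ k ih =>
    rw [pow_succ] at hf
    refine Submodule.mul_induction_on hf ?_ ?_
    · intro a ha b hb
      rw [pderiv_mul]
      refine Ideal.add_mem _ ?_ (Ideal.mul_mem_right _ _ ha)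
      rw [pow_succ]
      exact Ideal.mul_mem_mul (ih ha) hb
    · intro a b ha hb
      rw [map_add]
      exact Ideal.add_mem _ ha hb

lemma aeval_sub_aeval_mem {σ R : Type*} [CommRing R] [Algebra ℂ R] (I : Ideal R) {χ ψ : σ → R}
    (h : ∀ i, χ i - ψ i ∈ I) (f : MvPolynomial σ ℂ) : aeval χ f - aeval ψ f ∈ I := by
  rw [← Ideal.Quotient.mk_eq_mk_iff_sub_mem]
  change (Ideal.Quotient.mkₐ ℂ I) _ = (Ideal.Quotient.mkₐ ℂ I) _
  rw [comp_aeval_apply, comp_aeval_apply]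
  have h2 : (fun i => (Ideal.Quotient.mkₐ ℂ I) (χ i)) = fun i => (Ideal.Quotient.mkₐ ℂ I) (ψ i) :=
    funext fun i => (Ideal.Quotient.mk_eq_mk_iff_sub_mem _ _).2 (h i)
  rw [h2]

lemma mem_pointIdeal_iff {n : ℕ} {v : Fin n → ℂ} {f : MvPolynomial (Fin n) ℂ} :
    f ∈ pointIdeal v ↔ eval v f = 0 := by
  constructor
  · intro h
    have := aeval_mem_pow (k := 1) (by simpa using h) v ⊥ (by simp)
    simpa [coe_aeval_eq_eval] using this
  · intro h
    have h2 := aeval_sub_aeval_mem (pointIdeal v) (χ := X) (ψ := fun i => C (v i))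
      (fun i => Ideal.subset_span ⟨i, rfl⟩) f
    have h3 : aeval (fun i => C (v i)) f = (C (eval v f) : MvPolynomial (Fin n) ℂ) := by
      rw [← coe_aeval_eq_eval]
      exact (comp_aeval_apply v (Algebra.ofId ℂ (MvPolynomial (Fin n) ℂ)) f).symm
    rwa [h3, h, C_0, aeval_X_left_apply, sub_zero] at h2

lemma mem_pow_succ_of_pderiv {n : ℕ} {v : Fin n → ℂ} {k : ℕ}
    {f : MvPolynomial (Fin n) ℂ} (h0 : eval v f = 0) (h : ∀ i, pderiv i f ∈ pointIdeal v ^ k) :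
    f ∈ pointIdeal v ^ (k + 1) := by
  set T : MvPolynomial (Fin n) ℂ →ₐ[ℂ] MvPolynomial (Fin n) ℂ := aeval fun i => X i + C (v i)
  have hI : idealOfVars (Fin n) ℂ = pointIdeal 0 := by
    simp [idealOfVars, pointIdeal]
  have hT : ∀ {g : MvPolynomial (Fin n) ℂ} {j : ℕ}, g ∈ pointIdeal v ^ j →
      T g ∈ idealOfVars (Fin n) ℂ ^ j := fun hg =>
    aeval_mem_pow hg _ _ fun i => by
      simpa [algebraMap_eq, idealOfVars] using Ideal.subset_span (Set.mem_range_self i)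
  have hd : ∀ i, pderiv i (T f) = T (pderiv i f) := by
    intro i
    rw [derivation_aeval, Finset.sum_eq_single i]
    · simp [T]
    · intro j _ hj
      simp [pderiv_X_of_ne hj]
    · simp
  have hTf : T f ∈ idealOfVars (Fin n) ℂ ^ (k + 1) := by
    rw [mem_pow_idealOfVars_iff']
    intro d hdeg
    by_cases hd0 : d = 0
    · subst hd0
      have : eval 0 (T f) = eval v f := by
        rw [← coe_aeval_eq_eval, ← coe_aeval_eq_eval]
        change (aeval 0 : MvPolynomial (Fin n) ℂ →ₐ[ℂ] ℂ) (aeval _ f) = _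
        rw [comp_aeval_apply]
        simp [coe_aeval_eq_eval]
      rw [← constantCoeff_eq, ← eval_zero, this, h0]
    · obtain ⟨i, hi⟩ := Finsupp.ne_iff.1 hd0
      have hi' : d = (d - Finsupp.single i 1) + Finsupp.single i 1 := by
        rw [tsub_add_cancel_of_le]
        simpa using Nat.one_le_iff_ne_zero.2 hi
      have h1 := (mem_pow_idealOfVars_iff' _ _).1 (hT (h i)) (d - Finsupp.single i 1) (by
        rw [hi', map_add] at hdeg
        simp at hdeg
        omega)
      rw [← hd, coeff_pderiv, ← hi'] at h1
      refine (mul_eq_zero.1 h1).resolve_right ?_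
      norm_cast
  have h2 := aeval_mem_pow (hI ▸ hTf) (fun i => X i - C (v i)) (pointIdeal v)
    (fun i => by simpa [pointIdeal] using Ideal.subset_span (Set.mem_range_self i))
  have h3 : aeval (fun i => X i - C (v i)) (T f) = f := by
    rw [comp_aeval_apply]
    simp [algebraMap_eq]
  rwa [h3] at h2

lemma multAtLeast_iff {n : ℕ} {v : Fin n → ℂ} {k : ℕ} {f : MvPolynomial (Fin n) ℂ} :
    MultAtLeast f v k ↔ f ∈ pointIdeal v ^ k := by
  induction k generalizing f with
  | zero => simp [MultAtLeast]
  | succ k ih =>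
    constructor
    · intro h
      refine mem_pow_succ_of_pderiv (h [] (by simp)) fun i => ih.1 fun l hl => ?_
      exact h (i :: l) (by simpa using hl)
    · intro h l hl
      cases l with
      | nil => exact mem_pointIdeal_iff.1 (Ideal.pow_le_self (by simp) h)
      | cons i l => exact ih.2 (pderiv_mem_pow h i) l (by simpa using hl)

lemma mem_sq_iff {n : ℕ} {v : Fin n → ℂ} {f : MvPolynomial (Fin n) ℂ} :
    f ∈ pointIdeal v ^ 2 ↔ eval v f = 0 ∧ ∀ i, eval v (pderiv i f) = 0 := by
  simp_rw [← mem_pointIdeal_iff]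
  constructor
  · intro h
    exact ⟨Ideal.pow_le_self (by simp) h, fun i => by simpa using pderiv_mem_pow h i⟩
  · rintro ⟨h0, h⟩
    exact mem_pow_succ_of_pderiv (mem_pointIdeal_iff.1 h0) (by simpa using h)

lemma euler_aeval {n d : ℕ} {R : Type*} [CommRing R] [Algebra ℂ R]
    {f : MvPolynomial (Fin n) ℂ} (hf : f.IsHomogeneous d) (χ : Fin n → R) :
    ∑ i, χ i * aeval χ (pderiv i f) = d * aeval χ f := by
  have := congrArg (aeval χ) hf.sum_X_mul_pderiv
  simpa using this

lemma eval_pderiv_of_homogeneous {n d : ℕ} (hd : d ≠ 0) {v : Fin n → ℂ}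
    {f : MvPolynomial (Fin n) ℂ} (hf : f.IsHomogeneous d) :
    f ∈ pointIdeal v ^ 2 ↔ ∀ i, eval v (pderiv i f) = 0 := by
  rw [mem_sq_iff, and_iff_right_of_imp]
  intro h
  have := euler_aeval hf v
  simpa [coe_aeval_eq_eval, h, hd] using this

lemma substMatrix_mem_pow {n : ℕ} {M : Matrix (Fin n) (Fin n) ℂ} {v : Fin n → ℂ} {k : ℕ}
    {f : MvPolynomial (Fin n) ℂ} (hf : f ∈ pointIdeal (M.mulVec v) ^ k) :
    substMatrix M f ∈ pointIdeal v ^ k := by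
  refine aeval_mem_pow hf _ _ fun i => ?_
  have : ∑ j, C (M i j) * X j - algebraMap ℂ (MvPolynomial (Fin n) ℂ) (M.mulVec v i)
      = ∑ j, C (M i j) * (X j - C (v j)) := by
    simp [Matrix.mulVec, dotProduct, algebraMap_eq, mul_sub]
  rw [this]
  exact Ideal.sum_mem _ fun j _ => Ideal.mul_mem_left _ _ (Ideal.subset_span ⟨j, rfl⟩)

lemma eval_substMatrix {n : ℕ} (M : Matrix (Fin n) (Fin n) ℂ) (v : Fin n → ℂ)
    (f : MvPolynomial (Fin n) ℂ) : eval v (substMatrix M f) = eval (M.mulVec v) f := by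
  rw [← coe_aeval_eq_eval, ← coe_aeval_eq_eval]
  change (aeval v : MvPolynomial (Fin n) ℂ →ₐ[ℂ] ℂ) (aeval _ f) = _
  rw [comp_aeval_apply]
  simp [coe_aeval_eq_eval]
  rfl

lemma substMatrix_inv {n : ℕ} {M : Matrix (Fin n) (Fin n) ℂ} (hM : IsUnit M.det)
    (f : MvPolynomial (Fin n) ℂ) : substMatrix M⁻¹ (substMatrix M f) = f := by
  refine MvPolynomial.funext fun v => ?_
  simp [eval_substMatrix, Matrix.mul_nonsing_inv _ hM]

lemma substMatrix_isHomogeneous {n d : ℕ} (M : Matrix (Fin n) (Fin n) ℂ)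
    {f : MvPolynomial (Fin n) ℂ} (hf : f.IsHomogeneous d) :
    (substMatrix M f).IsHomogeneous d := by
  have := hf.aeval (fun i => ∑ j, C (M i j) * X j) (n := 1) fun i =>
    IsHomogeneous.sum _ _ _ fun j _ => isHomogeneous_C_mul_X _ _
  simpa [substMatrix] using this

lemma aeval_smul_of_homogeneous {n d : ℕ} {R : Type*} [CommRing R] [Algebra ℂ R]
    {f : MvPolynomial (Fin n) ℂ} (hf : f.IsHomogeneous d) (r : R) (χ : Fin n → R) :
    aeval (fun i => r * χ i) f = r ^ d * aeval χ f := by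
  rw [aeval_def, aeval_def, eval₂_eq, eval₂_eq, Finset.mul_sum]
  refine Finset.sum_congr rfl fun m hm => ?_
  simp only [mul_pow, Finset.prod_mul_distrib, Finset.prod_pow_eq_pow_sum]
  rw [← hf.degree_eq_sum_deg_support hm]
  ring_nf

lemma smul_mem_pow {n d : ℕ} {v : Fin n → ℂ} {k : ℕ} {c : ℂ} (hc : c ≠ 0)
    {f : MvPolynomial (Fin n) ℂ} (hf : f.IsHomogeneous d) (h : f ∈ pointIdeal v ^ k) :
    f ∈ pointIdeal (c • v) ^ k := by
  have h1 := aeval_mem_pow h (fun i => C c⁻¹ * X i) (pointIdeal (c • v)) fun i => by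
    have : C c⁻¹ * X i - algebraMap ℂ (MvPolynomial (Fin n) ℂ) (v i)
        = C c⁻¹ * (X i - C ((c • v) i)) := by
      rw [mul_sub, ← C_mul]
      simp [hc, algebraMap_eq]
    rw [this]
    exact Ideal.mul_mem_left _ _ (Ideal.subset_span ⟨i, rfl⟩)
  rw [aeval_smul_of_homogeneous hf, aeval_X_left_apply, ← C_pow] at h1
  have h2 := Ideal.mul_mem_left _ (C (c ^ d)) h1
  rwa [← mul_assoc, ← C_mul, ← mul_pow, mul_inv_cancel₀ hc, one_pow, C_1, one_mul] at h2

lemma eq_zero_of_pow_dvd {ι : Type*} (S : Finset ι) (s : ι → ℂ) (hs : Set.InjOn s S) (k : ι → ℕ)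
    {P G : Polynomial ℂ} {d : ℕ} (hd : P.natDegree ≤ d) (hG : G ∣ P)
    (hGs : ∀ i ∈ S, G.eval (s i) ≠ 0)
    (h : ∀ i ∈ S, (Polynomial.X - Polynomial.C (s i)) ^ k i ∣ P)
    (hlt : d < G.natDegree + ∑ i ∈ S, k i) : P = 0 := by
  by_contra hP
  have h1 : ∏ i ∈ S, (Polynomial.X - Polynomial.C (s i)) ^ k i ∣ P := by
    refine Finset.prod_dvd_of_coprime ?_ h
    intro i hi j hj hij
    exact (Polynomial.isCoprime_X_sub_C_of_isUnit_sub
      (sub_ne_zero.2 fun he => hij (hs hi hj he)).isUnit).pow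
  have h2 : IsCoprime G (∏ i ∈ S, (Polynomial.X - Polynomial.C (s i)) ^ k i) := by
    refine IsCoprime.prod_right fun i hi => IsCoprime.pow_right ?_
    rw [isCoprime_comm]
    refine (Polynomial.irreducible_X_sub_C (s i)).coprime_iff_not_dvd.2 fun hdvd => ?_
    exact hGs i hi (Polynomial.dvd_iff_isRoot.1 hdvd)
  have h3 := Polynomial.natDegree_le_of_dvd (h2.mul_dvd hG h1) hP
  have h4 : (∏ i ∈ S, (Polynomial.X - Polynomial.C (s i)) ^ k i).Monic :=
    Polynomial.monic_prod_of_monic _ _ fun i _ => (Polynomial.monic_X_sub_C _).pow _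
  have hG0 : G ≠ 0 := by
    rintro rfl
    exact hP (zero_dvd_iff.1 hG)
  rw [Polynomial.natDegree_mul hG0 h4.ne_zero, Polynomial.natDegree_prod_of_monic _ _
    fun i _ => (Polynomial.monic_X_sub_C _).pow _] at h3
  simp only [Polynomial.natDegree_pow, Polynomial.natDegree_X_sub_C, mul_one] at h3
  omega

lemma pow_dvd_aeval {n k : ℕ} {v : Fin n → ℂ} {f : MvPolynomial (Fin n) ℂ}
    (hf : f ∈ pointIdeal v ^ k) {χ : Fin n → Polynomial ℂ} {s : ℂ}
    (hχ : ∀ i, (χ i).eval s = v i) : (Polynomial.X - Polynomial.C s) ^ k ∣ aeval χ f := by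
  have := aeval_mem_pow hf χ (Ideal.span {Polynomial.X - Polynomial.C s}) fun i => by
    rw [Ideal.mem_span_singleton, Polynomial.dvd_iff_isRoot]
    simp [hχ]
  rwa [Ideal.span_singleton_pow, Ideal.mem_span_singleton] at this

lemma eval_aeval {n : ℕ} (f : MvPolynomial (Fin n) ℂ) (χ : Fin n → Polynomial ℂ) (s : ℂ) :
    (aeval χ f).eval s = MvPolynomial.eval (fun i => (χ i).eval s) f := by
  have := comp_aeval_apply χ (Polynomial.aeval s : Polynomial ℂ →ₐ[ℂ] ℂ) f
  simpa [Polynomial.coe_aeval_eq_eval, coe_aeval_eq_eval] using this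

lemma natDegree_aeval_le {n d m : ℕ} {f : MvPolynomial (Fin n) ℂ} (hf : f.IsHomogeneous d)
    {χ : Fin n → Polynomial ℂ} (hχ : ∀ i, (χ i).natDegree ≤ m) :
    (aeval χ f).natDegree ≤ d * m :=
  aeval_natDegree_le f hf.totalDegree_le χ hχ

/-- `f` is a sextic form whose singular points are the nine distinct points `p i`, all of
multiplicity at least three. -/
structure IsNine (f : MvPolynomial (Fin 4) ℂ) (p : Fin 9 → Fin 4 → ℂ) : Prop where
  homog : f.IsHomogeneous 6
  indep : ∀ i j, i ≠ j → ∀ c : ℂ, p i ≠ c • p j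
  triple : ∀ i, f ∈ pointIdeal (p i) ^ 3
  singular : ∀ v ≠ 0, f ∈ pointIdeal v ^ 2 → ∃ i, ∃ c : ℂ, v = c • p i

namespace IsNine

variable {f : MvPolynomial (Fin 4) ℂ} {p : Fin 9 → Fin 4 → ℂ}

lemma ne_zero (h : IsNine f p) (i : Fin 9) : p i ≠ 0 := by
  obtain ⟨j, hj⟩ := exists_ne i
  intro h0
  exact h.indep i j hj.symm 0 (by simp [h0])

lemma pair (h : IsNine f p) {i j : Fin 9} (hij : i ≠ j) {a b : ℂ}
    (hab : a • p i + b • p j = 0) : a = 0 ∧ b = 0 := by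
  have ha : a = 0 := by
    by_contra ha
    refine h.indep i j hij (-(a⁻¹ * b)) ?_
    have := congrArg (a⁻¹ • ·) hab
    simp only [smul_add, smul_smul, inv_mul_cancel₀ ha, one_smul, smul_zero] at this
    rw [neg_smul]
    exact eq_neg_of_add_eq_zero_left this
  refine ⟨ha, ?_⟩
  have := h.ne_zero j
  simp_all

lemma subst (h : IsNine f p) {M : Matrix (Fin 4) (Fin 4) ℂ} (hM : IsUnit M.det)
    {p' : Fin 9 → Fin 4 → ℂ} (hp : ∀ i, M.mulVec (p' i) = p i) : IsNine (substMatrix M f) p' where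
  homog := substMatrix_isHomogeneous _ h.homog
  indep i j hij c hc := h.indep i j hij c (by rw [← hp, ← hp, hc, Matrix.mulVec_smul])
  triple i := substMatrix_mem_pow (by rw [hp]; exact h.triple i)
  singular v hv hs := by
    have hinv : M⁻¹.mulVec (M.mulVec v) = v := by simp [Matrix.nonsing_inv_mul _ hM]
    have h1 : f ∈ pointIdeal (M.mulVec v) ^ 2 := by
      rw [← substMatrix_inv hM f]
      exact substMatrix_mem_pow (by rwa [hinv])
    obtain ⟨i, c, hc⟩ := h.singular _ (fun h0 => hv (by rw [← hinv, h0, Matrix.mulVec_zero])) h1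
    refine ⟨i, c, ?_⟩
    rw [← hinv, hc, Matrix.mulVec_smul, ← hp]
    simp [Matrix.nonsing_inv_mul _ hM]

lemma rescale (h : IsNine f p) {c : Fin 9 → ℂ} (hc : ∀ i, c i ≠ 0) :
    IsNine f (fun i => c i • p i) where
  homog := h.homog
  indep i j hij d hd := h.indep i j hij ((c i)⁻¹ * (d * c j)) (by
    rw [mul_smul, mul_smul, ← hd, smul_smul, inv_mul_cancel₀ (hc i), one_smul])
  triple i := smul_mem_pow (hc i) h.homog (h.triple i)
  singular v hv hs := by
    obtain ⟨i, d, hd⟩ := h.singular v hv hs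
    exact ⟨i, d * (c i)⁻¹, by rw [smul_smul, mul_assoc, inv_mul_cancel₀ (hc i), mul_one, hd]⟩

/-- The singular locus contains no infinite family of distinct points. -/
lemma not_infinite (h : IsNine f p) {S : Set ℂ} (hS : S.Infinite) (γ : ℂ → Fin 4 → ℂ)
    (h0 : ∀ s ∈ S, γ s ≠ 0) (hinj : ∀ s ∈ S, ∀ t ∈ S, ∀ c : ℂ, γ s = c • γ t → s = t)
    (hs : ∀ s ∈ S, ∀ j, eval (γ s) (pderiv j f) = 0) : False := by
  have h1 : ∀ s : S, ∃ i, ∃ c : ℂ, γ s = c • p i := fun s =>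
    h.singular _ (h0 s s.2) ((eval_pderiv_of_homogeneous (by norm_num) h.homog).2 (hs s s.2))
  choose i c hc using h1
  have := hS.to_subtype
  obtain ⟨s, t, hst, he⟩ := Finite.exists_ne_map_eq_of_infinite i
  refine hst (Subtype.ext (hinj s s.2 t t.2 (c s * (c t)⁻¹) ?_))
  have hct : c t ≠ 0 := by
    intro hz
    exact h0 t t.2 (by simp [hc, hz])
  rw [hc t, smul_smul, mul_assoc, inv_mul_cancel₀ hct, mul_one, ← he, hc s]

lemma pderiv_mem (h : IsNine f p) (i : Fin 9) (l : Fin 4) : pderiv l f ∈ pointIdeal (p i) ^ 2 :=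
  pderiv_mem_pow (h.triple i) l

lemma homog_pderiv (h : IsNine f p) (l : Fin 4) : (pderiv l f).IsHomogeneous 5 :=
  h.homog.pderiv

/-- No three of the nine points are collinear. -/
lemma not_collinear (h : IsNine f p) {i j k : Fin 9} (hij : i ≠ j) (hik : i ≠ k) (hjk : j ≠ k)
    (a b : ℂ) : p k ≠ a • p i + b • p j := by
  intro hk
  have ha : a ≠ 0 := by
    rintro rfl
    exact h.indep k j hjk.symm b (by simpa using hk)
  have hb : b ≠ 0 := by
    rintro rfl
    exact h.indep k i hik.symm a (by simpa using hk)
  have hz : ∀ x y : ℂ, x • (a • p i) + y • (b • p j) = 0 → x = 0 ∧ y = 0 := by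
    intro x y hxy
    rw [smul_smul, smul_smul] at hxy
    simpa [ha, hb] using h.pair hij hxy
  set χ : Fin 4 → Polynomial ℂ := fun l =>
    Polynomial.C (a * p i l) + Polynomial.X * Polynomial.C (a * p i l + 2 * (b * p j l)) with hχ
  have hχs : ∀ s, (fun l => (χ l).eval s) = (1 + s) • (a • p i) + (2 * s) • (b • p j) := by
    intro s
    ext l
    simp [hχ]
    ring
  have hdeg : ∀ l, (χ l).natDegree ≤ 1 := by
    intro l
    simp only [hχ]
    compute_degree
  have hzero : ∀ l, aeval χ (pderiv l f) = 0 := by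
    intro l
    have key : ∀ (m : Fin 9) (c s : ℂ), c ≠ 0 →
        (1 + s) • (a • p i) + (2 * s) • (b • p j) = c • p m →
        (Polynomial.X - Polynomial.C s) ^ 2 ∣ aeval χ (pderiv l f) := by
      intro m c s hc hm
      refine pow_dvd_aeval (smul_mem_pow hc (h.homog_pderiv l) (h.pderiv_mem m l)) fun r => ?_
      rw [← hm, ← hχs]
    refine eq_zero_of_pow_dvd (Finset.univ : Finset (Fin 3)) ![0, -1, 1] ?_ (fun _ => 2) (G := 1)
      (natDegree_aeval_le (h.homog_pderiv l) hdeg) (one_dvd _) (by simp) ?_ (by simp)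
    · intro x _ y _
      fin_cases x <;> fin_cases y <;> norm_num
    · intro x _
      fin_cases x
      · exact key i a 0 ha (by simp)
      · refine key j (-2 * b) (-1) (by simpa using hb) (by simp [smul_smul])
      · refine key k 2 1 (by norm_num) ?_
        rw [hk]
        module
  refine h.not_infinite Set.infinite_univ (fun s => fun l => (χ l).eval s) ?_ ?_ ?_
  · intro s _ h0
    obtain ⟨h1, h2⟩ := hz _ _ ((hχs s).symm.trans h0)
    have : s = 0 := by simpa using h2
    simp [this] at h1
  · intro s _ t _ c hc
    simp only [hχs] at hc
    obtain ⟨h1, h2⟩ := hz ((1 + s) - c * (1 + t)) (2 * s - c * (2 * t)) (by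
      rw [sub_smul, sub_smul, mul_smul c, mul_smul c, ← sub_eq_zero.2 hc]
      module)
    have : c = 1 := by linear_combination h2 / 2 - h1
    subst this
    linear_combination h1
  · intro s _ l
    rw [← eval_aeval, hzero]
    simp

lemma linearIndependent (h : IsNine f p) {i j k : Fin 9} (hij : i ≠ j) (hik : i ≠ k)
    (hjk : j ≠ k) : LinearIndependent ℂ ![p i, p j, p k] := by
  rw [Fintype.linearIndependent_iff]
  intro g hg
  simp only [Fin.sum_univ_three, Matrix.cons_val] at hg
  have h2 : g 2 = 0 := by
    by_contra h2
    refine h.not_collinear hij hik hjk (-(g 2)⁻¹ * g 0) (-(g 2)⁻¹ * g 1) ?_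
    have : p k = (g 2)⁻¹ • (g 2 • p k) := by simp [smul_smul, h2]
    rw [this, eq_neg_of_add_eq_zero_right hg]
    module
  rw [h2, zero_smul, add_zero] at hg
  obtain ⟨h0, h1⟩ := h.pair hij hg
  intro l
  fin_cases l <;> assumption

lemma not_three_mem (h : IsNine f p) (U : Submodule ℂ (Fin 4 → ℂ)) (hU : Module.finrank ℂ U ≤ 2)
    {i j k : Fin 9} (hij : i ≠ j) (hik : i ≠ k) (hjk : j ≠ k) (hi : p i ∈ U) (hj : p j ∈ U)
    (hk : p k ∈ U) : False := by
  have hl := h.linearIndependent hij hik hjk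
  have h3 := finrank_span_eq_card hl
  have h4 : Submodule.span ℂ (Set.range ![p i, p j, p k]) ≤ U := by
    rw [Submodule.span_le]
    rintro _ ⟨l, rfl⟩
    fin_cases l <;> assumption
  have := Submodule.finrank_mono h4
  simp at h3
  omega

end IsNine

lemma exists_quadraticForm {n : ℕ} {q : MvPolynomial (Fin n) ℂ} (hq : q.IsHomogeneous 2) :
    ∃ Q : QuadraticForm ℂ (Fin n → ℂ), ∀ v, Q v = eval v q := by
  rw [← mem_homogeneousSubmodule, ← homogeneousSubmodule_one_pow, sq,
    homogeneousSubmodule_one_eq_span_X, Submodule.span_mul_span] at hq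
  induction hq using Submodule.span_induction with
  | mem x hx =>
    obtain ⟨_, ⟨i, rfl⟩, _, ⟨j, rfl⟩, rfl⟩ := hx
    exact ⟨QuadraticMap.linMulLin (LinearMap.proj i) (LinearMap.proj j), fun v => by simp⟩
  | zero => exact ⟨0, by simp⟩
  | add x y _ _ hx hy =>
    obtain ⟨Q, hQ⟩ := hx
    obtain ⟨R, hR⟩ := hy
    exact ⟨Q + R, by simp [hQ, hR]⟩
  | smul a x _ hx =>
    obtain ⟨Q, hQ⟩ := hx
    exact ⟨a • Q, by simp [hQ]⟩

lemma exists_ne_zero_forall_sum_eq_zero {V : Type*} {m n : ℕ} (hmn : m < n)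
    (g : Fin n → V → ℂ) (t : Fin m → V) :
    ∃ c : Fin n → ℂ, c ≠ 0 ∧ ∀ i, ∑ k, c k * g k (t i) = 0 := by
  set L : (Fin n → ℂ) →ₗ[ℂ] (Fin m → ℂ) := Matrix.mulVecLin (Matrix.of fun i k => g k (t i))
  obtain ⟨c, hc, h0⟩ := Submodule.exists_mem_ne_zero_of_ne_bot
    (LinearMap.ker_ne_bot_of_finrank_lt (f := L) (by simpa using hmn))
  refine ⟨c, h0, fun i => ?_⟩
  have := congrFun (LinearMap.mem_ker.1 hc) i
  simpa [L, Matrix.mulVec, dotProduct, mul_comm] using this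

lemma exists_quadric (t : Fin 9 → Fin 4 → ℂ) :
    ∃ q : MvPolynomial (Fin 4) ℂ, q ≠ 0 ∧ q.IsHomogeneous 2 ∧ ∀ i, eval (t i) q = 0 := by
  set m : Fin 10 → MvPolynomial (Fin 4) ℂ := ![X 0 * X 0, X 1 * X 1, X 2 * X 2, X 3 * X 3,
    X 0 * X 1, X 0 * X 2, X 0 * X 3, X 1 * X 2, X 1 * X 3, X 2 * X 3] with hm
  obtain ⟨c, hc, hct⟩ := exists_ne_zero_forall_sum_eq_zero (by norm_num)
    (fun k v => eval v (m k)) t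
  refine ⟨∑ k, C (c k) * m k, fun h0 => hc ?_, IsHomogeneous.sum _ _ _ fun k _ => ?_, fun i => ?_⟩
  · have key : ∀ v, ∑ k, c k * eval v (m k) = 0 := fun v => by
      simpa using congrArg (eval v) h0
    simp only [Fin.sum_univ_succ, hm] at key
    have h1 := key ![1, 0, 0, 0]
    have h2 := key ![0, 1, 0, 0]
    have h3 := key ![0, 0, 1, 0]
    have h4 := key ![0, 0, 0, 1]
    have h5 := key ![1, 1, 0, 0]
    have h6 := key ![1, 0, 1, 0]
    have h7 := key ![1, 0, 0, 1]
    have h8 := key ![0, 1, 1, 0]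
    have h9 := key ![0, 1, 0, 1]
    have h10 := key ![0, 0, 1, 1]
    simp at h1 h2 h3 h4 h5 h6 h7 h8 h9 h10
    ext k
    fin_cases k <;> simp_all
  · refine IsHomogeneous.C_mul ?_ _
    fin_cases k <;> exact (isHomogeneous_X _ _).mul (isHomogeneous_X _ _)
  · simpa using hct i

lemma exists_eval_ne_zero {ι : Type*} [Finite ι] (P : ι → Polynomial ℂ) (hP : ∀ i, P i ≠ 0) :
    ∃ x : ℂ, ∀ i, (P i).eval x ≠ 0 := by
  cases nonempty_fintype ι
  by_contra! h
  refine Finset.prod_ne_zero_iff.2 (fun i _ => hP i : ∀ i ∈ Finset.univ, P i ≠ 0) ?_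
  refine Polynomial.funext fun x => ?_
  obtain ⟨i, hi⟩ := h x
  rw [Polynomial.eval_prod, Finset.prod_eq_zero (Finset.mem_univ i) hi, Polynomial.eval_zero]

section ternary

variable {V : Type*} [AddCommGroup V] [Module ℂ V]

/-- A ternary quadratic form over `ℂ` is a product of linear forms or equivalent to
`x z - y ^ 2`. -/
lemma ternary_normal_form (hV : Module.finrank ℂ V = 3) (Q : QuadraticForm ℂ V) :
    (∃ l₁ l₂ : V →ₗ[ℂ] ℂ, ∀ v, Q v = l₁ v * l₂ v) ∨
      ∃ b : Module.Basis (Fin 3) ℂ V, ∀ x y z : ℂ,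
        Q (x • b 0 + y • b 1 + z • b 2) = x * z - y ^ 2 := by
  have : FiniteDimensional ℂ V := Module.finite_of_finrank_pos (by omega)
  obtain ⟨w, ⟨φ⟩⟩ := QuadraticForm.equivalent_weightedSumSquares Q
  have hV' := hV
  generalize Module.finrank ℂ V = n at w φ hV'
  subst hV'
  have hQ : ∀ v, Q v = ∑ i, w i * (φ v i * φ v i) := fun v => by
    rw [← φ.map_app, QuadraticMap.weightedSumSquares_apply]
    simp
  have hr : ∀ i, ∃ r, r * r = w i := fun i => by
    obtain ⟨r, hr⟩ := IsAlgClosed.exists_pow_nat_eq (w i) two_pos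
    exact ⟨r, by rw [← hr, sq]⟩
  choose r hr using hr
  set ψ : V ≃ₗ[ℂ] (Fin 3 → ℂ) := φ.toLinearEquiv
  have hψ : ∀ v, φ v = ψ v := fun v => rfl
  simp only [Fin.sum_univ_three, hψ] at hQ
  by_cases h0 : ∀ i, r i ≠ 0
  · right
    have hQs : ∀ u : Fin 3 → ℂ, Q (ψ.symm u)
        = w 0 * (u 0 * u 0) + w 1 * (u 1 * u 1) + w 2 * (u 2 * u 2) := fun u => by
      rw [hQ, ψ.apply_symm_apply]
    set e : Fin 3 → V := ![ψ.symm ![(2 * r 0)⁻¹, 0, (2 * r 2 * Complex.I)⁻¹],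
      ψ.symm ![0, (r 1 * Complex.I)⁻¹, 0], ψ.symm ![(2 * r 0)⁻¹, 0, -(2 * r 2 * Complex.I)⁻¹]]
      with he
    have hsum : ∀ x y z : ℂ, x • e 0 + y • e 1 + z • e 2 = ψ.symm ![(x + z) * (2 * r 0)⁻¹,
        y * (r 1 * Complex.I)⁻¹, (x - z) * (2 * r 2 * Complex.I)⁻¹] := by
      intro x y z
      simp only [he, Matrix.cons_val, ← map_smul, ← map_add]
      congr 1
      ext i
      fin_cases i <;> simp <;> ring
    have hI := Complex.I_ne_zero
    have hl : LinearIndependent ℂ e := by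
      rw [Fintype.linearIndependent_iff]
      intro g hg
      rw [Fin.sum_univ_three, hsum, LinearEquiv.map_eq_zero_iff] at hg
      have e0 := congrFun hg 0
      have e1 := congrFun hg 1
      have e2 := congrFun hg 2
      simp [h0] at e0 e1 e2
      intro i
      fin_cases i
      · change g 0 = 0
        linear_combination (e0 + e2) / 2
      · exact e1
      · change g 2 = 0
        linear_combination (e0 - e2) / 2
    refine ⟨basisOfLinearIndependentOfCardEqFinrank hl (by simp [hV]), fun x y z => ?_⟩
    simp only [coe_basisOfLinearIndependentOfCardEqFinrank, hsum, hQs, ← hr, Matrix.cons_val]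
    have := h0 0
    have := h0 1
    have := h0 2
    field_simp
    simp only [Complex.I_sq]
    ring
  · left
    push Not at h0
    obtain ⟨i, hi⟩ := h0
    have hw : w i = 0 := by rw [← hr, hi, zero_mul]
    set L : Fin 3 → V →ₗ[ℂ] ℂ := fun j => r j • (LinearMap.proj j ∘ₗ ψ.toLinearMap) with hL
    have hLv : ∀ j v, L j v * L j v = w j * (ψ v j * ψ v j) := fun j v => by
      simp [hL, ← hr]
      ring
    have hfac : ∀ a b v, L a v * L a v + L b v * L b v
        = (L a + Complex.I • L b) v * (L a - Complex.I • L b) v := fun a b v => by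
      simp only [LinearMap.add_apply, LinearMap.sub_apply, LinearMap.smul_apply, smul_eq_mul]
      linear_combination (L b v * L b v) * Complex.I_sq
    fin_cases i
    · refine ⟨L 1 + Complex.I • L 2, L 1 - Complex.I • L 2, fun v => ?_⟩
      rw [← hfac 1 2, hLv, hLv, hQ]
      simp_all
    · refine ⟨L 0 + Complex.I • L 2, L 0 - Complex.I • L 2, fun v => ?_⟩
      rw [← hfac 0 2, hLv, hLv, hQ]
      simp_all
    · refine ⟨L 0 + Complex.I • L 1, L 0 - Complex.I • L 1, fun v => ?_⟩
      rw [← hfac 0 1, hLv, hLv, hQ]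
      simp_all

lemma exists_rotated_basis {Q : QuadraticForm ℂ V} (b : Module.Basis (Fin 3) ℂ V)
    (hb : ∀ x y z : ℂ, Q (x • b 0 + y • b 1 + z • b 2) = x * z - y ^ 2)
    {ι : Type*} [Finite ι] (t : ι → V) (ht : ∀ i, t i ≠ 0) (β : V →ₗ[ℂ] ℂ) :
    ∃ b : Module.Basis (Fin 3) ℂ V,
      (∀ x y z : ℂ, Q (x • b 0 + y • b 1 + z • b 2) = x * z - y ^ 2) ∧
      (∀ i, ∀ x y z : ℂ, t i = x • b 0 + y • b 1 + z • b 2 → z ≠ 0) ∧ (β ≠ 0 → β (b 0) ≠ 0) := by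
  have hV : Module.finrank ℂ V = 3 := by simpa using Module.finrank_eq_card_basis b
  classical
  set P : Option ι → Polynomial ℂ := fun o => o.elim
    (if β = 0 then 1 else Polynomial.C (β (b 0)) + Polynomial.X * Polynomial.C (β (b 1))
      + Polynomial.X ^ 2 * Polynomial.C (β (b 2)))
    (fun i => Polynomial.C (b.repr (t i) 2) - Polynomial.X * Polynomial.C (2 * b.repr (t i) 1)
      + Polynomial.X ^ 2 * Polynomial.C (b.repr (t i) 0)) with hP
  have hcoeff : ∀ x y z : ℂ, (Polynomial.C x + Polynomial.X * Polynomial.C y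
      + Polynomial.X ^ 2 * Polynomial.C z) = 0 → x = 0 ∧ y = 0 ∧ z = 0 := by
    intro x y z h
    have h0 := congrArg (Polynomial.coeff · 0) h
    have h1 := congrArg (Polynomial.coeff · 1) h
    have h2 := congrArg (Polynomial.coeff · 2) h
    simp [Polynomial.coeff_X, Polynomial.coeff_C, Polynomial.coeff_X_pow] at h0 h1 h2
    exact ⟨h0, h1, h2⟩
  obtain ⟨r, hr⟩ := exists_eval_ne_zero P (by
    rintro (_ | i)
    · simp only [hP, Option.elim]
      split_ifs with hβ
      · exact one_ne_zero
      · intro h0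
        obtain ⟨h0, h1, h2⟩ := hcoeff _ _ _ h0
        refine hβ (b.ext fun i => ?_)
        fin_cases i <;> simpa
    · simp only [hP, Option.elim]
      intro h0
      rw [sub_eq_add_neg, ← mul_neg, ← Polynomial.C_neg] at h0
      obtain ⟨h0, h1, h2⟩ := hcoeff _ _ _ h0
      refine ht i (b.ext_elem fun j => ?_)
      have h1 : b.repr (t i) 1 = 0 := by simpa using h1
      rw [map_zero, Finsupp.zero_apply]
      fin_cases j <;> assumption)
  set e : Fin 3 → V := ![b 0 + r • b 1 + r ^ 2 • b 2, b 1 + (2 * r) • b 2, b 2] with he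
  have hsum : ∀ x y z : ℂ, x • e 0 + y • e 1 + z • e 2
      = x • b 0 + (r * x + y) • b 1 + (r ^ 2 * x + 2 * r * y + z) • b 2 := by
    intro x y z
    simp only [he, Matrix.cons_val]
    module
  have hrepr : ∀ x y z : ℂ, ∀ j, b.repr (x • b 0 + y • b 1 + z • b 2) j = ![x, y, z] j := by
    intro x y z j
    fin_cases j <;> simp
  have hl : LinearIndependent ℂ e := by
    rw [Fintype.linearIndependent_iff]
    intro g hg
    rw [Fin.sum_univ_three, hsum] at hg
    have hb := Fintype.linearIndependent_iff.1 b.linearIndependent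
      ![g 0, r * g 0 + g 1, r ^ 2 * g 0 + 2 * r * g 1 + g 2] (by
        simpa [Fin.sum_univ_three] using hg)
    have e0 := hb 0
    have e1 := hb 1
    have e2 := hb 2
    simp at e0
    simp [e0] at e1
    simp [e0, e1] at e2
    intro i
    fin_cases i <;> assumption
  refine ⟨basisOfLinearIndependentOfCardEqFinrank hl (by simp [hV]), ?_, ?_, ?_⟩
  · intro x y z
    simp only [coe_basisOfLinearIndependentOfCardEqFinrank, hsum, hb]
    ring
  · rintro i x y z hi rfl
    simp only [coe_basisOfLinearIndependentOfCardEqFinrank, hsum] at hi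
    refine hr (some i) ?_
    simp only [hP, Option.elim, hi, hrepr, Matrix.cons_val, Polynomial.eval_add,
      Polynomial.eval_sub, Polynomial.eval_mul, Polynomial.eval_C, Polynomial.eval_X,
      Polynomial.eval_pow]
    ring
  · intro hβ
    have := hr none
    simp only [hP, Option.elim, if_neg hβ] at this
    simp at this
    simp only [coe_basisOfLinearIndependentOfCardEqFinrank, he, Matrix.cons_val, map_add, map_smul,
      smul_eq_mul]
    intro h0
    exact this (by linear_combination h0)

end ternary

lemma exists_matrix_of_basis {W : Submodule ℂ (Fin 4 → ℂ)} (b : Module.Basis (Fin 3) ℂ W)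
    {e : Fin 4 → ℂ} (he : e ∉ W) : ∃ M : Matrix (Fin 4) (Fin 4) ℂ, IsUnit M.det ∧
      ∀ x, M.mulVec x = ((x 0 • b 0 + x 1 • b 1 + x 2 • b 2 : W) : Fin 4 → ℂ) + x 3 • e := by
  set M : Matrix (Fin 4) (Fin 4) ℂ :=
    Matrix.of fun i j => (![(b 0 : Fin 4 → ℂ), b 1, b 2, e] j) i
  have hM : ∀ x, M.mulVec x
      = ((x 0 • b 0 + x 1 • b 1 + x 2 • b 2 : W) : Fin 4 → ℂ) + x 3 • e := by
    intro x
    ext i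
    simp [M, Matrix.mulVec, dotProduct, Fin.sum_univ_four]
    ring
  refine ⟨M, ?_, hM⟩
  rw [← Matrix.isUnit_iff_isUnit_det, ← Matrix.mulVec_injective_iff_isUnit]
  change Function.Injective M.mulVecLin
  rw [← LinearMap.ker_eq_bot, LinearMap.ker_eq_bot']
  intro x hx
  rw [Matrix.mulVecLin_apply, hM] at hx
  have h3 : x 3 = 0 := by
    by_contra h3
    refine he ?_
    have h1 : x 3 • e ∈ W := by
      rw [eq_neg_of_add_eq_zero_right hx]
      exact W.neg_mem (Subtype.property _)
    exact (W.smul_mem_iff h3).1 h1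
  rw [h3, zero_smul, add_zero, Submodule.coe_eq_zero] at hx
  have hb := Fintype.linearIndependent_iff.1 b.linearIndependent ![x 0, x 1, x 2] (by
    simpa [Fin.sum_univ_three] using hx)
  ext i
  fin_cases i
  · exact hb 0
  · exact hb 1
  · exact hb 2
  · exact h3

lemma pderiv_comm {n : ℕ} (i j : Fin n) (f : MvPolynomial (Fin n) ℂ) :
    pderiv i (pderiv j f) = pderiv j (pderiv i f) := by
  induction f using MvPolynomial.induction_on with
  | C a => simp
  | add p q hp hq => simp [hp, hq]
  | mul_X p k hp =>
    have h0 : ∀ a b : Fin n, pderiv a (pderiv b (X k : MvPolynomial (Fin n) ℂ)) = 0 := by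
      intro a b
      by_cases hb : k = b
      · subst hb
        simp
      · simp [pderiv_X_of_ne hb]
    simp only [pderiv_mul, map_add, hp, h0]
    ring

/-- The parametrised conic `x z = y ^ 2` in the plane `x₃ = 0`. -/
def conic : Fin 4 → Polynomial ℂ := ![Polynomial.X ^ 2, Polynomial.X, 1, 0]

lemma conic_eval (s : ℂ) : (fun i => (conic i).eval s) = ![s ^ 2, s, 1, 0] := by
  ext i
  fin_cases i <;> simp [conic]

lemma conic_natDegree (i : Fin 4) : (conic i).natDegree ≤ 2 := by
  fin_cases i <;> simp [conic]

lemma derivative_aeval {n : ℕ} (χ : Fin n → Polynomial ℂ) (f : MvPolynomial (Fin n) ℂ) :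
    Polynomial.derivative (aeval χ f)
      = ∑ i, aeval χ (pderiv i f) * Polynomial.derivative (χ i) :=
  derivation_aeval Polynomial.derivative' χ f

lemma conic_pderiv {d : ℕ} {F : MvPolynomial (Fin 4) ℂ} (hF : F.IsHomogeneous d)
    (h0 : aeval conic F = 0) :
    aeval conic (pderiv 1 F) = -2 * Polynomial.X * aeval conic (pderiv 0 F) ∧
    aeval conic (pderiv 2 F) = Polynomial.X ^ 2 * aeval conic (pderiv 0 F) := by
  have h1 := euler_aeval hF conic
  have h2 := derivative_aeval conic F
  rw [h0] at h1 h2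
  simp [Fin.sum_univ_four, conic] at h1 h2
  rw [← conic] at h1 h2
  constructor
  · linear_combination -h2
  · linear_combination h1 + Polynomial.X * h2

lemma conic_pow_dvd {k : ℕ} {F : MvPolynomial (Fin 4) ℂ} {s : ℂ}
    (h : F ∈ pointIdeal ![s ^ 2, s, 1, 0] ^ k) :
    (Polynomial.X - Polynomial.C s) ^ k ∣ aeval conic F :=
  pow_dvd_aeval h fun i => congrFun (conic_eval s) i

lemma eq_zero_of_X_pow_mul {m d : ℕ} {P : Polynomial ℂ} {S : Finset ℂ} {k : ℕ}
    (hd : (Polynomial.X ^ m * P).natDegree ≤ d)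
    (h : ∀ s ∈ S, (Polynomial.X - Polynomial.C s) ^ k ∣ P) (hlt : d < m + S.card * k) : P = 0 := by
  by_contra hP
  rw [Polynomial.natDegree_mul (pow_ne_zero _ Polynomial.X_ne_zero) hP,
    Polynomial.natDegree_X_pow] at hd
  refine hP (eq_zero_of_pow_dvd S id (fun _ _ _ _ h => h) (fun _ => k) (G := 1) (d := d - m)
    (by omega) (one_dvd _) (by simp) h ?_)
  simp
  omega

/-- Restriction to the plane `x₃ = 0`. -/
def planeSubst : Fin 4 → MvPolynomial (Fin 4) ℂ := ![X 0, X 1, X 2, 0]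

lemma eval_planeSubst (F : MvPolynomial (Fin 4) ℂ) (v : Fin 4 → ℂ) :
    eval v (aeval planeSubst F) = eval ![v 0, v 1, v 2, 0] F := by
  have := comp_aeval_apply planeSubst (aeval v : MvPolynomial (Fin 4) ℂ →ₐ[ℂ] ℂ) F
  refine this.trans (congrArg (fun w => eval w F) ?_)
  ext i
  fin_cases i <;> simp [planeSubst]

lemma pderiv_planeSubst (F : MvPolynomial (Fin 4) ℂ) (j : Fin 4) (hj : j ≠ 3) :
    pderiv j (aeval planeSubst F) = aeval planeSubst (pderiv j F) := by
  rw [derivation_aeval]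
  fin_cases j <;> simp_all [Fin.sum_univ_four, planeSubst, pderiv_X]

lemma pderiv_three_planeSubst (F : MvPolynomial (Fin 4) ℂ) :
    pderiv 3 (aeval planeSubst F) = 0 := by
  rw [derivation_aeval]
  simp [Fin.sum_univ_four, planeSubst, pderiv_X]

lemma planeSubst_mem {k : ℕ} {F : MvPolynomial (Fin 4) ℂ} {v : Fin 4 → ℂ} (hv : v 3 = 0)
    (h0 : eval v F = 0) (h : ∀ j, j ≠ 3 → aeval planeSubst (pderiv j F) ∈ pointIdeal v ^ k) :
    aeval planeSubst F ∈ pointIdeal v ^ (k + 1) := by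
  refine mem_pow_succ_of_pderiv ?_ fun j => ?_
  · rw [eval_planeSubst, ← hv]
    convert h0
    ext i
    fin_cases i <;> rfl
  · by_cases hj : j = 3
    · rw [hj, pderiv_three_planeSubst]
      exact zero_mem _
    · rw [pderiv_planeSubst F j hj]
      exact h j hj

lemma eval_conic_eq_zero {F : MvPolynomial (Fin 4) ℂ} (h : aeval conic F = 0) (s : ℂ) :
    eval ![s ^ 2, s, 1, 0] F = 0 := by
  rw [← conic_eval, ← eval_aeval, h, Polynomial.eval_zero]

lemma eval_line_of_triple_conic {g : MvPolynomial (Fin 4) ℂ} (hhom : g.IsHomogeneous 6)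
    (hmem : ∀ s : ℂ, g ∈ pointIdeal ![s ^ 2, s, 1, 0] ^ 3) {s : ℂ} (hs : s ≠ 0) (t : ℂ) :
    eval ![t * s ^ 2, 1, t, 0] g = -eval ![0, 1, 0, 0] g * (t ^ 2 * s ^ 2 - 1) ^ 3 := by
  set χ : Fin 4 → Polynomial ℂ := ![Polynomial.X * Polynomial.C (s ^ 2), 1, Polynomial.X, 0]
    with hχ
  have hχe : ∀ t, (fun i => (χ i).eval t) = ![t * s ^ 2, 1, t, 0] := by
    intro t
    ext i
    fin_cases i <;> simp [hχ]
  have hroot : ∀ r : ℂ, r ≠ 0 → r ^ 2 = s ^ 2 →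
      (Polynomial.X - Polynomial.C r⁻¹) ^ 3 ∣ aeval χ g := by
    intro r hr hrs
    refine pow_dvd_aeval (smul_mem_pow (inv_ne_zero hr) hhom (hmem r)) fun i => ?_
    rw [← congrFun (hχe r⁻¹) i |>.symm, ← hrs]
    fin_cases i <;> simp [hr]
  have hcop : IsCoprime ((Polynomial.X - Polynomial.C s⁻¹) ^ 3)
      ((Polynomial.X - Polynomial.C (-s)⁻¹) ^ 3) := by
    refine (Polynomial.isCoprime_X_sub_C_of_isUnit_sub (IsUnit.mk0 _ ?_)).pow
    rw [inv_neg, sub_neg_eq_add, ← two_mul]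
    simp [hs]
  obtain ⟨k, hk⟩ := hcop.mul_dvd (hroot s hs rfl) (hroot (-s) (neg_ne_zero.2 hs) (by ring))
  have hdeg : (aeval χ g).natDegree ≤ 6 := by
    refine natDegree_aeval_le (m := 1) hhom fun i => ?_
    fin_cases i
    · exact (Polynomial.natDegree_mul_C_le _ _).trans Polynomial.natDegree_X_le
    · simp [hχ]
    · simp [hχ]
    · simp [hχ]
  have hk0 : k.natDegree = 0 := by
    by_cases hk0 : k = 0
    · simp [hk0]
    have hmon : ((Polynomial.X - Polynomial.C s⁻¹) ^ 3
        * (Polynomial.X - Polynomial.C (-s)⁻¹) ^ 3).Monic :=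
      ((Polynomial.monic_X_sub_C _).pow 3).mul ((Polynomial.monic_X_sub_C _).pow 3)
    rw [hk, hmon.natDegree_mul' hk0, Polynomial.Monic.natDegree_mul
      ((Polynomial.monic_X_sub_C _).pow 3) ((Polynomial.monic_X_sub_C _).pow 3)] at hdeg
    simp at hdeg
    exact hdeg
  obtain ⟨a, rfl⟩ := Polynomial.natDegree_eq_zero.1 hk0
  have hval : ∀ t, eval ![t * s ^ 2, 1, t, 0] g = (t - s⁻¹) ^ 3 * (t + s⁻¹) ^ 3 * a := by
    intro t
    rw [← hχe, ← eval_aeval, hk]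
    simp
  have h0 := hval 0
  rw [hval]
  simp only [zero_mul] at h0
  rw [h0]
  field_simp
  ring

section sextic

variable {f : MvPolynomial (Fin 4) ℂ} (hf : f.IsHomogeneous 6) {S : Finset ℂ} (hS : 5 ≤ S.card)
  (h3 : ∀ s ∈ S, f ∈ pointIdeal ![s ^ 2, s, 1, 0] ^ 3)

include hf hS h3

lemma aeval_conic_pderiv_eq_zero :
    aeval conic f = 0 ∧ (∀ i, i ≠ 3 → aeval conic (pderiv i f) = 0) ∧
      ∀ i j, i ≠ 3 → j ≠ 3 → aeval conic (pderiv i (pderiv j f)) = 0 := by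
  have e0 : aeval conic f = 0 :=
    eq_zero_of_X_pow_mul (m := 0) (d := 12) (S := S) (k := 3)
      (by simpa using natDegree_aeval_le hf conic_natDegree)
      (fun s hs => conic_pow_dvd (h3 s hs)) (by omega)
  obtain ⟨g1, g2⟩ := conic_pderiv hf e0
  have g0 : aeval conic (pderiv 0 f) = 0 :=
    eq_zero_of_X_pow_mul (m := 2) (d := 10) (S := S) (k := 2)
      (by rw [← g2]; exact natDegree_aeval_le hf.pderiv conic_natDegree)
      (fun s hs => conic_pow_dvd (pderiv_mem_pow (h3 s hs) 0)) (by omega)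
  rw [g0, mul_zero] at g1 g2
  obtain ⟨h01, h02⟩ := conic_pderiv hf.pderiv g0
  obtain ⟨h11, h12⟩ := conic_pderiv hf.pderiv g1
  obtain ⟨h21, h22⟩ := conic_pderiv hf.pderiv g2
  have c10 := pderiv_comm 1 0 f
  have c20 := pderiv_comm 2 0 f
  have c21 := pderiv_comm 2 1 f
  have h00 : aeval conic (pderiv 0 (pderiv 0 f)) = 0 :=
    eq_zero_of_X_pow_mul (m := 4) (d := 8) (S := S) (k := 1)
      (by
        have : Polynomial.X ^ 4 * aeval conic (pderiv 0 (pderiv 0 f))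
            = aeval conic (pderiv 2 (pderiv 2 f)) := by
          rw [h22, ← c20, h02]
          ring
        rw [this]
        exact natDegree_aeval_le hf.pderiv.pderiv conic_natDegree)
      (fun s hs => conic_pow_dvd (pderiv_mem_pow (pderiv_mem_pow (h3 s hs) 0) 0)) (by omega)
  simp only [h00, mul_zero] at h01 h02
  rw [← c10, h01, mul_zero] at h11 h12
  rw [← c20, h02, mul_zero] at h21 h22
  refine ⟨e0, ?_, ?_⟩
  · intro i hi
    fin_cases i <;> simp_all
  · intro i j hi hj
    fin_cases i <;> fin_cases j <;> simp_all

lemma exists_planeSubst_eq :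
    ∃ c : ℂ, aeval planeSubst f = C c * (X 0 * X 2 - X 1 ^ 2) ^ 3 := by
  obtain ⟨e0, e1, e2⟩ := aeval_conic_pderiv_eq_zero hf hS h3
  have hmem : ∀ s : ℂ, aeval planeSubst f ∈ pointIdeal ![s ^ 2, s, 1, 0] ^ 3 := by
    intro s
    refine planeSubst_mem rfl (eval_conic_eq_zero e0 s) fun i hi => ?_
    refine planeSubst_mem rfl (eval_conic_eq_zero (e1 i hi) s) fun j hj => ?_
    rw [pow_one, mem_pointIdeal_iff, eval_planeSubst]
    exact eval_conic_eq_zero (e2 j i hj hi) s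
  have hhom : (aeval planeSubst f).IsHomogeneous 6 := by
    have := hf.aeval planeSubst (n := 1) fun i => by
      fin_cases i
      exacts [isHomogeneous_X _ _, isHomogeneous_X _ _, isHomogeneous_X _ _,
        isHomogeneous_zero _ _ _]
    simpa using this
  set g := aeval planeSubst f with hg
  set c := -eval ![0, 1, 0, 0] g with hc
  have hline := fun s hs t => eval_line_of_triple_conic hhom hmem (s := s) hs t
  refine ⟨c, ?_⟩
  have hX : (X 0 * X 1 * X 2 : MvPolynomial (Fin 4) ℂ) ≠ 0 :=
    mul_ne_zero (mul_ne_zero (X_ne_zero _) (X_ne_zero _)) (X_ne_zero _)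
  rw [← sub_eq_zero]
  refine (mul_eq_zero.1 ?_).resolve_left hX
  refine MvPolynomial.funext fun v => ?_
  by_cases hv : v 0 * v 1 * v 2 = 0
  · simp [hv]
  have h0 : v 0 ≠ 0 := by rintro h; simp [h] at hv
  have h1 : v 1 ≠ 0 := by rintro h; simp [h] at hv
  have h2 : v 2 ≠ 0 := by rintro h; simp [h] at hv
  obtain ⟨s, hs⟩ := IsAlgClosed.exists_pow_nat_eq (v 0 / v 2) two_pos
  have hs0 : s ≠ 0 := by
    rintro rfl
    rw [zero_pow two_ne_zero] at hs
    exact div_ne_zero h0 h2 hs.symm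
  have key := hline s hs0 (v 2 / v 1)
  have hscale := aeval_smul_of_homogeneous hhom (v 1)
    (![v 2 / v 1 * s ^ 2, 1, v 2 / v 1, 0] : Fin 4 → ℂ)
  have hvec : eval v g = eval (fun i => v 1 * ![v 2 / v 1 * s ^ 2, 1, v 2 / v 1, 0] i) g := by
    rw [hg, eval_planeSubst, eval_planeSubst, hs]
    congr 2
    ext i
    fin_cases i <;> simp <;> field_simp
  have : eval v g = c * (v 0 * v 2 - v 1 ^ 2) ^ 3 := by
    rw [hvec]
    refine hscale.trans ?_
    change v 1 ^ 6 * eval _ g = _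
    rw [key, ← hc, hs]
    field_simp
  simp [this]

end sextic

/-- A homogeneous form not vanishing at `o` has a zero on every line through `o`. -/
lemma exists_root_on_line {d : ℕ} (hd : d ≠ 0) {g : MvPolynomial (Fin 4) ℂ}
    (hg : g.IsHomogeneous d) {o : Fin 4 → ℂ} (ho : eval o g ≠ 0) (v : Fin 4 → ℂ) :
    ∃ t : ℂ, eval (v + t • o) g = 0 := by
  set χ : Fin 4 → Polynomial ℂ := fun i => Polynomial.C (v i) + Polynomial.X * Polynomial.C (o i)
    with hχ
  have hR : ∀ t, (aeval χ g).eval t = eval (v + t • o) g := by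
    intro t
    rw [eval_aeval]
    congr 2
    ext i
    simp [hχ]
    ring
  by_cases hdeg : (aeval χ g).degree = 0
  · exfalso
    obtain ⟨k, hk⟩ : ∃ k, aeval χ g = Polynomial.C k :=
      ⟨_, Polynomial.eq_C_of_degree_eq_zero hdeg⟩
    set ψ : Fin 4 → Polynomial ℂ :=
      fun i => Polynomial.X * Polynomial.C (v i) + Polynomial.C (o i) with hψ
    have hQ : ∀ t, (aeval ψ g).eval t = eval (t • v + o) g := by
      intro t
      rw [eval_aeval]
      congr 2
      ext i
      simp [hψ]
      ring
    have h1 : Polynomial.X * (aeval ψ g - Polynomial.C k * Polynomial.X ^ d) = 0 := by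
      refine Polynomial.funext fun t => ?_
      by_cases ht : t = 0
      · simp [ht]
      have h2 := aeval_smul_of_homogeneous hg t (v + t⁻¹ • o)
      have h3 : (fun i => t * (v + t⁻¹ • o) i) = t • v + o := by
        ext i
        simp [mul_add, ht]
      rw [h3] at h2
      change eval _ g = t ^ d * eval _ g at h2
      rw [← hR, hk, Polynomial.eval_C] at h2
      simp [hQ, h2]
      right
      ring
    have h4 := (mul_eq_zero.1 h1).resolve_left Polynomial.X_ne_zero
    have h5 := congrArg (Polynomial.eval 0) h4
    simp [hQ, hd] at h5
    exact ho h5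
  · obtain ⟨t, ht⟩ := IsAlgClosed.exists_root _ hdeg
    exact ⟨t, by rw [← hR]; exact ht⟩

namespace IsNine

variable {f : MvPolynomial (Fin 4) ℂ} {p : Fin 9 → Fin 4 → ℂ}

section conic

variable (h : IsNine f p) {T : Finset (Fin 9)} {s : Fin 9 → ℂ}
  (hs : ∀ i ∈ T, p i = ![s i ^ 2, s i, 1, 0])

include h hs

lemma conic_injOn : Set.InjOn s T := by
  intro i hi j hj hij
  by_contra hne
  refine h.indep i j hne 1 ?_
  rw [hs i hi, hs j hj, hij, one_smul]

variable (hT : 5 ≤ T.card)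

include hT

lemma conic_image : 5 ≤ (T.image s).card ∧
    ∀ r ∈ T.image s, f ∈ pointIdeal ![r ^ 2, r, 1, 0] ^ 3 := by
  refine ⟨by rwa [Finset.card_image_of_injOn (h.conic_injOn hs)], fun r hr => ?_⟩
  obtain ⟨i, hi, rfl⟩ := Finset.mem_image.1 hr
  rw [← hs i hi]
  exact h.triple i

lemma aeval_conic_ne_zero : aeval conic (pderiv 3 f) ≠ 0 := by
  intro h0
  obtain ⟨hc, h3⟩ := h.conic_image hs hT
  obtain ⟨-, h1, -⟩ := aeval_conic_pderiv_eq_zero h.homog hc h3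
  refine h.not_infinite Set.infinite_univ (fun r => ![r ^ 2, r, 1, 0]) ?_ ?_ ?_
  · intro r _ hr
    simpa using congrFun hr 2
  · intro r _ t _ c hr
    have e1 := congrFun hr 1
    have e2 := congrFun hr 2
    simp at e1 e2
    rw [e1, ← e2, one_mul]
  · intro r _ j
    refine eval_conic_eq_zero ?_ r
    by_cases hj : j = 3
    · rw [hj, h0]
    · exact h1 j hj

lemma conic_card_le : T.card ≤ 5 := by
  by_contra! hlt
  refine h.aeval_conic_ne_zero hs hT ?_
  refine eq_zero_of_pow_dvd T s (h.conic_injOn hs) (fun _ => 2) (d := 10) (G := 1)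
    (natDegree_aeval_le (h.homog_pderiv 3) conic_natDegree) (one_dvd _) (by simp) ?_ ?_
  · intro i hi
    refine conic_pow_dvd ?_
    rw [← hs i hi]
    exact h.pderiv_mem i 3
  · simp
    omega

lemma exists_restrict_eq :
    ∃ c : ℂ, c ≠ 0 ∧ aeval planeSubst f = C c * (X 0 * X 2 - X 1 ^ 2) ^ 3 := by
  obtain ⟨hc, h3⟩ := h.conic_image hs hT
  obtain ⟨c, hf⟩ := exists_planeSubst_eq h.homog hc h3
  refine ⟨c, ?_, hf⟩
  rintro rfl
  rw [C_0, zero_mul] at hf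
  have hplane : ∀ j, j ≠ 3 → ∀ v : Fin 4 → ℂ, eval ![v 0, v 1, v 2, 0] (pderiv j f) = 0 := by
    intro j hj v
    rw [← eval_planeSubst, ← pderiv_planeSubst f j hj, hf]
    simp
  obtain ⟨r, hr⟩ : ∃ r : ℂ, eval ![r ^ 2, r, 1, 0] (pderiv 3 f) ≠ 0 := by
    by_contra! hall
    refine h.aeval_conic_ne_zero hs hT (Polynomial.funext fun r => ?_)
    rw [eval_aeval, conic_eval, hall, Polynomial.eval_zero]
  choose τ hτ using fun t : ℂ =>
    exists_root_on_line (by norm_num) (h.homog_pderiv 3) hr ![1, t, 0, 0]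
  have hγ : ∀ t, ![1, t, 0, 0] + τ t • ![r ^ 2, r, 1, 0]
      = ![1 + τ t * r ^ 2, t + τ t * r, τ t, 0] := by
    intro t
    ext i
    fin_cases i <;> simp
  simp only [hγ] at hτ
  refine h.not_infinite Set.infinite_univ
    (fun t => ![1 + τ t * r ^ 2, t + τ t * r, τ t, 0]) ?_ ?_ ?_
  · intro t _ h0
    have e0 := congrFun h0 0
    have e2 := congrFun h0 2
    simp at e0 e2
    simp [e2] at e0
  · intro t _ u _ k hk
    have e0 := congrFun hk 0
    have e1 := congrFun hk 1
    have e2 := congrFun hk 2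
    simp at e0 e1 e2
    have hk1 : k = 1 := by linear_combination -e0 + r ^ 2 * e2
    rw [hk1] at e1 e2
    linear_combination e1 - r * e2
  · intro t _ j
    by_cases hj : j = 3
    · rw [hj]
      exact hτ t
    · exact hplane j hj ![1 + τ t * r ^ 2, t + τ t * r, τ t, 0]

end conic

end IsNine

lemma finrank_map_ker_le_two {W : Submodule ℂ (Fin 4 → ℂ)} (hW : Module.finrank ℂ W = 3)
    {l : W →ₗ[ℂ] ℂ} (hl : l ≠ 0) :
    Module.finrank ℂ ((LinearMap.ker l).map W.subtype) ≤ 2 := by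
  have h1 := Module.Dual.finrank_ker_add_one_of_ne_zero (f := l) hl
  have h2 := Submodule.finrank_map_le W.subtype (LinearMap.ker l)
  omega

lemma finrank_ker_eq_three {ℓ : (Fin 4 → ℂ) →ₗ[ℂ] ℂ} (hℓ : ℓ ≠ 0) :
    Module.finrank ℂ (LinearMap.ker ℓ) = 3 := by
  have h1 := Module.Dual.finrank_ker_add_one_of_ne_zero (f := ℓ) hℓ
  simp at h1
  omega

lemma exists_apply_eq_one {ℓ : (Fin 4 → ℂ) →ₗ[ℂ] ℂ} (hℓ : ℓ ≠ 0) : ∃ e, ℓ e = 1 := by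
  obtain ⟨v, hv⟩ := DFunLike.ne_iff.1 hℓ
  exact ⟨(ℓ v)⁻¹ • v, by simpa using inv_mul_cancel₀ hv⟩

namespace IsNine

variable {f : MvPolynomial (Fin 4) ℂ} {p : Fin 9 → Fin 4 → ℂ}

lemma card_mem_le_two (h : IsNine f p) {U : Submodule ℂ (Fin 4 → ℂ)}
    (hU : Module.finrank ℂ U ≤ 2) {T : Finset (Fin 9)} (hT : ∀ i ∈ T, p i ∈ U) : T.card ≤ 2 := by
  by_contra! hlt
  obtain ⟨i, hi, j, hj, k, hk, hij, hik, hjk⟩ := Finset.two_lt_card.1 hlt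
  exact h.not_three_mem U hU hij hik hjk (hT i hi) (hT j hj) (hT k hk)

/-- Points of `T` lying on a quadric which degenerates to a pair of lines in the
three-dimensional space `W`. -/
lemma card_le_four_of_mul (h : IsNine f p) {W : Submodule ℂ (Fin 4 → ℂ)}
    (hW : Module.finrank ℂ W = 3) {l₁ l₂ : W →ₗ[ℂ] ℂ} (h₁ : l₁ ≠ 0) (h₂ : l₂ ≠ 0)
    {T : Finset (Fin 9)} (hT : ∀ i ∈ T, ∃ hi : p i ∈ W, l₁ ⟨p i, hi⟩ * l₂ ⟨p i, hi⟩ = 0) :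
    T.card ≤ 4 := by
  classical
  have key : ∀ l : W →ₗ[ℂ] ℂ, l ≠ 0 →
      (T.filter fun i => ∃ hi : p i ∈ W, l ⟨p i, hi⟩ = 0).card ≤ 2 := by
    intro l hl
    refine h.card_mem_le_two (finrank_map_ker_le_two hW hl) fun i hi => ?_
    obtain ⟨hiW, h0⟩ := (Finset.mem_filter.1 hi).2
    exact ⟨⟨p i, hiW⟩, h0, rfl⟩
  have hsub : T ⊆ (T.filter fun i => ∃ hi : p i ∈ W, l₁ ⟨p i, hi⟩ = 0) ∪
      (T.filter fun i => ∃ hi : p i ∈ W, l₂ ⟨p i, hi⟩ = 0) := by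
    intro i hi
    obtain ⟨hiW, h0⟩ := hT i hi
    rcases mul_eq_zero.1 h0 with h0 | h0
    · exact Finset.mem_union_left _ (Finset.mem_filter.2 ⟨hi, hiW, h0⟩)
    · exact Finset.mem_union_right _ (Finset.mem_filter.2 ⟨hi, hiW, h0⟩)
  have h1 := Finset.card_le_card hsub
  have h2 := Finset.card_union_le (T.filter fun i => ∃ hi : p i ∈ W, l₁ ⟨p i, hi⟩ = 0)
    (T.filter fun i => ∃ hi : p i ∈ W, l₂ ⟨p i, hi⟩ = 0)
  have h3 := key l₁ h₁
  have h4 := key l₂ h₂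
  omega

/-- Coordinates adapted to a decomposition of the ambient space, with the representatives of the
nine points scaled so that the third coordinate is `1` whenever it is nonzero. -/
lemma exists_coords (h : IsNine f p) {W : Submodule ℂ (Fin 4 → ℂ)} (b : Module.Basis (Fin 3) ℂ W)
    {e : Fin 4 → ℂ} (he : e ∉ W) : ∃ (M : Matrix (Fin 4) (Fin 4) ℂ) (c : Fin 9 → ℂ)
      (p' : Fin 9 → Fin 4 → ℂ), IsUnit M.det ∧
      (∀ x, M.mulVec x = ((x 0 • b 0 + x 1 • b 1 + x 2 • b 2 : W) : Fin 4 → ℂ) + x 3 • e) ∧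
      (∀ i, c i ≠ 0) ∧ (∀ i, M.mulVec (p' i) = c i • p i) ∧ IsNine (substMatrix M f) p' ∧
      ∀ i, p' i 2 ≠ 0 → p' i 2 = 1 := by
  obtain ⟨M, hM, hMx⟩ := exists_matrix_of_basis b he
  set u : Fin 9 → Fin 4 → ℂ := fun i => M⁻¹.mulVec (p i) with hu
  set c : Fin 9 → ℂ := fun i => if u i 2 = 0 then 1 else (u i 2)⁻¹ with hc
  have hMu : ∀ i, M.mulVec (u i) = p i := fun i => by simp [hu, Matrix.mul_nonsing_inv _ hM]
  have hc0 : ∀ i, c i ≠ 0 := by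
    intro i
    by_cases hi : u i 2 = 0 <;> simp [hc, hi]
  refine ⟨M, c, fun i => c i • u i, hM, hMx, hc0, fun i => by rw [Matrix.mulVec_smul, hMu],
    (h.subst hM hMu).rescale hc0, fun i => ?_⟩
  by_cases hi : u i 2 = 0 <;> simp [hc, hi]

lemma exists_plane_coords (h : IsNine f p) {ℓ : (Fin 4 → ℂ) →ₗ[ℂ] ℂ} (hℓ : ℓ ≠ 0)
    {Q : QuadraticForm ℂ (Fin 4 → ℂ)} (hQ : ∃ v, ℓ v = 0 ∧ Q v ≠ 0) {T : Finset (Fin 9)}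
    (hT : 5 ≤ T.card) (hTℓ : ∀ i ∈ T, ℓ (p i) = 0 ∧ Q (p i) = 0) :
    ∃ (M : Matrix (Fin 4) (Fin 4) ℂ) (c : Fin 9 → ℂ) (p' : Fin 9 → Fin 4 → ℂ) (s : Fin 9 → ℂ),
      (∀ i, c i ≠ 0) ∧ (∀ i, M.mulVec (p' i) = c i • p i) ∧ IsNine (substMatrix M f) p' ∧
      (∀ i ∈ T, p' i = ![s i ^ 2, s i, 1, 0]) ∧ (∀ x, ℓ (M.mulVec x) = x 3) ∧
      (∀ x y z, Q (M.mulVec ![x, y, z, 0]) = x * z - y ^ 2) ∧ IsUnit M.det := by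
  have hW := finrank_ker_eq_three hℓ
  set W := LinearMap.ker ℓ with hWdef
  obtain ⟨e, he⟩ := exists_apply_eq_one hℓ
  rcases ternary_normal_form hW (Q.comp W.subtype) with ⟨l₁, l₂, hl⟩ | ⟨b, hb⟩
  · exfalso
    obtain ⟨v, hv, hQv⟩ := hQ
    have hv' := hl ⟨v, hv⟩
    simp only [QuadraticMap.comp_apply, Submodule.subtype_apply] at hv' hl
    rw [hv'] at hQv
    have := h.card_le_four_of_mul hW (l₁ := l₁) (l₂ := l₂) (T := T)
      (by rintro rfl; simp at hQv) (by rintro rfl; simp at hQv)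
      fun i hi => ⟨(hTℓ i hi).1, by rw [← hl]; exact (hTℓ i hi).2⟩
    omega
  · obtain ⟨b, hb, ht, -⟩ := exists_rotated_basis b hb
      (fun i : T => (⟨p i, (hTℓ i i.2).1⟩ : W)) (fun i h0 => h.ne_zero i (by
        simpa using congrArg Subtype.val h0)) 0
    have heW : e ∉ W := by
      simp [hWdef, he]
    obtain ⟨M, c, p', hM, hMx, hc, hp, h', hp2⟩ := h.exists_coords b heW
    have hℓM : ∀ x, ℓ (M.mulVec x) = x 3 := by
      intro x
      rw [hMx, map_add, map_smul, he, LinearMap.mem_ker.1 (Subtype.property _)]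
      simp
    have hQM : ∀ x y z, Q (M.mulVec ![x, y, z, 0]) = x * z - y ^ 2 := by
      intro x y z
      rw [hMx, ← hb]
      simp
    refine ⟨M, c, p', fun i => p' i 1, hc, hp, h', fun i hi => ?_, hℓM, hQM, hM⟩
    have h3 : p' i 3 = 0 := by
      rw [← hℓM (p' i), hp, map_smul, (hTℓ i hi).1, smul_zero]
    have hvec : p' i = ![p' i 0, p' i 1, p' i 2, 0] := by
      ext j
      fin_cases j
      exacts [rfl, rfl, rfl, h3]
    have h2 : p' i 2 ≠ 0 := by
      intro h2
      refine ht ⟨i, hi⟩ ((c i)⁻¹ * p' i 0) ((c i)⁻¹ * p' i 1) ((c i)⁻¹ * p' i 2) ?_ (by simp [h2])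
      apply Subtype.ext
      have := hMx (p' i)
      rw [hp, h3, zero_smul, add_zero] at this
      rw [mul_smul, mul_smul, mul_smul, ← smul_add, ← smul_add, Submodule.coe_smul, ← this,
        smul_smul, inv_mul_cancel₀ (hc i), one_smul]
    have h21 := hp2 i h2
    have hq := hQM (p' i 0) (p' i 1) (p' i 2)
    rw [← hvec, hp, QuadraticMap.map_smul, (hTℓ i hi).2, smul_zero, h21] at hq
    rw [hvec, h21]
    ext j
    fin_cases j <;> simp
    linear_combination -hq

/-- A plane contains at most five of the nine points. -/
lemma card_plane_le (h : IsNine f p) {ℓ : (Fin 4 → ℂ) →ₗ[ℂ] ℂ} (hℓ : ℓ ≠ 0)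
    {T : Finset (Fin 9)} (hT : ∀ i ∈ T, ℓ (p i) = 0) : T.card ≤ 5 := by
  classical
  by_contra! hlt
  obtain ⟨T', hT', hcard⟩ := Finset.exists_subset_card_eq (show 5 ≤ T.card by omega)
  have hW := finrank_ker_eq_three hℓ
  set W := LinearMap.ker ℓ with hWdef
  set a := Module.finBasisOfFinrankEq ℂ W hW with ha
  obtain ⟨e, he⟩ := exists_apply_eq_one hℓ
  set π : (Fin 4 → ℂ) →ₗ[ℂ] W := LinearMap.codRestrict W (LinearMap.id - ℓ.smulRight e) (by
    intro v
    simp [hWdef, he]) with hπ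
  have hπW : ∀ w : W, π w = w := by
    intro w
    refine Subtype.ext ?_
    change (w : Fin 4 → ℂ) - ℓ w • e = w
    rw [LinearMap.mem_ker.1 w.2, zero_smul, sub_zero]
  set m : Fin 6 → QuadraticForm ℂ (Fin 3 → ℂ) :=
    ![QuadraticMap.linMulLin (LinearMap.proj 0) (LinearMap.proj 0),
      QuadraticMap.linMulLin (LinearMap.proj 1) (LinearMap.proj 1),
      QuadraticMap.linMulLin (LinearMap.proj 2) (LinearMap.proj 2),
      QuadraticMap.linMulLin (LinearMap.proj 0) (LinearMap.proj 1),
      QuadraticMap.linMulLin (LinearMap.proj 0) (LinearMap.proj 2),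
      QuadraticMap.linMulLin (LinearMap.proj 1) (LinearMap.proj 2)] with hm
  have hcard' : Fintype.card T' = 5 := by simpa using hcard
  obtain ⟨c, hc, hct⟩ := exists_ne_zero_forall_sum_eq_zero (by norm_num)
    (fun k v => m k (a.equivFun (π v))) (fun i => p ((Fintype.equivFinOfCardEq hcard').symm i))
  set Q₀ : QuadraticForm ℂ (Fin 3 → ℂ) := ∑ k, c k • m k with hQ₀
  set Q : QuadraticForm ℂ (Fin 4 → ℂ) := Q₀.comp (a.equivFun.toLinearMap ∘ₗ π) with hQdef
  have hQ0 : ∃ x, Q₀ x ≠ 0 := by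
    by_contra! hall
    have key : ∀ x : Fin 3 → ℂ, c 0 * (x 0 * x 0) + c 1 * (x 1 * x 1) + c 2 * (x 2 * x 2)
        + c 3 * (x 0 * x 1) + c 4 * (x 0 * x 2) + c 5 * (x 1 * x 2) = 0 := by
      intro x
      simpa [hQ₀, hm, Fin.sum_univ_six] using hall x
    have k0 := key ![1, 0, 0]
    have k1 := key ![0, 1, 0]
    have k2 := key ![0, 0, 1]
    have k3 := key ![1, 1, 0]
    have k4 := key ![1, 0, 1]
    have k5 := key ![0, 1, 1]
    simp at k0 k1 k2
    simp [k0, k1, k2] at k3 k4 k5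
    refine hc (funext fun i => ?_)
    fin_cases i <;> assumption
  have hQne : ∃ v, ℓ v = 0 ∧ Q v ≠ 0 := by
    obtain ⟨x, hx⟩ := hQ0
    refine ⟨(a.equivFun.symm x : W), LinearMap.mem_ker.1 (Subtype.property _), ?_⟩
    rw [hQdef, QuadraticMap.comp_apply, LinearMap.comp_apply, hπW]
    simpa only [LinearEquiv.coe_coe, LinearEquiv.apply_symm_apply] using hx
  have hQT : ∀ i ∈ T', Q (p i) = 0 := by
    intro i hi
    have := hct (Fintype.equivFinOfCardEq hcard' ⟨i, hi⟩)
    simpa [hQdef, hQ₀] using this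
  obtain ⟨M, d, p', s, hd, hp, h', hs, hℓM, hQM, -⟩ := h.exists_plane_coords hℓ (Q := Q)
    hQne hcard.ge
    fun i hi => ⟨hT i (hT' hi), hQT i hi⟩
  obtain ⟨k, hk, hf⟩ := h'.exists_restrict_eq hs hcard.ge
  have hQall : ∀ i ∈ T, Q (p i) = 0 := by
    intro i hi
    have h3 : p' i 3 = 0 := by rw [← hℓM (p' i), hp, map_smul, hT i hi, smul_zero]
    have hvec : ![p' i 0, p' i 1, p' i 2, 0] = p' i := by
      ext j
      fin_cases j
      exacts [rfl, rfl, rfl, h3.symm]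
    have h0 : eval (p' i) (substMatrix M f) = 0 :=
      mem_pointIdeal_iff.1 (Ideal.pow_le_self three_ne_zero (h'.triple i))
    have h1 := congrArg (eval (p' i)) hf
    rw [eval_planeSubst, hvec, h0] at h1
    have h2 : p' i 0 * p' i 2 - p' i 1 ^ 2 = 0 := by
      simpa [hk] using h1
    rw [← hQM, hvec, hp, QuadraticMap.map_smul] at h2
    simpa [hd i] using h2
  obtain ⟨M, d, p', s, hd, hp, h', hs, -⟩ := h.exists_plane_coords hℓ (Q := Q) (T := T)
    hQne (by omega) fun i hi => ⟨hT i hi, hQall i hi⟩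
  have := h'.conic_card_le hs (by omega)
  omega

end IsNine

/-- The linear form attached to a functional. -/
def linForm (ℓ : (Fin 4 → ℂ) →ₗ[ℂ] ℂ) : MvPolynomial (Fin 4) ℂ :=
  ∑ i, C (ℓ (Pi.single i 1)) * X i

lemma eval_linForm (ℓ : (Fin 4 → ℂ) →ₗ[ℂ] ℂ) (v : Fin 4 → ℂ) : eval v (linForm ℓ) = ℓ v := by
  conv_rhs => rw [LinearMap.pi_apply_eq_sum_univ ℓ v]
  simp only [linForm, map_sum, map_mul, eval_C, eval_X, smul_eq_mul]
  refine Finset.sum_congr rfl fun i _ => ?_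
  rw [mul_comm]
  congr 2
  ext j
  simp [Pi.single_apply, eq_comm]

lemma linForm_isHomogeneous (ℓ : (Fin 4 → ℂ) →ₗ[ℂ] ℂ) : (linForm ℓ).IsHomogeneous 1 :=
  IsHomogeneous.sum _ _ _ fun i _ => by
    simpa using (isHomogeneous_C (Fin 4) _).mul (isHomogeneous_X ℂ i)

lemma exists_eq_linForm_mul {ℓ : (Fin 4 → ℂ) →ₗ[ℂ] ℂ} (hℓ : ℓ ≠ 0)
    {F : MvPolynomial (Fin 4) ℂ} (hF : ∀ v, ℓ v = 0 → eval v F = 0) :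
    ∃ a, F = linForm ℓ * a ∧ a.totalDegree ≤ F.totalDegree - 1 := by
  obtain ⟨e, he⟩ := exists_apply_eq_one hℓ
  set π : Fin 4 → MvPolynomial (Fin 4) ℂ := fun i => X i - C (e i) * linForm ℓ with hπ
  have h0 : aeval π F = 0 := by
    refine MvPolynomial.funext fun v => ?_
    have h1 := comp_aeval_apply π (aeval v : MvPolynomial (Fin 4) ℂ →ₐ[ℂ] ℂ) F
    refine h1.trans ?_
    have h2 : (fun i => (aeval v : MvPolynomial (Fin 4) ℂ →ₐ[ℂ] ℂ) (π i)) = v - ℓ v • e := by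
      ext i
      change eval v (π i) = _
      simp [hπ, eval_linForm, mul_comm]
    rw [h2, map_zero]
    exact hF _ (by simp [he])
  have h1 := aeval_sub_aeval_mem (R := MvPolynomial (Fin 4) ℂ) (χ := X) (ψ := π)
    (Ideal.span {linForm ℓ}) (fun i => by
      rw [Ideal.mem_span_singleton]
      exact ⟨C (e i), by simp [hπ, mul_comm]⟩) F
  rw [h0, sub_zero, aeval_X_left_apply, Ideal.mem_span_singleton] at h1
  obtain ⟨a, ha⟩ := h1
  refine ⟨a, ha, ?_⟩
  by_cases ha0 : a = 0
  · simp [ha0]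
  have hl0 : linForm ℓ ≠ 0 := by
    intro hl0
    have := eval_linForm ℓ e
    simp [hl0, he] at this
  have := totalDegree_mul_of_isDomain hl0 ha0
  rw [← ha, (linForm_isHomogeneous ℓ).totalDegree hl0] at this
  omega

/-- Along every affine line through a nonzero multiple of `v`, the polynomial `a` vanishes to order
three at that point. -/
def TripleAlongLines (a : MvPolynomial (Fin 4) ℂ) (v : Fin 4 → ℂ) : Prop :=
  ∀ k : ℂ, k ≠ 0 → ∀ (χ : Fin 4 → Polynomial ℂ) (r : ℂ), (∀ j, (χ j).eval r = k * v j) →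
    (Polynomial.X - Polynomial.C r) ^ 3 ∣ aeval χ a

section lines

variable {a : MvPolynomial (Fin 4) ℂ} (ha : a.totalDegree ≤ 5)

include ha

lemma eval_eq_zero_of_tripleAlongLines_pair {v w : Fin 4 → ℂ} (hv : TripleAlongLines a v)
    (hw : TripleAlongLines a w) {x y : ℂ} (hx : x ≠ 0) (hy : y ≠ 0) :
    eval (x • v + y • w) a = 0 := by
  set χ : Fin 4 → Polynomial ℂ := fun j =>
    Polynomial.C (2 * x * v j) + Polynomial.C (2 * y * w j - 2 * x * v j) * Polynomial.X with hχ
  have hdeg : ∀ j, (χ j).natDegree ≤ 1 := fun j => by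
    simp only [hχ]
    compute_degree
  have h0 : aeval χ a = 0 := by
    refine eq_zero_of_pow_dvd (Finset.univ : Finset (Fin 2)) ![0, 1] ?_ (fun _ => 3) (G := 1)
      (aeval_natDegree_le a ha χ hdeg) (one_dvd _) (by simp) ?_ (by simp)
    · intro i _ j _
      fin_cases i <;> fin_cases j <;> simp
    · intro i _
      fin_cases i
      · exact hv (2 * x) (by simpa) χ 0 (by simp [hχ])
      · exact hw (2 * y) (by simpa) χ 1 (by simp [hχ])
  have h1 := eval_aeval a χ (1 / 2)
  rw [h0, Polynomial.eval_zero] at h1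
  rw [h1]
  congr 2
  ext j
  simp [hχ]
  ring

variable {u₁ u₂ u₃ : Fin 4 → ℂ} (h₁ : TripleAlongLines a u₁) (h₂ : TripleAlongLines a u₂)
  (h₃ : TripleAlongLines a u₃) (h₄ : TripleAlongLines a (u₁ + u₂ + u₃))

include h₁ h₂ h₃ h₄

lemma eval_eq_zero_of_tripleAlongLines_generic {x y z : ℂ} (hy : y ≠ 0) (hz : z ≠ 0)
    (hyz : y ≠ z) : eval (x • u₁ + y • u₂ + z • u₃) a = 0 := by
  obtain ⟨m, hm⟩ := Infinite.exists_notMem_finset ({0, x, x - y, x - z} : Finset ℂ)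
  simp only [Finset.mem_insert, Finset.mem_singleton, not_or] at hm
  obtain ⟨hm0, hmx, hmy, hmz⟩ := hm
  have hmx' : m - x ≠ 0 := sub_ne_zero.2 hmx
  have hmy' : m - x + y ≠ 0 := fun h => hmy (by linear_combination h)
  have hmz' : m - x + z ≠ 0 := fun h => hmz (by linear_combination h)
  set χ : Fin 4 → Polynomial ℂ := fun j => Polynomial.C (m * u₁ j) +
    Polynomial.C ((x - m) * u₁ j + y * u₂ j + z * u₃ j) * Polynomial.X with hχ
  have hdeg : ∀ j, (χ j).natDegree ≤ 1 := fun j => by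
    simp only [hχ]
    compute_degree
  have hzero : ∀ r, eval (fun j => (χ j).eval r) a = 0 →
      (Polynomial.X - Polynomial.C r) ^ 1 ∣ aeval χ a := by
    intro r hr
    rw [pow_one, Polynomial.dvd_iff_isRoot, Polynomial.IsRoot, eval_aeval, hr]
  have h0 : aeval χ a = 0 := by
    refine eq_zero_of_pow_dvd (Finset.univ : Finset (Fin 4))
      ![0, m / (m - x), m / (m - x + y), m / (m - x + z)] ?_ ![3, 1, 1, 1] (G := 1)
      (aeval_natDegree_le a ha χ hdeg) (one_dvd _) (by simp) ?_ (by simp [Fin.sum_univ_four])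
    · have e1 : m / (m - x) ≠ m / (m - x + y) := by
        rw [Ne, div_eq_div_iff hmx' hmy']
        intro h
        exact mul_ne_zero hm0 hy (by linear_combination h)
      have e2 : m / (m - x) ≠ m / (m - x + z) := by
        rw [Ne, div_eq_div_iff hmx' hmz']
        intro h
        exact mul_ne_zero hm0 hz (by linear_combination h)
      have e3 : m / (m - x + y) ≠ m / (m - x + z) := by
        rw [Ne, div_eq_div_iff hmy' hmz']
        intro h
        exact mul_ne_zero hm0 (sub_ne_zero.2 hyz) (by linear_combination -h)
      intro i _ j _
      fin_cases i <;> fin_cases j <;>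
        simp [hm0, hmx', hmy', hmz', e1, e2, e3, e1.symm, e2.symm, e3.symm,
          (div_ne_zero hm0 hmx').symm, (div_ne_zero hm0 hmy').symm, (div_ne_zero hm0 hmz').symm]
    · intro i _
      fin_cases i
      · exact h₁ m hm0 χ 0 (by simp [hχ])
      · refine hzero _ ?_
        rw [← eval_eq_zero_of_tripleAlongLines_pair ha h₂ h₃
          (mul_ne_zero (div_ne_zero hm0 hmx') hy) (mul_ne_zero (div_ne_zero hm0 hmx') hz)]
        congr 2
        ext j
        simp [hχ]
        field_simp
        ring
      · refine hzero _ ?_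
        rw [← eval_eq_zero_of_tripleAlongLines_pair ha h₄ h₃
          (mul_ne_zero (div_ne_zero hm0 hmy') hy)
          (mul_ne_zero (div_ne_zero hm0 hmy') (sub_ne_zero.2 hyz.symm))]
        congr 2
        ext j
        simp [hχ]
        field_simp
        ring
      · refine hzero _ ?_
        rw [← eval_eq_zero_of_tripleAlongLines_pair ha h₄ h₂
          (mul_ne_zero (div_ne_zero hm0 hmz') hz)
          (mul_ne_zero (div_ne_zero hm0 hmz') (sub_ne_zero.2 hyz))]
        congr 2
        ext j
        simp [hχ]
        field_simp
        ring
  have h1 := eval_aeval a χ 1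
  rw [h0, Polynomial.eval_zero] at h1
  rw [h1]
  congr 2
  ext j
  simp [hχ]
  ring

/-- A quintic with four triple points in general position in a plane vanishes on that plane. -/
lemma eval_eq_zero_of_tripleAlongLines (x y z : ℂ) : eval (x • u₁ + y • u₂ + z • u₃) a = 0 := by
  set χ : Fin 4 → Polynomial ℂ := fun j => Polynomial.C (x * u₁ j + y * u₂ j + z * u₃ j) +
    Polynomial.C (u₂ j + 2 * u₃ j) * Polynomial.X with hχ
  have hχe : ∀ r, (fun j => (χ j).eval r) = x • u₁ + (y + r) • u₂ + (z + 2 * r) • u₃ := by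
    intro r
    ext j
    simp [hχ]
    ring
  have hlin : ∀ b c : ℂ, b ≠ 0 → Polynomial.C c + Polynomial.C b * Polynomial.X ≠ 0 := by
    intro b c hb h0
    have := congrArg (Polynomial.coeff · 1) h0
    simp [hb] at this
  have h0 : aeval χ a = 0 := by
    have h1 : (Polynomial.C y + Polynomial.C 1 * Polynomial.X) *
        (Polynomial.C z + Polynomial.C 2 * Polynomial.X) *
        (Polynomial.C (z - y) + Polynomial.C 1 * Polynomial.X) * aeval χ a = 0 := by
      refine Polynomial.funext fun r => ?_
      rw [Polynomial.eval_mul, eval_aeval, hχe]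
      by_cases h1 : y + r = 0
      · simp [h1]
      by_cases h2 : z + 2 * r = 0
      · simp [h2]
      by_cases h3 : y + r = z + 2 * r
      · have : z - y + r = 0 := by linear_combination -h3
        simp [this]
      rw [eval_eq_zero_of_tripleAlongLines_generic ha h₁ h₂ h₃ h₄ h1 h2 h3]
      simp
    exact (mul_eq_zero.1 h1).resolve_left (mul_ne_zero (mul_ne_zero (hlin _ _ one_ne_zero)
      (hlin _ _ two_ne_zero)) (hlin _ _ one_ne_zero))
  have h1 := eval_aeval a χ 0
  rw [h0, hχe] at h1
  simpa using h1.symm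

end lines

lemma exists_ne_zero_ne_zero {ℓ₁ ℓ₂ : (Fin 4 → ℂ) →ₗ[ℂ] ℂ} (h₁ : ℓ₁ ≠ 0) (h₂ : ℓ₂ ≠ 0) :
    ∃ v, ℓ₁ v ≠ 0 ∧ ℓ₂ v ≠ 0 := by
  obtain ⟨v, hv⟩ := exists_apply_eq_one h₁
  obtain ⟨w, hw⟩ := exists_apply_eq_one h₂
  by_cases h2 : ℓ₂ v = 0
  · by_cases h1 : ℓ₁ w = 0
    · exact ⟨v + w, by simp [hv, h1], by simp [hw, h2]⟩
    · exact ⟨w, h1, by simp [hw]⟩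
  · exact ⟨v, by simp [hv], h2⟩

namespace IsNine

variable {f : MvPolynomial (Fin 4) ℂ} {p : Fin 9 → Fin 4 → ℂ}

lemma exists_frame (h : IsNine f p) {ℓ : (Fin 4 → ℂ) →ₗ[ℂ] ℂ} (hℓ : ℓ ≠ 0)
    {T : Finset (Fin 9)} (hT : 3 < T.card) (hTℓ : ∀ i ∈ T, ℓ (p i) = 0) :
    ∃ u₁ u₂ u₃ : Fin 4 → ℂ,
      (∀ u, u = u₁ ∨ u = u₂ ∨ u = u₃ ∨ u = u₁ + u₂ + u₃ → ∃ i ∈ T, ∃ c : ℂ, c ≠ 0 ∧ u = c • p i) ∧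
      ∀ v, ℓ v = 0 → ∃ x y z : ℂ, v = x • u₁ + y • u₂ + z • u₃ := by
  obtain ⟨T', hT', hcard⟩ := Finset.exists_subset_card_eq (show 4 ≤ T.card by omega)
  set i : Fin 4 → Fin 9 := fun k => T'.equivFinOfCardEq hcard |>.symm k with hi
  have hinj : Function.Injective i :=
    Subtype.val_injective.comp (Equiv.injective _)
  have hiT : ∀ k, i k ∈ T := fun k => hT' (Subtype.property _)
  have hne : ∀ k l : Fin 4, k ≠ l → i k ≠ i l := fun k l hkl => hinj.ne hkl
  have hl := h.linearIndependent (hne 0 1 (by decide)) (hne 0 2 (by decide)) (hne 1 2 (by decide))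
  have hle : Submodule.span ℂ (Set.range ![p (i 0), p (i 1), p (i 2)]) ≤ LinearMap.ker ℓ := by
    rw [Submodule.span_le]
    rintro _ ⟨l, rfl⟩
    fin_cases l <;> exact hTℓ _ (hiT _)
  have hspan := Submodule.eq_of_le_of_finrank_eq hle (by
    rw [finrank_span_eq_card hl, finrank_ker_eq_three hℓ]
    simp)
  have hmem : ∀ v, ℓ v = 0 → ∃ x y z : ℂ, v = x • p (i 0) + y • p (i 1) + z • p (i 2) := by
    intro v hv
    have : v ∈ Submodule.span ℂ (Set.range ![p (i 0), p (i 1), p (i 2)]) := by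
      rw [hspan]
      exact hv
    obtain ⟨c, rfl⟩ := (Submodule.mem_span_range_iff_exists_fun ℂ).1 this
    exact ⟨c 0, c 1, c 2, by simp [Fin.sum_univ_three]⟩
  obtain ⟨x, y, z, hxyz⟩ := hmem _ (hTℓ _ (hiT 3))
  have hx : x ≠ 0 := by
    rintro rfl
    exact h.not_collinear (hne 1 2 (by decide)) (hne 1 3 (by decide)) (hne 2 3 (by decide)) y z
      (by simpa using hxyz)
  have hy : y ≠ 0 := by
    rintro rfl
    exact h.not_collinear (hne 0 2 (by decide)) (hne 0 3 (by decide)) (hne 2 3 (by decide)) x z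
      (by simpa using hxyz)
  have hz : z ≠ 0 := by
    rintro rfl
    exact h.not_collinear (hne 0 1 (by decide)) (hne 0 3 (by decide)) (hne 1 3 (by decide)) x y
      (by simpa using hxyz)
  refine ⟨x • p (i 0), y • p (i 1), z • p (i 2), ?_, ?_⟩
  · rintro u (rfl | rfl | rfl | rfl)
    · exact ⟨_, hiT 0, x, hx, rfl⟩
    · exact ⟨_, hiT 1, y, hy, rfl⟩
    · exact ⟨_, hiT 2, z, hz, rfl⟩
    · exact ⟨_, hiT 3, 1, one_ne_zero, by rw [one_smul, hxyz]⟩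
  · intro v hv
    obtain ⟨a, b, c, rfl⟩ := hmem v hv
    exact ⟨a / x, b / y, c / z, by simp [smul_smul, hx, hy, hz]⟩

lemma false_of_conic_and_plane (h : IsNine f p) {T : Finset (Fin 9)} (hT : T.card = 5)
    {s : Fin 9 → ℂ} (hs : ∀ i ∈ T, p i = ![s i ^ 2, s i, 1, 0]) (hT3 : ∀ i ∉ T, p i 3 ≠ 0)
    {ℓ : (Fin 4 → ℂ) →ₗ[ℂ] ℂ} (hℓ : ℓ ≠ 0) (hℓp : ∀ i ∉ T, ℓ (p i) = 0)
    {q : MvPolynomial (Fin 4) ℂ} (hq : q.IsHomogeneous 2) (hqp : ∀ i, eval (p i) q = 0)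
    (hq0 : ∀ x y z, eval ![x, y, z, 0] q = x * z - y ^ 2) : False := by
  obtain ⟨c, -, hf⟩ := h.exists_restrict_eq hs hT.ge
  have hcompl : Tᶜ.card = 4 := by
    rw [Finset.card_compl, hT]
    simp
  set F := f - C c * q ^ 3 with hF
  have hFhom : F.IsHomogeneous 6 := h.homog.sub (by
    simpa using (isHomogeneous_C (Fin 4) c).mul (hq.pow 3))
  have hFtriple : ∀ i, F ∈ pointIdeal (p i) ^ 3 := fun i =>
    sub_mem (h.triple i) (Ideal.mul_mem_left _ _
      (Ideal.pow_mem_pow (mem_pointIdeal_iff.2 (hqp i)) 3))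
  have hX3 : (LinearMap.proj 3 : (Fin 4 → ℂ) →ₗ[ℂ] ℂ) ≠ 0 := by
    intro h0
    simpa using congrArg (fun l => l (Pi.single 3 1)) h0
  obtain ⟨a, ha, hadeg⟩ := exists_eq_linForm_mul hX3 (F := F) (by
    intro v hv
    have hvec : ![v 0, v 1, v 2, 0] = v := by
      ext j
      fin_cases j
      exacts [rfl, rfl, rfl, hv.symm]
    have h1 := congrArg (eval v) hf
    rw [eval_planeSubst, hvec] at h1
    have h2 := hq0 (v 0) (v 1) (v 2)
    rw [hvec] at h2
    simp [hF, h1, h2])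
  have hadeg5 : a.totalDegree ≤ 5 := hadeg.trans (by have := hFhom.totalDegree_le; omega)
  have hlin : linForm (LinearMap.proj 3) = X 3 := by
    refine MvPolynomial.funext fun v => ?_
    rw [eval_linForm]
    simp
  rw [hlin] at ha
  have htri : ∀ i ∉ T, ∀ d : ℂ, d ≠ 0 → TripleAlongLines a (d • p i) := by
    intro i hi d hd k hk χ r hχ
    have h1 : (Polynomial.X - Polynomial.C r) ^ 3 ∣ aeval χ F :=
      pow_dvd_aeval (smul_mem_pow (mul_ne_zero hk hd) hFhom (hFtriple i)) fun j => by
        rw [hχ]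
        simp [mul_assoc]
    rw [ha, map_mul, aeval_X] at h1
    refine IsCoprime.dvd_of_dvd_mul_left (IsCoprime.pow_left ?_) h1
    refine (Polynomial.irreducible_X_sub_C r).coprime_iff_not_dvd.2 fun hdvd => ?_
    have h2 := Polynomial.dvd_iff_isRoot.1 hdvd
    rw [Polynomial.IsRoot, hχ] at h2
    simp [hk, hd, hT3 i hi] at h2
  obtain ⟨u₁, u₂, u₃, hu, hspan⟩ := h.exists_frame hℓ (T := Tᶜ) (by omega)
    (fun i hi => hℓp i (Finset.mem_compl.1 hi))
  have hutri : ∀ u, u = u₁ ∨ u = u₂ ∨ u = u₃ ∨ u = u₁ + u₂ + u₃ → TripleAlongLines a u := by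
    intro u hu'
    obtain ⟨i, hi, d, hd, rfl⟩ := hu u hu'
    exact htri i (Finset.mem_compl.1 hi) d hd
  obtain ⟨b, hb, hbdeg⟩ := exists_eq_linForm_mul hℓ (F := a) (by
    intro v hv
    obtain ⟨x, y, z, rfl⟩ := hspan v hv
    exact eval_eq_zero_of_tripleAlongLines hadeg5 (hutri _ (by simp)) (hutri _ (by simp))
      (hutri _ (by simp)) (hutri _ (by simp)) x y z)
  have hfeq : f = C c * q ^ 3 + X 3 * (linForm ℓ * b) := by
    rw [← hb, ← ha, hF]
    ring
  have hqconic : aeval conic q = 0 := by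
    refine Polynomial.funext fun r => ?_
    rw [eval_aeval, conic_eval, hq0, Polynomial.eval_zero]
    ring
  have hpd : aeval conic (pderiv 3 f) = aeval conic (linForm ℓ) * aeval conic b := by
    have h3 : conic 3 = 0 := rfl
    rw [hfeq]
    simp [hqconic, h3]
  refine h.aeval_conic_ne_zero hs hT.ge ?_
  rw [hpd]
  refine mul_eq_zero_of_right _ ?_
  classical
  have hone : (T.filter fun i => ℓ (p i) = 0).card ≤ 1 := by
    have h1 := h.card_plane_le hℓ (T := (T.filter fun i => ℓ (p i) = 0) ∪ Tᶜ) (by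
      intro i hi
      rcases Finset.mem_union.1 hi with hi | hi
      · exact (Finset.mem_filter.1 hi).2
      · exact hℓp i (Finset.mem_compl.1 hi))
    rw [Finset.card_union_of_disjoint (Finset.disjoint_left.2 fun i hi hi' =>
      Finset.mem_compl.1 hi' (Finset.mem_filter.1 hi).1)] at h1
    omega
  refine eq_zero_of_pow_dvd T s (h.conic_injOn hs) (fun i => if ℓ (p i) = 0 then 1 else 2)
    (d := 4 * 2) (G := 1) (aeval_natDegree_le b (by omega) conic conic_natDegree) (one_dvd _)
    (by simp) ?_ ?_
  · intro i hi
    have hdvd : (Polynomial.X - Polynomial.C (s i)) ^ 2 ∣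
        aeval conic (linForm ℓ) * aeval conic b := by
      rw [← hpd]
      refine conic_pow_dvd ?_
      rw [← hs i hi]
      exact h.pderiv_mem i 3
    split_ifs with h0
    · obtain ⟨v, hv3, hvℓ⟩ := exists_ne_zero_ne_zero hX3 hℓ
      set χ : Fin 4 → Polynomial ℂ := fun j =>
        Polynomial.C (p i j) + Polynomial.C (v j) * Polynomial.X with hχ
      have hχe : ∀ r, (fun j => (χ j).eval r) = p i + r • v := by
        intro r
        ext j
        simp [hχ]
        ring
      have h1 : (Polynomial.X - Polynomial.C 0) ^ 3 ∣ aeval χ F :=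
        pow_dvd_aeval (hFtriple i) fun j => by simp [hχ]
      have hlχ : aeval χ (linForm ℓ) = Polynomial.C (ℓ v) * Polynomial.X := by
        refine Polynomial.funext fun r => ?_
        rw [eval_aeval, hχe, eval_linForm]
        simp [h0]
        ring
      have h3 : p i 3 = 0 := by simp [hs i hi]
      have hrew : aeval χ F =
          Polynomial.X ^ 2 * (Polynomial.C (v 3 * ℓ v) * aeval χ b) := by
        rw [ha, hb, map_mul, map_mul, hlχ, aeval_X]
        simp [hχ, h3]
        ring
      rw [hrew, Polynomial.C_0, sub_zero, pow_succ] at h1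
      have h4 := (mul_dvd_mul_iff_left (pow_ne_zero 2 Polynomial.X_ne_zero)).1 h1
      rw [Polynomial.X_dvd_iff, Polynomial.coeff_C_mul] at h4
      have h5 := (mul_eq_zero.1 h4).resolve_left (mul_ne_zero hv3 hvℓ)
      rw [Polynomial.coeff_zero_eq_eval_zero, eval_aeval, hχe, zero_smul, add_zero, hs i hi] at h5
      rw [pow_one, Polynomial.dvd_iff_isRoot, Polynomial.IsRoot, eval_aeval, conic_eval, h5]
    · refine IsCoprime.dvd_of_dvd_mul_left (IsCoprime.pow_left ?_) hdvd
      refine (Polynomial.irreducible_X_sub_C _).coprime_iff_not_dvd.2 fun hd => h0 ?_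
      have h2 := Polynomial.dvd_iff_isRoot.1 hd
      rwa [Polynomial.IsRoot, eval_aeval, conic_eval, eval_linForm, ← hs i hi] at h2
  · have : ∑ i ∈ T, (if ℓ (p i) = 0 then 1 else 2) + (T.filter fun i => ℓ (p i) = 0).card = 10 := by
      rw [Finset.card_filter, ← Finset.sum_add_distrib]
      rw [Finset.sum_congr rfl (g := fun _ => 2) fun i _ => by split_ifs <;> rfl]
      simp [hT]
    simp only [Polynomial.natDegree_one]
    omega

end IsNine

/-- A quadratic form vanishing on the kernel of a functional is divisible by it. -/
lemma exists_eq_mul_of_forall_ker {Q : QuadraticForm ℂ (Fin 4 → ℂ)} {ℓ : (Fin 4 → ℂ) →ₗ[ℂ] ℂ}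
    (hℓ : ℓ ≠ 0) (hQ : ∀ v, ℓ v = 0 → Q v = 0) :
    ∃ l : (Fin 4 → ℂ) →ₗ[ℂ] ℂ, ∀ v, Q v = ℓ v * l v := by
  obtain ⟨e, he⟩ := exists_apply_eq_one hℓ
  refine ⟨(QuadraticMap.polarBilin Q).flip e - Q e • ℓ, fun v => ?_⟩
  have h1 := hQ (v - ℓ v • e) (by simp [he])
  have h2 : Q v = Q (v - ℓ v • e) + Q (ℓ v • e) + QuadraticMap.polar Q (v - ℓ v • e) (ℓ v • e) := by
    rw [QuadraticMap.polar, sub_add_cancel]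
    ring
  rw [h1, QuadraticMap.map_smul, QuadraticMap.polar_smul_right, QuadraticMap.polar_sub_left,
    QuadraticMap.polar_smul_left, QuadraticMap.polar_self] at h2
  rw [h2]
  simp
  ring

lemma linearMap_eq_smul_of_forall_ker {ℓ l : (Fin 4 → ℂ) →ₗ[ℂ] ℂ} (hℓ : ℓ ≠ 0)
    (hl : ∀ v, ℓ v = 0 → l v = 0) : ∃ c : ℂ, ∀ v, l v = c * ℓ v := by
  obtain ⟨e, he⟩ := exists_apply_eq_one hℓ
  refine ⟨l e, fun v => ?_⟩
  have := hl (v - ℓ v • e) (by simp [he])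
  rw [map_sub, map_smul, smul_eq_mul] at this
  linear_combination this

namespace IsNine

variable {f : MvPolynomial (Fin 4) ℂ} {p : Fin 9 → Fin 4 → ℂ}

lemma false_of_planes_of_card (h : IsNine f p) {ℓ ℓ' : (Fin 4 → ℂ) →ₗ[ℂ] ℂ} (hℓ : ℓ ≠ 0)
    (hℓ' : ℓ' ≠ 0) {T : Finset (Fin 9)} (hcard : 5 ≤ T.card) (hT : ∀ i, i ∈ T ↔ ℓ (p i) = 0)
    (hp : ∀ i ∉ T, ℓ' (p i) = 0)
    {q : MvPolynomial (Fin 4) ℂ} (hq : q.IsHomogeneous 2) (hqp : ∀ i, eval (p i) q = 0)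
    (hne : ∀ c : ℂ, ∃ v, eval v q ≠ c * (ℓ v * ℓ' v)) : False := by
  have hT5 : T.card = 5 := le_antisymm (h.card_plane_le hℓ fun i hi => (hT i).1 hi) hcard
  have hcompl : Tᶜ.card = 4 := by
    rw [Finset.card_compl, hT5]
    simp
  obtain ⟨Q, hQ⟩ := exists_quadraticForm hq
  by_cases hzero : ∃ v, ℓ v = 0 ∧ Q v ≠ 0
  · obtain ⟨M, c, p', s, hc, hpM, h', hs, hℓM, hQM, hM⟩ := h.exists_plane_coords hℓ hzero hcard
      fun i hi => ⟨(hT i).1 hi, by rw [hQ, hqp]⟩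
    refine h'.false_of_conic_and_plane hT5 hs (fun i hi => ?_) (ℓ := ℓ' ∘ₗ M.mulVecLin) ?_
      (fun i hi => ?_) (substMatrix_isHomogeneous M hq) (fun i => ?_) (fun x y z => ?_)
    · rw [← hℓM (p' i), hpM, map_smul]
      exact mul_ne_zero (hc i) fun h0 => hi ((hT i).2 h0)
    · intro h0
      obtain ⟨e, he⟩ := exists_apply_eq_one hℓ'
      have := congrArg (fun l => l (M⁻¹.mulVec e)) h0
      simp [Matrix.mul_nonsing_inv _ hM, he] at this
    · simp [hpM, hp i hi]
    · rw [eval_substMatrix, hpM, ← hQ, QuadraticMap.map_smul, hQ, hqp, smul_zero]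
    · rw [eval_substMatrix, ← hQ, hQM]
  · push Not at hzero
    obtain ⟨l, hl⟩ := exists_eq_mul_of_forall_ker hℓ hzero
    set l' : LinearMap.ker ℓ' →ₗ[ℂ] ℂ := l ∘ₗ (LinearMap.ker ℓ').subtype with hl'
    have hl0 : l' ≠ 0 := by
      intro h0
      obtain ⟨c, hc⟩ := linearMap_eq_smul_of_forall_ker (l := l) hℓ' fun v hv => by
        simpa [hl'] using congrArg (fun m => m ⟨v, hv⟩) h0
      obtain ⟨v, hv⟩ := hne c
      refine hv ?_
      rw [← hQ, hl, hc]
      ring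
    have := h.card_mem_le_two (finrank_map_ker_le_two (finrank_ker_eq_three hℓ') hl0) (T := Tᶜ) (by
      intro i hi
      have hi' := Finset.mem_compl.1 hi
      refine ⟨⟨p i, hp i hi'⟩, ?_, rfl⟩
      have h1 := hl (p i)
      rw [hQ, hqp, eq_comm, mul_eq_zero] at h1
      exact h1.resolve_left fun h0 => hi' ((hT i).2 h0))
    omega

/-- If the nine points lie on two planes, that pair of planes is the only quadric through them. -/
lemma false_of_planes (h : IsNine f p) {ℓ ℓ' : (Fin 4 → ℂ) →ₗ[ℂ] ℂ} (hℓ : ℓ ≠ 0)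
    (hℓ' : ℓ' ≠ 0) (hp : ∀ i, ℓ (p i) * ℓ' (p i) = 0)
    {q : MvPolynomial (Fin 4) ℂ} (hq : q.IsHomogeneous 2) (hqp : ∀ i, eval (p i) q = 0)
    (hne : ∀ c : ℂ, ∃ v, eval v q ≠ c * (ℓ v * ℓ' v)) : False := by
  classical
  by_cases hcard : 5 ≤ (Finset.univ.filter fun i => ℓ (p i) = 0).card
  · exact h.false_of_planes_of_card hℓ hℓ' hcard (by simp)
      (fun i hi => (mul_eq_zero.1 (hp i)).resolve_left (by simpa using hi)) hq hqp hne
  · refine h.false_of_planes_of_card hℓ' hℓ (T := Finset.univ.filter fun i => ℓ' (p i) = 0) ?_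
      (by simp) (fun i hi => (mul_eq_zero.1 (hp i)).resolve_right (by simpa using hi)) hq hqp
      fun c => by simpa only [mul_comm (ℓ' _)] using hne c
    have h1 : (Finset.univ : Finset (Fin 9)) ⊆ (Finset.univ.filter fun i => ℓ (p i) = 0) ∪
        (Finset.univ.filter fun i => ℓ' (p i) = 0) := by
      intro i _
      simpa using hp i
    have h2 := (Finset.card_le_card h1).trans (Finset.card_union_le _ _)
    simp only [Finset.card_univ, Fintype.card_fin] at h2
    omega

end IsNine

/-- The coordinate ring `ℂ[X][ω]/(ω² - δ)` of a double cover of the affine line. -/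
abbrev DoubleCover (δ : Polynomial ℂ) := QuadraticAlgebra (Polynomial ℂ) δ 0

namespace DoubleCover

variable {δ : Polynomial ℂ}
open Polynomial in
/-- The ideal of the point `(s, w)` of the curve `w² = δ(s)`. -/
def ptIdeal (δ : Polynomial ℂ) (s w : ℂ) : Ideal (DoubleCover δ) :=
  Ideal.span {algebraMap (Polynomial ℂ) _ (Polynomial.X - Polynomial.C s),
    QuadraticAlgebra.omega - algebraMap ℂ _ w}

lemma eq_zero_of_norm_eq_zero (hδ : ∀ ε, ε ^ 2 ≠ δ) {z : DoubleCover δ}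
    (hz : QuadraticAlgebra.norm z = 0) : z = 0 := by
  have h : z.re ^ 2 = δ * z.im ^ 2 := by
    rw [QuadraticAlgebra.norm_def] at hz
    linear_combination hz
  by_cases him : z.im = 0
  · ext1
    · simpa [him] using h
    · exact him
  · obtain ⟨c, hc⟩ : z.im ∣ z.re :=
      (IsIntegrallyClosed.pow_dvd_pow_iff two_ne_zero).1 (Dvd.intro_left _ h.symm)
    refine absurd ?_ (hδ c)
    rw [hc] at h
    exact mul_right_cancel₀ (pow_ne_zero 2 him) (by linear_combination h)

lemma omega_sq : (QuadraticAlgebra.omega : DoubleCover δ) ^ 2 = algebraMap _ _ δ := by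
  rw [sq, QuadraticAlgebra.omega_mul_omega_eq_mk]; rfl

lemma ptIdeal_mul_le {s w : ℂ} (hw : w ^ 2 = δ.eval s) :
    ptIdeal δ s w * ptIdeal δ s (-w) ≤
      Ideal.span {algebraMap (Polynomial ℂ) _ (Polynomial.X - Polynomial.C s)} := by
  rw [ptIdeal, ptIdeal, Ideal.span_mul_span', Ideal.span_le]
  rintro _ ⟨a, ha, b, hb, rfl⟩
  rw [SetLike.mem_coe, Ideal.mem_span_singleton]
  rcases ha with rfl | rfl
  · exact dvd_mul_right _ _
  rcases hb with rfl | rfl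
  · exact dvd_mul_left _ _
  have : Polynomial.X - Polynomial.C s ∣ δ - Polynomial.C (w ^ 2) := by
    rw [Polynomial.dvd_iff_isRoot]; simp [hw]
  have h2 := map_dvd (algebraMap (Polynomial ℂ) (DoubleCover δ)) this
  convert h2 using 1
  rw [map_sub, ← omega_sq, ← Polynomial.algebraMap_eq, ← IsScalarTower.algebraMap_apply, map_pow,
    map_neg]
  ring

lemma star_mem {s w : ℂ} {k : ℕ} {z : DoubleCover δ} (hz : z ∈ ptIdeal δ s w ^ k) :
    star z ∈ ptIdeal δ s (-w) ^ k := by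
  have h : ptIdeal δ s w ≤ (ptIdeal δ s (-w)).comap (starRingEnd (DoubleCover δ)) := by
    rw [ptIdeal, Ideal.span_le]
    rintro x (rfl | rfl)
    · refine Ideal.subset_span (Or.inl ?_)
      ext1 <;> simp [starRingEnd_apply]
    · rw [SetLike.mem_coe, Ideal.mem_comap, ← neg_mem_iff]
      refine Ideal.subset_span (Or.inr ?_)
      ext1 <;> simp [starRingEnd_apply,
        IsScalarTower.algebraMap_apply ℂ (Polynomial ℂ) (DoubleCover δ)]
  have h2 := Ideal.pow_right_mono h k hz
  exact Ideal.le_comap_pow _ _ h2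

lemma pow_dvd_norm {s w : ℂ} (hw : w ^ 2 = δ.eval s) {k : ℕ} {z : DoubleCover δ}
    (hz : z ∈ ptIdeal δ s w ^ k) :
    (Polynomial.X - Polynomial.C s) ^ k ∣ QuadraticAlgebra.norm z := by
  rw [← QuadraticAlgebra.algebraMap_dvd_iff_dvd (a := δ) (b := 0),
    QuadraticAlgebra.algebraMap_norm_eq_mul_star, map_pow, ← Ideal.mem_span_singleton,
    ← Ideal.span_singleton_pow]
  refine Ideal.pow_right_mono (ptIdeal_mul_le hw) k ?_
  rw [mul_pow]
  exact Ideal.mul_mem_mul hz (star_mem hz)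

lemma pow_dvd_norm_of_pair {s w : ℂ} (hw : w ^ 2 = δ.eval s) (hw0 : w ≠ 0) {k : ℕ}
    {z : DoubleCover δ} (hz : z ∈ ptIdeal δ s w ^ k) (hz' : z ∈ ptIdeal δ s (-w) ^ k) :
    (Polynomial.X - Polynomial.C s) ^ (2 * k) ∣ QuadraticAlgebra.norm z := by
  have hco : IsCoprime (ptIdeal δ s w) (ptIdeal δ s (-w)) := by
    rw [Ideal.isCoprime_iff_sup_eq, Ideal.eq_top_iff_one]
    have h1 : (QuadraticAlgebra.omega - algebraMap ℂ _ w : DoubleCover δ) ∈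
        ptIdeal δ s w ⊔ ptIdeal δ s (-w) :=
      Ideal.mem_sup_left (Ideal.subset_span (Or.inr rfl))
    have h2 : (QuadraticAlgebra.omega - algebraMap ℂ _ (-w) : DoubleCover δ) ∈
        ptIdeal δ s w ⊔ ptIdeal δ s (-w) :=
      Ideal.mem_sup_right (Ideal.subset_span (Or.inr rfl))
    have h3 := Ideal.mul_mem_left _ (algebraMap ℂ (DoubleCover δ) (2 * w)⁻¹) (sub_mem h2 h1)
    convert h3 using 1
    rw [sub_sub_sub_cancel_left, ← map_sub, ← map_mul, ← map_one (algebraMap ℂ (DoubleCover δ))]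
    congr 1
    field_simp
    ring
  have hmem : z ∈ (ptIdeal δ s w * ptIdeal δ s (-w)) ^ k := by
    rw [mul_pow, Ideal.mul_eq_inf_of_isCoprime hco.pow]
    exact ⟨hz, hz'⟩
  have h := Ideal.pow_right_mono (ptIdeal_mul_le hw) k hmem
  rw [Ideal.span_singleton_pow, Ideal.mem_span_singleton] at h
  obtain ⟨y, rfl⟩ := h
  rw [map_mul, ← map_pow, QuadraticAlgebra.norm_algebraMap, ← pow_mul, mul_comm k]
  exact dvd_mul_right _ _

/-- A nonzero function on the double cover with few zeros of its norm does not vanish to order `k`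
at nine points of the curve. -/
lemma eq_zero_of_mem (hδ : ∀ ε, ε ^ 2 ≠ δ) {s w : Fin 9 → ℂ} (hw : ∀ i, w i ^ 2 = δ.eval (s i))
    (hinj : ∀ i j, s i = s j → w i = w j → i = j) {k : ℕ} {z : DoubleCover δ}
    (hz : ∀ i, w i ≠ 0 → z ∈ ptIdeal δ (s i) (w i) ^ k)
    (hz0 : ∀ i, w i = 0 → (Polynomial.X - Polynomial.C (s i)) ^ k ∣ QuadraticAlgebra.norm z)
    (hdeg : (QuadraticAlgebra.norm z).natDegree < 9 * k) : z = 0 := by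
  classical
  refine eq_zero_of_norm_eq_zero hδ ?_
  refine eq_zero_of_pow_dvd (Finset.univ.image s) id (Set.injOn_id _)
    (fun σ => (Finset.univ.filter fun i => s i = σ).card * k) le_rfl (one_dvd _) (by simp) ?_ ?_
  · intro σ hσ
    obtain ⟨i, -, rfl⟩ := Finset.mem_image.1 hσ
    have h1 : (Polynomial.X - Polynomial.C (s i)) ^ k ∣ QuadraticAlgebra.norm z := by
      by_cases h0 : w i = 0
      · exact hz0 i h0
      · exact pow_dvd_norm (hw i) (hz i h0)
    by_cases hj : ∃ j, j ≠ i ∧ s j = s i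
    · obtain ⟨j, hji, hs⟩ := hj
      have hneg : ∀ l, s l = s i → l = i ∨ w l = - w i := by
        intro l hl
        have : w l ^ 2 = w i ^ 2 := by rw [hw, hw, hl]
        exact (sq_eq_sq_iff_eq_or_eq_neg.1 this).imp (hinj l i hl) id
      have hwj : w j = - w i := (hneg j hs).resolve_left hji
      have hwi : w i ≠ 0 := by
        intro h0
        exact hji (hinj j i hs (by rw [hwj, h0, neg_zero]))
      have hcard : (Finset.univ.filter fun l => s l = s i) ⊆ {i, j} := by
        intro l hl
        have hl := (Finset.mem_filter.1 hl).2
        rcases hneg l hl with h | h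
        · simp [h]
        · simp [hinj l j (by rw [hl, hs]) (by rw [h, hwj])]
      refine (pow_dvd_pow _ ?_).trans (pow_dvd_norm_of_pair (hw i) hwi (hz i hwi) ?_)
      · exact Nat.mul_le_mul_right _ ((Finset.card_le_card hcard).trans Finset.card_le_two)
      · rw [← hwj, ← hs]
        exact hz j (by rw [hwj]; exact neg_ne_zero.2 hwi)
    · push Not at hj
      have hcard : (Finset.univ.filter fun l => s l = s i) ⊆ {i} := by
        intro l hl
        have hl := (Finset.mem_filter.1 hl).2
        by_contra hne
        exact hj l (by simpa using hne) hl
      refine (pow_dvd_pow _ ?_).trans h1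
      simpa using Nat.mul_le_mul_right k (Finset.card_le_card hcard)
  · have := Finset.card_eq_sum_card_image s (Finset.univ : Finset (Fin 9))
    rw [← Finset.sum_mul, ← this]
    simpa using hdeg

/-- The derivation of the double cover extending `2ω d/dX`. -/
def deriv (δ : Polynomial ℂ) : Derivation ℂ (DoubleCover δ) (DoubleCover δ) :=
  Derivation.mk'
    { toFun z := ⟨2 * δ * Polynomial.derivative z.im + Polynomial.derivative δ * z.im,
        2 * Polynomial.derivative z.re⟩
      map_add' x y := by ext1 <;> simp <;> ring
      map_smul' c x := by
        ext1 <;> simp [Polynomial.smul_eq_C_mul] <;> ring }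
    fun x y => by
      ext1 <;> simp <;> ring

end DoubleCover

/-- The parametrisation of the cone over a conic by a polynomial ring in two variables. -/
def coneSubst : Fin 4 → Polynomial (Polynomial ℂ) :=
  ![Polynomial.C (Polynomial.X ^ 2), Polynomial.C Polynomial.X, 1, Polynomial.X]

/-- The restriction of a form to the cone, as a polynomial in the fibre coordinate. -/
def coneRestrict (f : MvPolynomial (Fin 4) ℂ) : Polynomial (Polynomial ℂ) := aeval coneSubst f

lemma coeff_coneRestrict {d : ℕ} {f : MvPolynomial (Fin 4) ℂ} (hf : f.IsHomogeneous d) {k j : ℕ}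
    (h : 2 * d < j + 2 * k) : ((coneRestrict f).coeff k).coeff j = 0 := by
  rw [coneRestrict, f.as_sum, map_sum, Polynomial.finsetSum_coeff, Polynomial.finsetSum_coeff]
  refine Finset.sum_eq_zero fun m hm => ?_
  have hm1 := hf (mem_support_iff.1 hm)
  rw [Finsupp.weight_apply, Finsupp.sum_fintype _ _ (by simp), Fin.sum_univ_four] at hm1
  simp only [Pi.one_apply, smul_eq_mul, mul_one] at hm1
  have he : aeval coneSubst (monomial m (coeff m f)) =
      Polynomial.C (Polynomial.C (coeff m f) * Polynomial.X ^ (2 * m 0 + m 1)) *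
        Polynomial.X ^ m 3 := by
    rw [aeval_monomial, Finsupp.prod_fintype _ _ (by simp), Fin.prod_univ_four,
      IsScalarTower.algebraMap_apply ℂ (Polynomial ℂ) (Polynomial (Polynomial ℂ))]
    simp [coneSubst, Polynomial.algebraMap_eq]
    ring
  rw [he, Polynomial.coeff_C_mul_X_pow]
  split_ifs with hk
  · rw [Polynomial.coeff_C_mul_X_pow, if_neg (by omega)]
  · simp

lemma coneRestrict_coeff_natDegree {d m k : ℕ} {f : MvPolynomial (Fin 4) ℂ}
    (hf : f.IsHomogeneous d) (h : 2 * d ≤ m + 2 * k) :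
    ((coneRestrict f).coeff k).natDegree ≤ m :=
  Polynomial.natDegree_le_iff_coeff_eq_zero.2 fun j hj => coeff_coneRestrict hf (by omega)

lemma coneRestrict_coeff_eq_zero {d k : ℕ} {f : MvPolynomial (Fin 4) ℂ}
    (hf : f.IsHomogeneous d) (h : d < k) : (coneRestrict f).coeff k = 0 :=
  Polynomial.ext fun j => by simpa using coeff_coneRestrict hf (by omega)

lemma coneRestrict_pderiv_coeff (f : MvPolynomial (Fin 4) ℂ) (k : ℕ) :
    (coneRestrict (pderiv 3 f)).coeff k = (coneRestrict f).coeff (k + 1) * (k + 1) := by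
  have h := derivation_aeval ((Polynomial.derivative' (R := Polynomial ℂ)).restrictScalars ℂ)
    coneSubst f
  rw [Fin.sum_univ_four] at h
  simp [coneSubst, Polynomial.derivative'] at h
  rw [← Polynomial.coeff_derivative, coneRestrict, coneRestrict]
  simp [coneSubst, h]

lemma aeval_eq_coneRestrict {R : Type*} [CommRing R] [Algebra ℂ R] (φ : Polynomial ℂ →ₐ[ℂ] R)
    (y : R) {d : ℕ} (hd : d < 7) {f : MvPolynomial (Fin 4) ℂ} (hf : f.IsHomogeneous d) :
    aeval ![φ Polynomial.X ^ 2, φ Polynomial.X, 1, y] f =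
      ∑ k ∈ Finset.range 7, φ ((coneRestrict f).coeff k) * y ^ k := by
  have h1 : (coneRestrict f).natDegree < 7 :=
    lt_of_le_of_lt (Polynomial.natDegree_le_iff_coeff_eq_zero.2 fun k hk =>
      coneRestrict_coeff_eq_zero hf hk) hd
  have h2 := Polynomial.eval₂_eq_sum_range' (φ : Polynomial ℂ →+* R) h1 y
  simp only [RingHom.coe_coe] at h2
  rw [← h2, coneRestrict]
  have h3 : ((aeval ![φ Polynomial.X ^ 2, φ Polynomial.X, 1, y] : _ →ₐ[ℂ] R) : _ →+* R) =
      (Polynomial.eval₂RingHom (φ : Polynomial ℂ →+* R) y).comp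
        (aeval coneSubst : _ →ₐ[ℂ] Polynomial (Polynomial ℂ)).toRingHom := by
    ext i
    · simpa [IsScalarTower.algebraMap_apply ℂ (Polynomial ℂ) (Polynomial (Polynomial ℂ))] using
        (φ.commutes i).symm
    · fin_cases i <;> simp [coneSubst, Polynomial.eval₂_pow]
  exact RingHom.congr_fun h3 f

lemma pow_dvd_coneRestrict_coeff {s : ℂ} {n : ℕ} {f : MvPolynomial (Fin 4) ℂ}
    (hf : f ∈ pointIdeal ![s ^ 2, s, 1, 0] ^ n) (k : ℕ) :
    (Polynomial.X - Polynomial.C s) ^ (n - k) ∣ (coneRestrict f).coeff k := by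
  have h := aeval_mem_pow hf coneSubst (Ideal.span {Polynomial.C (Polynomial.X - Polynomial.C s),
    Polynomial.X}) ?_
  · change coneRestrict f ∈ _ at h
    generalize coneRestrict f = z at h
    induction n generalizing k z with
    | zero => simp
    | succ n ih =>
      rw [pow_succ] at h
      refine Submodule.mul_induction_on h ?_ ?_
      · intro a ha b hb
        obtain ⟨x, y, rfl⟩ := Ideal.mem_span_pair.1 hb
        have ih' := fun k c => ih (hf := Ideal.pow_le_pow_right n.le_succ hf) k (a * c)
          (Ideal.mul_mem_right c _ ha)
        have he : a * (x * Polynomial.C (Polynomial.X - Polynomial.C s) + y * Polynomial.X) =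
          Polynomial.C (Polynomial.X - Polynomial.C s) * (a * x) + (a * y) * Polynomial.X := by ring
        rw [he, Polynomial.coeff_add, Polynomial.coeff_C_mul]
        refine dvd_add ?_ ?_
        · refine (pow_dvd_pow _ (show n + 1 - k ≤ 1 + (n - k) by omega)).trans ?_
          rw [pow_add, pow_one]
          exact mul_dvd_mul_left _ (ih' k x)
        · cases k with
          | zero => simp
          | succ k =>
            rw [Polynomial.coeff_mul_X, Nat.succ_sub_succ]
            exact ih' k y
      · intro a b ha hb
        rw [Polynomial.coeff_add]
        exact dvd_add ha hb
  · have hC : ∀ a : ℂ, algebraMap ℂ (Polynomial (Polynomial ℂ)) a = Polynomial.C (Polynomial.C a) :=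
      fun a => rfl
    have h1 : Polynomial.C (Polynomial.X - Polynomial.C s) ∈ Ideal.span
      {Polynomial.C (Polynomial.X - Polynomial.C s), Polynomial.X} := Ideal.subset_span (Or.inl rfl)
    have h2 : Polynomial.X ∈ Ideal.span
      {Polynomial.C (Polynomial.X - Polynomial.C s), Polynomial.X} := Ideal.subset_span (Or.inr rfl)
    intro i
    fin_cases i
    · convert Ideal.mul_mem_left _ (Polynomial.C (Polynomial.X + Polynomial.C s)) h1 using 1
      simp [coneSubst, hC]; ring
    · convert h1 using 1
      simp [coneSubst, hC]
    · convert Ideal.zero_mem _ using 1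
      simp [coneSubst]
    · convert h2 using 1
      simp [coneSubst]

namespace DoubleCover

variable {δ : Polynomial ℂ}

/-- The parametrisation of the curve `w² = δ(s)` on the cone. -/
def param (δ : Polynomial ℂ) : Fin 4 → DoubleCover δ :=
  ![IsScalarTower.toAlgHom ℂ (Polynomial ℂ) (DoubleCover δ) Polynomial.X ^ 2,
    IsScalarTower.toAlgHom ℂ (Polynomial ℂ) (DoubleCover δ) Polynomial.X, 1, QuadraticAlgebra.omega]

lemma aeval_param_mem {s w : ℂ} {k : ℕ} {g : MvPolynomial (Fin 4) ℂ}
    (hg : g ∈ pointIdeal ![s ^ 2, s, 1, w] ^ k) : aeval (param δ) g ∈ ptIdeal δ s w ^ k := by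
  refine aeval_mem_pow hg _ _ fun i => ?_
  have h1 : algebraMap (Polynomial ℂ) (DoubleCover δ) (Polynomial.X - Polynomial.C s) ∈
    ptIdeal δ s w := Ideal.subset_span (Or.inl rfl)
  have h2 : QuadraticAlgebra.omega - algebraMap ℂ _ w ∈ ptIdeal δ s w :=
    Ideal.subset_span (Or.inr rfl)
  have hC : ∀ a : ℂ, algebraMap ℂ (DoubleCover δ) a =
      algebraMap (Polynomial ℂ) (DoubleCover δ) (Polynomial.C a) := fun a => rfl
  fin_cases i
  · convert Ideal.mul_mem_left _ (algebraMap (Polynomial ℂ) (DoubleCover δ)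
      (Polynomial.X + Polynomial.C s)) h1 using 1
    simp [param, hC]; ring
  · convert h1 using 1
    simp [param, hC]
  · convert Ideal.zero_mem _ using 1
    simp [param]
  · exact h2

lemma aeval_param {d : ℕ} (hd : d < 7) {g : MvPolynomial (Fin 4) ℂ} (hg : g.IsHomogeneous d) :
    (aeval (param δ) g).re = (coneRestrict g).coeff 0 + δ * (coneRestrict g).coeff 2 +
        δ ^ 2 * (coneRestrict g).coeff 4 + δ ^ 3 * (coneRestrict g).coeff 6 ∧
      (aeval (param δ) g).im = (coneRestrict g).coeff 1 + δ * (coneRestrict g).coeff 3 +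
        δ ^ 2 * (coneRestrict g).coeff 5 := by
  rw [param, aeval_eq_coneRestrict _ _ hd hg]
  simp only [Finset.sum_range_succ, Finset.sum_range_zero, pow_succ, pow_zero]
  constructor <;> simp <;> ring

lemma eval_of_aeval_param {d : ℕ} (hd : d < 7) {g : MvPolynomial (Fin 4) ℂ}
    (hg : g.IsHomogeneous d) {s w : ℂ} (hw : w ^ 2 = δ.eval s) (h : aeval (param δ) g = 0) :
    eval ![s ^ 2, s, 1, w] g = 0 := by
  obtain ⟨h1, h2⟩ := aeval_param (δ := δ) hd hg
  have h3 := aeval_eq_coneRestrict (Polynomial.aeval s) w hd hg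
  rw [h] at h1 h2
  replace h1 := congrArg (Polynomial.eval s) h1
  replace h2 := congrArg (Polynomial.eval s) h2
  simp [← hw] at h1 h2
  change eval ![_, _, _, _] g = _ at h3
  simp only [Finset.sum_range_succ, Finset.sum_range_zero, Polynomial.coe_aeval_eq_eval,
    Polynomial.eval_X] at h3
  rw [h3]
  linear_combination -h1 - w * h2

lemma norm_natDegree_lt {n a b : ℕ} {z : DoubleCover δ} (hδ : δ.natDegree ≤ 4)
    (ha : z.re.natDegree ≤ a) (hb : z.im.natDegree ≤ b) (h1 : 2 * a < n) (h2 : 4 + 2 * b < n) :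
    (QuadraticAlgebra.norm z).natDegree < n := by
  rw [QuadraticAlgebra.norm_def, zero_mul, zero_mul, add_zero]
  refine (Polynomial.natDegree_sub_le _ _).trans_lt (max_lt ?_ ?_)
  · exact lt_of_le_of_lt (Polynomial.natDegree_mul_le_of_le ha ha) (by omega)
  · exact lt_of_le_of_lt (Polynomial.natDegree_mul_le_of_le
      (Polynomial.natDegree_mul_le_of_le hδ hb) hb) (by omega)

lemma natDegree_pow_mul_coeff_le {d j k n : ℕ} (hδ : δ.natDegree ≤ 4)
    {g : MvPolynomial (Fin 4) ℂ} (hg : g.IsHomogeneous d) (h : 4 * j + 2 * d ≤ n + 2 * k) :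
    (δ ^ j * (coneRestrict g).coeff k).natDegree ≤ n := by
  by_cases hk : d < k
  · simp [coneRestrict_coeff_eq_zero hg hk]
  · have h1 := coneRestrict_coeff_natDegree (m := 2 * (d - k)) (k := k) hg (by omega)
    exact (Polynomial.natDegree_mul_le_of_le (Polynomial.natDegree_pow_le_of_le j hδ) h1).trans
      (by omega)

lemma natDegree_re_le {d : ℕ} (hd : d < 7) (hδ : δ.natDegree ≤ 4)
    {g : MvPolynomial (Fin 4) ℂ} (hg : g.IsHomogeneous d) :
    (aeval (param δ) g).re.natDegree ≤ 2 * d := by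
  have hb := fun j => natDegree_pow_mul_coeff_le (j := j) (k := 2 * j) (n := 2 * d) hδ hg (by omega)
  rw [(aeval_param hd hg).1]
  refine Polynomial.natDegree_add_le_of_degree_le (Polynomial.natDegree_add_le_of_degree_le
    (Polynomial.natDegree_add_le_of_degree_le ?_ ?_) (hb 2)) (hb 3)
  · simpa using hb 0
  · simpa using hb 1

lemma natDegree_im_le {d n : ℕ} (hd : d < 7) (hdn : 2 * d ≤ n + 2) (hδ : δ.natDegree ≤ 4)
    {g : MvPolynomial (Fin 4) ℂ} (hg : g.IsHomogeneous d) :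
    (aeval (param δ) g).im.natDegree ≤ n := by
  have hb := fun j => natDegree_pow_mul_coeff_le (j := j) (k := 2 * j + 1) (n := n) hδ hg (by omega)
  rw [(aeval_param hd hg).2]
  refine Polynomial.natDegree_add_le_of_degree_le (Polynomial.natDegree_add_le_of_degree_le ?_ ?_)
    (hb 2)
  · simpa using hb 0
  · simpa using hb 1

lemma omega_mul_eq_zero (hδ : ∀ ε, ε ^ 2 ≠ δ) {z : DoubleCover δ}
    (hz : QuadraticAlgebra.omega * z = 0) : z = 0 := by
  refine eq_zero_of_norm_eq_zero hδ ?_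
  have h := congrArg QuadraticAlgebra.norm hz
  rw [map_mul, QuadraticAlgebra.norm_zero] at h
  refine (mul_eq_zero.1 h).resolve_left fun h0 => ?_
  have := eq_zero_of_norm_eq_zero hδ h0
  simpa using congrArg QuadraticAlgebra.im this

lemma half_mul_two : algebraMap ℂ (DoubleCover δ) 2⁻¹ * 2 = 1 := by
  rw [← map_ofNat (algebraMap ℂ (DoubleCover δ)) 2, ← map_mul]
  simp

lemma mem_of_omega_mul_mem {s w : ℂ} (hw : w ≠ 0) {z : DoubleCover δ}
    (hz : 2 * (QuadraticAlgebra.omega * z) ∈ ptIdeal δ s w ^ 2) : z ∈ ptIdeal δ s w ^ 2 := by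
  set v := algebraMap ℂ (DoubleCover δ) w
  have h1 : (QuadraticAlgebra.omega - v) ^ 2 ∈ ptIdeal δ s w ^ 2 :=
    Ideal.pow_mem_pow (show QuadraticAlgebra.omega - v ∈ ptIdeal δ s w from
      Ideal.subset_span (Or.inr rfl)) 2
  have h2 : v ^ 2 * z ∈ ptIdeal δ s w ^ 2 := by
    have h3 := add_mem (Ideal.mul_mem_right z _ h1) (Ideal.mul_mem_left _
      (v - algebraMap ℂ (DoubleCover δ) 2⁻¹ * QuadraticAlgebra.omega) hz)
    convert h3 using 1
    linear_combination QuadraticAlgebra.omega ^ 2 * z * half_mul_two (δ := δ)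
  have h5 := Ideal.mul_mem_left _ (algebraMap ℂ (DoubleCover δ) w⁻¹ ^ 2) h2
  rwa [← mul_assoc, ← mul_pow, ← map_mul, inv_mul_cancel₀ hw, map_one, one_pow, one_mul] at h5

end DoubleCover

namespace IsNine

open DoubleCover

variable {f : MvPolynomial (Fin 4) ℂ} {p : Fin 9 → Fin 4 → ℂ} {s w : Fin 9 → ℂ} {δ : Polynomial ℂ}
  (h : IsNine f p) (hp : ∀ i, p i = ![s i ^ 2, s i, 1, w i]) (hδ : δ.natDegree ≤ 4)
  (hns : ∀ ε, ε ^ 2 ≠ δ) (hw : ∀ i, w i ^ 2 = δ.eval (s i))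

include h hp hns hw in
lemma eq_zero_of_mem_ptIdeal {k : ℕ} {z : DoubleCover δ}
    (hz : ∀ i, w i ≠ 0 → z ∈ ptIdeal δ (s i) (w i) ^ k)
    (hz0 : ∀ i, w i = 0 → (Polynomial.X - Polynomial.C (s i)) ^ k ∣ QuadraticAlgebra.norm z)
    (hdeg : (QuadraticAlgebra.norm z).natDegree < 9 * k) : z = 0 := by
  refine DoubleCover.eq_zero_of_mem hns hw (fun i j h1 h2 => ?_) hz hz0 hdeg
  by_contra hij
  exact h.indep i j hij 1 (by rw [hp, hp, h1, h2, one_smul])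

include h hp hδ hns hw in
lemma aeval_param_eq_zero : aeval (param δ) f = 0 := by
  have hm : ∀ i, aeval (param δ) f ∈ ptIdeal δ (s i) (w i) ^ 3 := fun i =>
    aeval_param_mem (hp i ▸ h.triple i)
  refine h.eq_zero_of_mem_ptIdeal hp hns hw (fun i _ => hm i)
    (fun i _ => pow_dvd_norm (hw i) (hm i)) ?_
  exact norm_natDegree_lt hδ (natDegree_re_le (by norm_num) hδ h.homog)
    (natDegree_im_le (n := 10) (by norm_num) (by norm_num) hδ h.homog) (by norm_num) (by norm_num)

include h hp hδ hns hw in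
lemma aeval_param_pderiv_three_eq_zero : aeval (param δ) (pderiv 3 f) = 0 := by
  obtain ⟨h1, h2⟩ := aeval_param (δ := δ) (by norm_num) h.homog
  obtain ⟨h3, h4⟩ := aeval_param (δ := δ) (by norm_num) (h.homog_pderiv 3)
  rw [h.aeval_param_eq_zero hp hδ hns hw] at h1 h2
  simp only [coneRestrict_pderiv_coeff, QuadraticAlgebra.re_zero, QuadraticAlgebra.im_zero] at *
  have h7 : (coneRestrict f).coeff 7 = 0 := coneRestrict_coeff_eq_zero h.homog (by norm_num)
  have hb := fun k => pow_dvd_coneRestrict_coeff (s := k) (n := 3) (f := f)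
  have hdeg := fun j k n => natDegree_pow_mul_coeff_le (j := j) (k := k) (n := n) hδ h.homog
  set c := (coneRestrict f).coeff
  set G : DoubleCover δ := ⟨c 2 + 2 * (δ * c 4) + 3 * (δ ^ 2 * c 6), c 3 + 2 * (δ * c 5)⟩ with hG
  have hu : aeval (param δ) (pderiv 3 f) = 2 * (QuadraticAlgebra.omega * G) := by
    ext1
    · rw [h3]
      simp [h7, hG, two_mul]
      linear_combination -h2
    · rw [h4]
      simp [hG, two_mul]
      ring
  have hG0 : G = 0 := by
    refine h.eq_zero_of_mem_ptIdeal hp hns hw (k := 2) (fun i hi => ?_) (fun i hi => ?_) ?_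
    · refine mem_of_omega_mul_mem hi ?_
      rw [← hu]
      exact aeval_param_mem (hp i ▸ h.pderiv_mem i 3)
    · have hf3 := h.triple i
      rw [hp, hi] at hf3
      have hc1 := hb _ hf3 1
      have hc2 := hb _ hf3 2
      set τ := Polynomial.X - Polynomial.C (s i)
      have hδτ : τ ∣ δ := by
        rw [Polynomial.dvd_iff_isRoot, Polynomial.IsRoot.def, ← hw, hi, zero_pow two_ne_zero]
      have hU : τ ∣ G.re := by
        refine dvd_add (dvd_add (by simpa using hc2) ?_) ?_
        · exact Dvd.dvd.mul_left (hδτ.mul_right _) _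
        · exact Dvd.dvd.mul_left ((hδτ.trans (dvd_pow_self _ two_ne_zero)).mul_right _) _
      have hV : τ ^ 2 ∣ δ * G.im * G.im := by
        by_cases hsq : τ ^ 2 ∣ δ
        · exact (hsq.mul_right _).mul_right _
        · obtain ⟨e, he⟩ := hδτ
          have hτ : τ ≠ 0 := Polynomial.X_sub_C_ne_zero _
          have h5 : τ ∣ c 3 + δ * c 5 := by
            have h6 : τ ^ 2 ∣ δ * (c 3 + δ * c 5) := by
              have : δ * (c 3 + δ * c 5) = - c 1 := by linear_combination -h2
              rw [this]
              exact dvd_neg.2 hc1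
            rw [he, sq, mul_assoc, mul_dvd_mul_iff_left hτ, ← he] at h6
            refine ((Polynomial.prime_X_sub_C (s i)).dvd_or_dvd h6).resolve_left fun h8 => hsq ?_
            rw [he, sq]
            exact mul_dvd_mul_left _ h8
          have h6 : τ ∣ G.im := by
            have : G.im = (c 3 + δ * c 5) + δ * c 5 := by simp only [hG]; ring
            rw [this]
            exact dvd_add h5 (Dvd.dvd.mul_right ⟨e, he⟩ _)
          rw [mul_assoc]
          exact Dvd.dvd.mul_left (by rw [sq]; exact mul_dvd_mul h6 h6) _
      rw [QuadraticAlgebra.norm_def, zero_mul, zero_mul, add_zero]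
      exact dvd_sub (by rw [sq]; exact mul_dvd_mul hU hU) hV
    · have hC : ∀ (a : ℂ) {P : Polynomial ℂ} {n : ℕ}, P.natDegree ≤ n →
          (Polynomial.C a * P).natDegree ≤ n := fun a P n hP =>
        (Polynomial.natDegree_C_mul_le _ _).trans hP
      refine norm_natDegree_lt hδ (a := 8) (b := 6) ?_ ?_ (by norm_num) (by norm_num)
      · refine Polynomial.natDegree_add_le_of_degree_le (Polynomial.natDegree_add_le_of_degree_le
          ?_ (hC 2 ?_)) (hC 3 (hdeg 2 6 8 (by norm_num)))
        · simpa using hdeg 0 2 8 (by norm_num)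
        · simpa using hdeg 1 4 8 (by norm_num)
      · refine Polynomial.natDegree_add_le_of_degree_le ?_ (hC 2 ?_)
        · simpa using hdeg 0 3 6 (by norm_num)
        · simpa using hdeg 1 5 6 (by norm_num)
  rw [hu, hG0, mul_zero, mul_zero]

include h hp hδ hns hw in
lemma aeval_param_pderiv_eq_zero (l : Fin 4) : aeval (param δ) (pderiv l f) = 0 := by
  have h0 := h.aeval_param_eq_zero hp hδ hns hw
  have h3 := h.aeval_param_pderiv_three_eq_zero hp hδ hns hw
  have hE := euler_aeval h.homog (param δ)
  have hD := derivation_aeval (DoubleCover.deriv δ) (param δ) f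
  rw [h0, Fin.sum_univ_four, h3] at hE hD
  set φ := IsScalarTower.toAlgHom ℂ (Polynomial ℂ) (DoubleCover δ)
  set x := φ Polynomial.X with hx
  have e0 : param δ 0 = x ^ 2 := rfl
  have e1 : param δ 1 = x := rfl
  have e2 : param δ 2 = 1 := rfl
  have hDx : DoubleCover.deriv δ x = 2 * QuadraticAlgebra.omega := by
    ext1 <;> simp [hx, φ, DoubleCover.deriv, two_mul]
  have hm := fun l i => aeval_param_mem (δ := δ) (hp i ▸ h.pderiv_mem i l)
  set a0 := aeval (param δ) (pderiv 0 f) with ha0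
  set a1 := aeval (param δ) (pderiv 1 f)
  set a2 := aeval (param δ) (pderiv 2 f) with ha2
  have h1 : a1 = - (2 * x * a0) := by
    rw [eq_neg_iff_add_eq_zero]
    refine omega_mul_eq_zero hns ?_
    simp only [e0, e1, e2, map_zero, Derivation.leibniz_pow, hDx, Derivation.map_one_eq_zero,
      mul_zero, zero_mul] at hD
    simp only [nsmul_eq_mul, smul_eq_mul, Nat.add_one_sub_one, pow_one, add_zero] at hD
    push_cast at hD
    linear_combination -algebraMap ℂ (DoubleCover δ) 2⁻¹ * hD -
      QuadraticAlgebra.omega * (a1 + 2 * x * a0) * half_mul_two (δ := δ)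
  have h2 : a2 = x ^ 2 * a0 := by
    rw [e0, e1, e2, h1] at hE
    linear_combination hE
  have hz : a0 = 0 := by
    refine h.eq_zero_of_mem_ptIdeal hp hns hw (k := 2) (fun i _ => hm 0 i)
      (fun i _ => pow_dvd_norm (hw i) (hm 0 i)) ?_
    have hre := natDegree_re_le (by norm_num) hδ (h.homog_pderiv 2)
    have him := natDegree_im_le (n := 8) (by norm_num) (by norm_num) hδ (h.homog_pderiv 2)
    have hx2 : x ^ 2 = algebraMap (Polynomial ℂ) _ (Polynomial.X ^ 2) := (map_pow φ _ _).symm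
    have hX : ∀ {P : Polynomial ℂ} {n : ℕ}, (Polynomial.X ^ 2 * P).natDegree ≤ n + 2 →
        P.natDegree ≤ n := by
      intro P n hP
      by_cases h0 : P = 0
      · simp [h0]
      · rw [Polynomial.natDegree_X_pow_mul _ h0] at hP
        omega
    rw [← ha2, h2, hx2] at hre him
    refine norm_natDegree_lt hδ (a := 8) (b := 6) (hX ?_) (hX ?_) (by norm_num) (by norm_num)
    · simpa only [QuadraticAlgebra.re_mul, QuadraticAlgebra.algebraMap_re,
        QuadraticAlgebra.algebraMap_im, mul_zero, zero_mul, add_zero] using hre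
    · simpa only [QuadraticAlgebra.im_mul, QuadraticAlgebra.algebraMap_re,
        QuadraticAlgebra.algebraMap_im, mul_zero, zero_mul, add_zero] using him
  fin_cases l
  · exact hz
  · exact h1.trans (by rw [hz, mul_zero, neg_zero])
  · exact h2.trans (by rw [hz, mul_zero])
  · exact h3

include h hp hδ hns hw in
/-- Nine triple points cannot lie on a quartic curve cut on a quadric cone by another quadric. -/
lemma false_of_doubleCover : False := by
  have hsq : ∀ s : ℂ, ∃ w, w ^ 2 = δ.eval s := fun s => IsAlgClosed.exists_pow_nat_eq _ two_pos
  choose r hr using hsq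
  refine h.not_infinite Set.infinite_univ (fun s => ![s ^ 2, s, 1, r s]) ?_ ?_ ?_
  · intro s _ h0
    simpa using congrFun h0 2
  · intro s _ t _ c hc
    have h1 := congrFun hc 1
    have h2 := congrFun hc 2
    simp at h1 h2
    rw [h1, ← h2, one_mul]
  · intro s _ j
    exact eval_of_aeval_param (by norm_num) (h.homog_pderiv j) (hr s)
      (h.aeval_param_pderiv_eq_zero hp hδ hns hw j)

end IsNine

/-- The parametrisation of the curve `β(s) w + γ(s) = 0` on the cone. -/
def ratParam (β γ : Polynomial ℂ) : Fin 4 → Polynomial ℂ :=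
  ![Polynomial.X ^ 2 * β, Polynomial.X * β, β, -γ]

lemma ratParam_natDegree {β γ : Polynomial ℂ} {n : ℕ} (hβ : β.natDegree ≤ n)
    (hγ : γ.natDegree ≤ n + 2) (i : Fin 4) : (ratParam β γ i).natDegree ≤ n + 2 := by
  fin_cases i
  · exact (Polynomial.natDegree_mul_le_of_le (Polynomial.natDegree_X_pow_le 2) hβ).trans (by omega)
  · exact (Polynomial.natDegree_mul_le_of_le Polynomial.natDegree_X_le hβ).trans (by omega)
  · exact hβ.trans (by simp)
  · exact (Polynomial.natDegree_neg γ).le.trans hγ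

lemma pow_dvd_aeval_ratParam {β γ : Polynomial ℂ} {s w : ℂ} (hs : β.eval s ≠ 0)
    (hw : β.eval s * w + γ.eval s = 0) {d k : ℕ} {g : MvPolynomial (Fin 4) ℂ}
    (hg : g.IsHomogeneous d) (hm : g ∈ pointIdeal ![s ^ 2, s, 1, w] ^ k) :
    (Polynomial.X - Polynomial.C s) ^ k ∣ aeval (ratParam β γ) g := by
  refine pow_dvd_aeval (smul_mem_pow hs hg hm) fun i => ?_
  fin_cases i
  · simp [ratParam]; ring
  · simp [ratParam]; ring
  · simp [ratParam]
  · simp [ratParam]; linear_combination -hw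

lemma pow_dvd_aeval_ratParam_of_vertex {β γ : Polynomial ℂ} (hco : IsCoprime β γ) {d k : ℕ}
    {g : MvPolynomial (Fin 4) ℂ} (hg : g.IsHomogeneous d)
    (hm : g ∈ pointIdeal ![0, 0, 0, 1] ^ k) : β ^ k ∣ aeval (ratParam β γ) g := by
  obtain ⟨a, b, hab⟩ := hco
  have hcop : IsCoprime β (-b) := ⟨a, -γ, by linear_combination hab⟩
  have hβ : β ∈ Ideal.span {β} := Ideal.subset_span rfl
  have h1 := aeval_mem_pow hm (fun i => -b * ratParam β γ i) (Ideal.span {β}) fun i => by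
    fin_cases i
    · convert Ideal.mul_mem_left _ (-b * Polynomial.X ^ 2) hβ using 1
      simp [ratParam]; ring
    · convert Ideal.mul_mem_left _ (-b * Polynomial.X) hβ using 1
      simp [ratParam]; ring
    · convert Ideal.mul_mem_left _ (-b) hβ using 1
      simp [ratParam]
    · convert Ideal.mul_mem_left _ (-a) hβ using 1
      simp [ratParam]; linear_combination hab
  rw [aeval_smul_of_homogeneous hg, Ideal.span_singleton_pow, Ideal.mem_span_singleton] at h1
  exact (hcop.pow (m := k) (n := d)).dvd_of_dvd_mul_left h1

lemma dvd_aeval_ratParam_sub (β γ : Polynomial ℂ) {d : ℕ} {g : MvPolynomial (Fin 4) ℂ}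
    (hg : g.IsHomogeneous d) :
    β ∣ aeval (ratParam β γ) g - (-γ) ^ d * Polynomial.C (eval ![0, 0, 0, 1] g) := by
  have hβ : β ∈ Ideal.span {β} := Ideal.subset_span rfl
  have h1 : aeval (fun i => -γ * Polynomial.C ((![0, 0, 0, 1] : Fin 4 → ℂ) i)) g =
      (-γ) ^ d * Polynomial.C (eval ![0, 0, 0, 1] g) := by
    rw [aeval_smul_of_homogeneous hg]
    congr 1
    rw [← Polynomial.algebraMap_eq]
    exact MvPolynomial.aeval_algebraMap_apply _ _ _
  rw [← h1, ← Ideal.mem_span_singleton]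
  refine aeval_sub_aeval_mem _ (fun i => ?_) g
  fin_cases i
  · convert Ideal.mul_mem_left _ (Polynomial.X ^ 2) hβ using 1
    simp [ratParam]
  · convert Ideal.mul_mem_left _ Polynomial.X hβ using 1
    simp [ratParam]
  · convert hβ using 1
    simp [ratParam]
  · simp [ratParam]

namespace IsNine

variable {f : MvPolynomial (Fin 4) ℂ} {p : Fin 9 → Fin 4 → ℂ} {s w : Fin 9 → ℂ}
  {β γ : Polynomial ℂ} {n : ℕ} {T : Finset (Fin 9)}

/-- The nine points cannot mostly lie on a rational curve `β(s) w + γ(s) = 0` on the cone: such a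
curve would consist of singular points. -/
lemma false_of_ratParam (h : IsNine f p) (hp : ∀ i ∈ T, p i = ![s i ^ 2, s i, 1, w i])
    (hco : IsCoprime β γ) (hn : n ≠ 0) (hβ : β.natDegree = n) (hγ : γ.natDegree ≤ n + 2)
    (hw : ∀ i ∈ T, β.eval (s i) * w i + γ.eval (s i) = 0)
    (hcase : n = 1 ∧ 7 ≤ T.card ∨ n = 2 ∧ 9 ≤ T.card ∨
      n = 2 ∧ 8 ≤ T.card ∧ f ∈ pointIdeal ![0, 0, 0, 1] ^ 3) : False := by
  have hβ0 : β ≠ 0 := by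
    rintro rfl
    exact hn (by simpa using hβ.symm)
  have hs : ∀ i ∈ T, β.eval (s i) ≠ 0 := by
    intro i hi h0
    have h1 := hw i hi
    rw [h0, zero_mul, zero_add] at h1
    obtain ⟨a, b, hab⟩ := hco
    simpa [h0, h1] using congrArg (Polynomial.eval (s i)) hab
  have hinj : Set.InjOn s T := by
    intro i hi j hj hij
    by_contra hne
    refine h.indep i j hne 1 ?_
    have : w i = w j := by
      have h1 := hw i hi
      have h2 := hw j hj
      rw [← hij] at h2
      exact mul_left_cancel₀ (hs i hi) (by linear_combination h1 - h2)
    rw [hp i hi, hp j hj, hij, this, one_smul]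
  have hdeg : ∀ {d : ℕ} {g : MvPolynomial (Fin 4) ℂ}, g.IsHomogeneous d →
      (aeval (ratParam β γ) g).natDegree ≤ d * (n + 2) := fun hg =>
    natDegree_aeval_le hg (ratParam_natDegree hβ.le hγ)
  have hm : ∀ i ∈ T, (Polynomial.X - Polynomial.C (s i)) ^ 3 ∣ aeval (ratParam β γ) f :=
    fun i hi => pow_dvd_aeval_ratParam (hs i hi) (hw i hi) h.homog (hp i hi ▸ h.triple i)
  have hml : ∀ l, ∀ i ∈ T,
      (Polynomial.X - Polynomial.C (s i)) ^ 2 ∣ aeval (ratParam β γ) (pderiv l f) :=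
    fun l i hi => pow_dvd_aeval_ratParam (hs i hi) (hw i hi) (h.homog_pderiv l)
      (hp i hi ▸ h.pderiv_mem i l)
  have hzero : ∀ (P G : Polynomial ℂ) (k : ℕ), G ∣ P → (∀ i ∈ T, G.eval (s i) ≠ 0) →
      (∀ i ∈ T, (Polynomial.X - Polynomial.C (s i)) ^ k ∣ P) →
      P.natDegree < G.natDegree + T.card * k → P = 0 := by
    intro P G k hG hGs hk hlt
    refine eq_zero_of_pow_dvd T s hinj (fun _ => k) le_rfl hG hGs hk ?_
    simpa using hlt
  have hvert : f ∈ pointIdeal ![0, 0, 0, 1] ^ 3 → ∀ l, β ^ 2 ∣ aeval (ratParam β γ) (pderiv l f) :=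
    fun hv l => pow_dvd_aeval_ratParam_of_vertex hco (h.homog_pderiv l) (pderiv_mem_pow hv l)
  have hpowdeg : ∀ k, (β ^ k).natDegree = k * n := fun k => by rw [Polynomial.natDegree_pow, hβ]
  have hpow : ∀ k, ∀ i ∈ T, (β ^ k).eval (s i) ≠ 0 := fun k i hi => by
    rw [Polynomial.eval_pow]; exact pow_ne_zero k (hs i hi)
  have h0 : aeval (ratParam β γ) f = 0 := by
    have := hdeg h.homog
    rcases hcase with ⟨rfl, hT⟩ | ⟨rfl, hT⟩ | ⟨rfl, hT, hv⟩
    · exact hzero _ 1 3 (one_dvd _) (by simp) hm (by rw [Polynomial.natDegree_one]; omega)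
    · exact hzero _ 1 3 (one_dvd _) (by simp) hm (by rw [Polynomial.natDegree_one]; omega)
    · exact hzero _ (β ^ 3) 3 (pow_dvd_aeval_ratParam_of_vertex hco h.homog hv) (hpow 3) hm
        (by rw [hpowdeg]; omega)
  have hE := euler_aeval h.homog (ratParam β γ)
  have hD := derivative_aeval (ratParam β γ) f
  rw [h0, Fin.sum_univ_four] at hE hD
  have hd := fun l => hdeg (h.homog_pderiv l)
  have hl := fun l => dvd_aeval_ratParam_sub β γ (h.homog_pderiv l)
  have e0 : ratParam β γ 0 = Polynomial.X ^ 2 * β := rfl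
  have e1 : ratParam β γ 1 = Polynomial.X * β := rfl
  have e2 : ratParam β γ 2 = β := rfl
  have e3 : ratParam β γ 3 = -γ := rfl
  have hall : ∀ l, aeval (ratParam β γ) (pderiv l f) = 0 := by
    set f0 := aeval (ratParam β γ) (pderiv 0 f) with hf0
    set f1 := aeval (ratParam β γ) (pderiv 1 f) with hf1
    set f2 := aeval (ratParam β γ) (pderiv 2 f) with hf2
    set f3 := aeval (ratParam β γ) (pderiv 3 f) with hf3
    simp only [e0, e1, e2, e3, Polynomial.derivative_mul, Polynomial.derivative_neg,
      Polynomial.derivative_X, Polynomial.derivative_X_pow, Polynomial.derivative_zero,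
      show Polynomial.C ((2 : ℕ) : ℂ) = (2 : Polynomial ℂ) from rfl] at hE hD
    have hγf3 : γ * f3 = β * (Polynomial.X ^ 2 * f0 + Polynomial.X * f1 + f2) := by
      linear_combination -hE
    have hβf3 : β ∣ f3 := hco.dvd_of_dvd_mul_left (hγf3 ▸ dvd_mul_right _ _)
    have hf3z : f3 = 0 := by
      by_cases hv : f ∈ pointIdeal ![0, 0, 0, 1] ^ 3 ∧ n = 2 ∧ 8 ≤ T.card
      · obtain ⟨hv, rfl, hT⟩ := hv
        refine hzero _ (β ^ 3) 2 ?_ (hpow 3) (hml 3)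
          (by rw [hpowdeg]; have : f3.natDegree ≤ _ := hd 3; omega)
        refine (hco.pow_left (m := 3)).dvd_of_dvd_mul_left (hγf3 ▸ ?_)
        rw [pow_succ']
        exact mul_dvd_mul_left _ (dvd_add (dvd_add ((hvert hv 0).mul_left _)
          ((hvert hv 1).mul_left _)) (hvert hv 2))
      · obtain ⟨k, hk⟩ := hβf3
        have hS : γ * k = Polynomial.X ^ 2 * f0 + Polynomial.X * f1 + f2 :=
          mul_left_cancel₀ hβ0 (by rw [← hγf3, hk]; ring)
        have hdvd : β ∣ Polynomial.derivative β * k := by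
          refine hco.dvd_of_dvd_mul_left
            ⟨Polynomial.derivative γ * k - (2 * Polynomial.X * f0 + f1), ?_⟩
          rw [hk] at hD
          linear_combination Polynomial.derivative β * hS - hD
        obtain ⟨ρ, hρ, hkρ⟩ : ∃ ρ, β.eval ρ = 0 ∧ k.eval ρ = 0 := by
          by_contra! hno
          have hcop : IsCoprime β k := by
            refine (Polynomial.isCoprime_iff_aeval_ne_zero_of_isAlgClosed ℂ (K := ℂ) β k).2
              fun ρ => ?_
            simp only [Polynomial.coe_aeval_eq_eval]
            exact or_iff_not_imp_left.2 fun hρ => hno ρ (not_not.1 hρ)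
          have h3 := Polynomial.eq_zero_of_dvd_of_natDegree_lt (hcop.dvd_of_dvd_mul_right hdvd)
            (Polynomial.natDegree_derivative_lt (by omega))
          exact hn (hβ ▸ Polynomial.derivative_eq_zero.1 h3)
        refine hzero _ (β * (Polynomial.X - Polynomial.C ρ)) 2 ?_ (fun i hi => ?_) (hml 3) ?_
        · rw [hk]
          exact mul_dvd_mul_left _ (Polynomial.dvd_iff_isRoot.2 hkρ)
        · rw [Polynomial.eval_mul, Polynomial.eval_sub, Polynomial.eval_X, Polynomial.eval_C]
          refine mul_ne_zero (hs i hi) (sub_ne_zero.2 fun he => hs i hi (he ▸ hρ))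
        · rw [Polynomial.natDegree_mul hβ0 (Polynomial.X_sub_C_ne_zero ρ), hβ,
            Polynomial.natDegree_X_sub_C]
          have : f3.natDegree ≤ _ := hd 3
          rcases hcase with ⟨rfl, hT⟩ | ⟨rfl, hT⟩ | ⟨rfl, hT, hv'⟩
          · omega
          · omega
          · exact absurd ⟨hv', rfl, hT⟩ hv
    have hS : Polynomial.X ^ 2 * f0 + Polynomial.X * f1 + f2 = 0 := by
      rw [hf3z, mul_zero] at hγf3
      exact (mul_eq_zero.1 hγf3.symm).resolve_left hβ0
    have h1 : f1 = -(2 * Polynomial.X * f0) := by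
      refine mul_left_cancel₀ hβ0 ?_
      rw [hf3z] at hD
      linear_combination -hD - Polynomial.derivative β * hS
    have h2 : f2 = Polynomial.X ^ 2 * f0 := by linear_combination hS - Polynomial.X * h1
    have hdeg0 : f0.natDegree + 2 ≤ 5 * (n + 2) ∨ f0 = 0 := by
      by_cases hz : f0 = 0
      · exact Or.inr hz
      · left
        have := hd 2
        rwa [← hf2, h2, Polynomial.natDegree_X_pow_mul _ hz] at this
    have hz : f0 = 0 := by
      refine hdeg0.elim (fun hdeg0 => ?_) id
      rcases hcase with ⟨rfl, hT⟩ | ⟨rfl, hT⟩ | ⟨rfl, hT, hv⟩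
      · exact hzero _ 1 2 (one_dvd _) (by simp) (hml 0) (by rw [Polynomial.natDegree_one]; omega)
      · refine hzero _ β 2 ?_ hs (hml 0) (by rw [hβ]; omega)
        have hdiv : β ∣ (-γ) ^ 5 * (Polynomial.C (eval ![0, 0, 0, 1] (pderiv 1 f)) +
            2 * Polynomial.X * Polynomial.C (eval ![0, 0, 0, 1] (pderiv 0 f))) := by
          have h3 := dvd_add (hl 1) ((hl 0).mul_left (2 * Polynomial.X))
          rw [← hf0, ← hf1, h1, ← dvd_neg] at h3
          convert h3 using 1
          ring
        have hlin := (IsCoprime.pow_right (n := 5) hco.neg_right).dvd_of_dvd_mul_left hdiv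
        have hl0 : eval ![0, 0, 0, 1] (pderiv 0 f) = 0 := by
          have h3 := Polynomial.eq_zero_of_dvd_of_natDegree_lt hlin (by
            rw [hβ]
            refine lt_of_le_of_lt (b := 1) ?_ (by norm_num)
            compute_degree)
          have h4 := congrArg (Polynomial.eval 1) h3
          have h5 := congrArg (Polynomial.eval 0) h3
          simp at h4 h5
          simpa [h5] using h4
        simpa [hl0] using hl 0
      · exact hzero _ (β ^ 2) 2 (hvert hv 0) (hpow 2) (hml 0) (by rw [hpowdeg]; omega)
    intro l
    fin_cases l
    · exact hz
    · exact h1.trans (by rw [hz, mul_zero, neg_zero])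
    · exact h2.trans (by rw [hz, mul_zero])
    · exact hf3z
  have hinf : {x : ℂ | β.eval x ≠ 0}.Infinite := by
    refine (Set.Finite.infinite_compl (s := {x : ℂ | β.IsRoot x}) ?_).mono fun x hx => hx
    exact Polynomial.finite_setOfPred_isRoot hβ0
  refine h.not_infinite hinf (fun x i => (ratParam β γ i).eval x) ?_ ?_ ?_
  · intro x hx h0
    exact hx (congrFun h0 2)
  · intro x hx y hy c hc
    have h1 := congrFun hc 1
    have h2 := congrFun hc 2
    simp [ratParam] at h1 h2
    refine mul_right_cancel₀ (show β.eval x ≠ 0 from hx) ?_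
    rw [h1, h2]; ring
  · intro x _ j
    have := congrArg (Polynomial.eval x) (hall j)
    rwa [eval_aeval, Polynomial.eval_zero] at this

end IsNine

lemma quadraticForm_apply_add_smul (Q : QuadraticForm ℂ (Fin 4 → ℂ)) (u v : Fin 4 → ℂ) (t : ℂ) :
    Q (u + t • v) = Q u + t * QuadraticMap.polar Q v u + t ^ 2 * Q v := by
  rw [QuadraticMap.map_add Q, QuadraticMap.polar_smul_right, QuadraticMap.map_smul,
    QuadraticMap.polar_comm Q v u]
  simp only [smul_eq_mul]
  ring

/-- The coefficients of a quaternary quadratic form. -/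
lemma exists_quadraticForm_coeff (Q : QuadraticForm ℂ (Fin 4 → ℂ)) : ∃ a b c d e g : ℂ, ∀ x,
    Q x = Q (Pi.single 3 1) * x 3 ^ 2 +
      (QuadraticMap.polar Q (Pi.single 3 1) (Pi.single 0 1) * x 0 +
      QuadraticMap.polar Q (Pi.single 3 1) (Pi.single 1 1) * x 1 +
      QuadraticMap.polar Q (Pi.single 3 1) (Pi.single 2 1) * x 2) * x 3 +
      (a * x 0 ^ 2 + b * (x 0 * x 1) + c * (x 0 * x 2) + d * x 1 ^ 2 + e * (x 1 * x 2) +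
        g * x 2 ^ 2) := by
  refine ⟨Q (Pi.single 0 1), QuadraticMap.polar Q (Pi.single 1 1) (Pi.single 0 1),
    QuadraticMap.polar Q (Pi.single 2 1) (Pi.single 0 1), Q (Pi.single 1 1),
    QuadraticMap.polar Q (Pi.single 2 1) (Pi.single 1 1), Q (Pi.single 2 1), fun x => ?_⟩
  have hx : x = x 0 • Pi.single 0 1 + x 1 • Pi.single 1 1 + x 2 • Pi.single 2 1 +
      x 3 • Pi.single 3 (1 : ℂ) := by
    ext j
    fin_cases j <;> simp
  conv_lhs => rw [hx]
  simp only [quadraticForm_apply_add_smul, QuadraticMap.polar_add_right,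
    QuadraticMap.polar_smul_right, QuadraticMap.map_smul, smul_eq_mul]
  ring

lemma exists_eval_eq_quadraticForm (Q : QuadraticForm ℂ (Fin 4 → ℂ)) :
    ∃ q : MvPolynomial (Fin 4) ℂ, q.IsHomogeneous 2 ∧ ∀ v, eval v q = Q v := by
  obtain ⟨a, b, c, d, e, g, hQ⟩ := exists_quadraticForm_coeff Q
  have hXX : ∀ (r : ℂ) (i j : Fin 4),
      (C r * (X i * X j) : MvPolynomial (Fin 4) ℂ).IsHomogeneous 2 := fun r i j =>
    ((isHomogeneous_X ℂ i).mul (isHomogeneous_X ℂ j)).C_mul r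
  set P := QuadraticMap.polar Q
  refine ⟨C (Q (Pi.single 3 1)) * (X 3 * X 3) +
    (C (P (Pi.single 3 1) (Pi.single 0 1)) * (X 0 * X 3) +
      C (P (Pi.single 3 1) (Pi.single 1 1)) * (X 1 * X 3) +
      C (P (Pi.single 3 1) (Pi.single 2 1)) * (X 2 * X 3)) +
    (C a * (X 0 * X 0) + C b * (X 0 * X 1) + C c * (X 0 * X 2) + C d * (X 1 * X 1) +
      C e * (X 1 * X 2) + C g * (X 2 * X 2)), ?_, fun v => ?_⟩
  · repeat' apply IsHomogeneous.add
    all_goals exact hXX _ _ _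
  · rw [hQ v]
    simp only [map_add, map_mul, eval_C, eval_X]
    ring

namespace IsNine

variable {f : MvPolynomial (Fin 4) ℂ} {p : Fin 9 → Fin 4 → ℂ} {s w : Fin 9 → ℂ}

lemma false_of_planes_of_quadraticForm (h : IsNine f p) {ℓ ℓ' : (Fin 4 → ℂ) →ₗ[ℂ] ℂ} (hℓ : ℓ ≠ 0)
    (hℓ' : ℓ' ≠ 0) (hp : ∀ i, ℓ (p i) * ℓ' (p i) = 0) {Q : QuadraticForm ℂ (Fin 4 → ℂ)}
    (hQp : ∀ i, Q (p i) = 0) (hne : ∀ c : ℂ, ∃ v, Q v ≠ c * (ℓ v * ℓ' v)) : False := by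
  obtain ⟨q, hq, hqQ⟩ := exists_eval_eq_quadraticForm Q
  exact h.false_of_planes hℓ hℓ' hp hq (fun i => by rw [hqQ, hQp]) fun c => by
    simpa only [hqQ] using hne c

/-- The quadratic form of the cone over a conic. -/
lemma exists_coneForm : ∃ Q : QuadraticForm ℂ (Fin 4 → ℂ), ∀ x, Q x = x 0 * x 2 - x 1 ^ 2 :=
  ⟨QuadraticMap.linMulLin (LinearMap.proj 0) (LinearMap.proj 2) -
    QuadraticMap.linMulLin (LinearMap.proj 1) (LinearMap.proj 1), fun x => by
      simp [QuadraticMap.linMulLin_apply, sq]⟩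

/-- Nine points on a quadric cone do not lie on two planes through which the cone does not
factor. -/
lemma false_of_cone_of_planes (h : IsNine f p)
    (hp : ∀ i, p i = ![s i ^ 2, s i, 1, w i] ∨ p i = ![0, 0, 0, w i])
    {ℓ ℓ' : (Fin 4 → ℂ) →ₗ[ℂ] ℂ} (hℓp : ∀ i, ℓ (p i) * ℓ' (p i) = 0)
    (hne : ∃ v, v 0 * v 2 = v 1 ^ 2 ∧ ℓ v * ℓ' v ≠ 0) : False := by
  obtain ⟨v, hv, hv'⟩ := hne
  obtain ⟨Q, hQ⟩ := exists_coneForm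
  refine h.false_of_planes_of_quadraticForm (ℓ := ℓ) (ℓ' := ℓ') (by rintro rfl; simp at hv')
    (by rintro rfl; simp at hv') hℓp (Q := Q) (fun i => ?_) fun c => ?_
  · rcases hp i with hi | hi <;> simp [hQ, hi]
  · by_cases hc : c = 0
    · exact ⟨![0, 1, 0, 0], by simp [hQ, hc]⟩
    · refine ⟨v, ?_⟩
      rw [hQ, hv, sub_self]
      exact (mul_ne_zero hc hv').symm

end IsNine

lemma eval_eq_of_natDegree_le_two {ε : Polynomial ℂ} (hε : ε.natDegree ≤ 2) (x : ℂ) :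
    ε.eval x = ε.coeff 2 * x ^ 2 + ε.coeff 1 * x + ε.coeff 0 := by
  rw [Polynomial.eval_eq_sum_range' (n := 3) (by omega)]
  simp only [Finset.sum_range_succ, Finset.sum_range_zero]
  ring

/-- The linear form with the given coefficients. -/
def linearForm (a b c d : ℂ) : (Fin 4 → ℂ) →ₗ[ℂ] ℂ :=
  a • LinearMap.proj 0 + b • LinearMap.proj 1 + c • LinearMap.proj 2 + d • LinearMap.proj 3

@[simp]
lemma linearForm_apply (a b c d : ℂ) (x : Fin 4 → ℂ) :
    linearForm a b c d x = a * x 0 + b * x 1 + c * x 2 + d * x 3 := by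
  simp [linearForm]

namespace IsNine

variable {f : MvPolynomial (Fin 4) ℂ} {p : Fin 9 → Fin 4 → ℂ} {s w : Fin 9 → ℂ}

lemma false_of_cone_of_sq (h : IsNine f p) (hp : ∀ i, p i = ![s i ^ 2, s i, 1, w i])
    {δ : Polynomial ℂ} (hδ : δ.natDegree ≤ 4) (hw : ∀ i, w i ^ 2 = δ.eval (s i)) : False := by
  by_cases hns : ∀ ε : Polynomial ℂ, ε ^ 2 ≠ δ
  · exact h.false_of_doubleCover hp hδ hns hw
  push Not at hns
  obtain ⟨ε, rfl⟩ := hns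
  have hε : ε.natDegree ≤ 2 := by
    rw [Polynomial.natDegree_pow] at hδ
    omega
  refine h.false_of_cone_of_planes (fun i => Or.inl (hp i))
    (ℓ := linearForm (ε.coeff 2) (ε.coeff 1) (ε.coeff 0) 1)
    (ℓ' := linearForm (-ε.coeff 2) (-ε.coeff 1) (-ε.coeff 0) 1) (fun i => ?_)
    ⟨![0, 0, 0, 1], by simp, by simp⟩
  have hwi := hw i
  rw [Polynomial.eval_pow, eval_eq_of_natDegree_le_two hε] at hwi
  simp only [hp i, linearForm_apply, Matrix.cons_val]
  linear_combination hwi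

/-- A ruling of the cone contains at most two of the nine points. -/
lemma card_ruling_le (h : IsNine f p) (ρ : ℂ) {T : Finset (Fin 9)}
    (hT : ∀ i ∈ T, p i = ![s i ^ 2, s i, 1, w i] ∧ s i = ρ ∨ p i = ![0, 0, 0, w i]) :
    T.card ≤ 2 := by
  refine h.card_mem_le_two (U := Submodule.span ℂ (Set.range ![![ρ ^ 2, ρ, 1, 0], ![0, 0, 0, 1]]))
    ((finrank_range_le_card _).trans (by simp)) fun i hi => ?_
  have h1 : (![ρ ^ 2, ρ, 1, 0] : Fin 4 → ℂ) ∈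
      Submodule.span ℂ (Set.range ![![ρ ^ 2, ρ, 1, 0], ![0, 0, 0, 1]]) :=
    Submodule.subset_span ⟨0, rfl⟩
  have h2 : (![0, 0, 0, 1] : Fin 4 → ℂ) ∈
      Submodule.span ℂ (Set.range ![![ρ ^ 2, ρ, 1, 0], ![0, 0, 0, 1]]) :=
    Submodule.subset_span ⟨1, rfl⟩
  rcases hT i hi with ⟨hpi, rfl⟩ | hpi
  · convert Submodule.add_mem _ h1 (Submodule.smul_mem _ (w i) h2) using 1
    rw [hpi]
    ext j
    fin_cases j <;> simp
  · convert Submodule.smul_mem _ (w i) h2 using 1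
    rw [hpi]
    ext j
    fin_cases j <;> simp

lemma eq_of_vertex (h : IsNine f p) {i j : Fin 9} (hi : p i = ![0, 0, 0, w i])
    (hj : p j = ![0, 0, 0, w j]) : i = j := by
  by_contra hne
  have hj0 : w j ≠ 0 := fun h0 => h.ne_zero j (by rw [hj, h0]; ext k; fin_cases k <;> rfl)
  refine h.indep i j hne (w i / w j) ?_
  rw [hi, hj]
  ext k
  fin_cases k <;> simp [hj0]

lemma false_of_rulings (h : IsNine f p) {γ : Polynomial ℂ} (hγ0 : γ ≠ 0) (hγ : γ.natDegree ≤ 4)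
    (hp : ∀ i, p i = ![s i ^ 2, s i, 1, w i] ∧ γ.eval (s i) = 0 ∨ p i = ![0, 0, 0, w i]) :
    False := by
  classical
  obtain ⟨ρ, hρ⟩ : ∃ ρ, γ.eval ρ = 0 := by
    by_contra! hno
    have h0 := fun i => (hp i).resolve_left fun hi => hno _ hi.2
    exact zero_ne_one (h.eq_of_vertex (h0 0) (h0 1))
  set r : Fin 9 → ℂ := fun i => if γ.eval (s i) = 0 then s i else ρ with hr
  have hr0 : ∀ i, γ.eval (r i) = 0 := by
    intro i
    by_cases hi : γ.eval (s i) = 0 <;> simp [hr, hi, hρ]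
  have h1 := Finset.card_le_mul_card_image (f := r) (Finset.univ : Finset (Fin 9)) 2 fun a _ =>
    h.card_ruling_le (s := s) (w := w) a fun i hi => by
      rw [Finset.mem_filter] at hi
      refine (hp i).imp_left fun hpi => ⟨hpi.1, ?_⟩
      rw [← hi.2, hr]
      simp [hpi.2]
  have h2 : (Finset.univ.image r).card ≤ γ.roots.toFinset.card := by
    refine Finset.card_le_card fun a ha => ?_
    obtain ⟨i, -, rfl⟩ := Finset.mem_image.1 ha
    simpa [hγ0] using hr0 i
  have h3 := (Multiset.toFinset_card_le γ.roots).trans (Polynomial.card_roots' γ)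
  rw [Finset.card_univ, Fintype.card_fin] at h1
  omega

lemma false_of_cone_of_linear (h : IsNine f p) {β γ : Polynomial ℂ} (hβ : β.natDegree = 2)
    (hγ : γ.natDegree ≤ 4)
    (hp : ∀ i, p i = ![s i ^ 2, s i, 1, w i] ∧ β.eval (s i) * w i + γ.eval (s i) = 0 ∨
      p i = ![0, 0, 0, w i]) : False := by
  classical
  have hβ0 : β ≠ 0 := by
    rintro rfl
    simp at hβ
  obtain ⟨G, β', γ', hco, rfl, rfl⟩ : ∃ G β' γ' : Polynomial ℂ,
      IsCoprime β' γ' ∧ β = G * β' ∧ γ = G * γ' := by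
    obtain ⟨β', hβ'⟩ := EuclideanDomain.gcd_dvd_left β γ
    obtain ⟨γ', hγ'⟩ := EuclideanDomain.gcd_dvd_right β γ
    have hbez := EuclideanDomain.gcd_eq_gcd_ab β γ
    refine ⟨_, β', γ', ⟨EuclideanDomain.gcdA β γ, EuclideanDomain.gcdB β γ, ?_⟩, hβ', hγ'⟩
    generalize EuclideanDomain.gcd β γ = G at *
    generalize EuclideanDomain.gcdA β γ = a at *
    generalize EuclideanDomain.gcdB β γ = b at *
    subst hβ' hγ'
    exact mul_left_cancel₀ (left_ne_zero_of_mul hβ0) (by linear_combination -hbez)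
  have hG0 : G ≠ 0 := left_ne_zero_of_mul hβ0
  have hβ'0 : β' ≠ 0 := right_ne_zero_of_mul hβ0
  rw [Polynomial.natDegree_mul hG0 hβ'0] at hβ
  have hγ' : G.natDegree + γ'.natDegree ≤ 4 := by
    by_cases hγ0 : γ' = 0
    · rw [hγ0, Polynomial.natDegree_zero]
      omega
    · rwa [← Polynomial.natDegree_mul hG0 hγ0]
  have hp' : ∀ i, p i = ![s i ^ 2, s i, 1, w i] ∧
      G.eval (s i) * (β'.eval (s i) * w i + γ'.eval (s i)) = 0 ∨ p i = ![0, 0, 0, w i] :=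
    fun i => (hp i).imp_left fun hi => ⟨hi.1, by
      rw [← hi.2, Polynomial.eval_mul, Polynomial.eval_mul]
      ring⟩
  obtain hG | hG | hG : G.natDegree = 0 ∨ G.natDegree = 1 ∨ G.natDegree = 2 := by omega
  · set T := Finset.univ.filter fun i => p i = ![s i ^ 2, s i, 1, w i] with hT
    have hGs : ∀ x, G.eval x ≠ 0 := by
      intro x
      rw [Polynomial.eq_C_of_natDegree_eq_zero hG] at hG0 ⊢
      rw [Polynomial.eval_C]
      exact fun h0 => hG0 (by rw [h0, map_zero])
    have hV : Tᶜ.card ≤ 1 := Finset.card_le_one.2 fun i hi j hj => by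
      simp only [hT, Finset.mem_compl, Finset.mem_filter, Finset.mem_univ, true_and] at hi hj
      exact h.eq_of_vertex ((hp i).resolve_left fun hi' => hi hi'.1)
        ((hp j).resolve_left fun hj' => hj hj'.1)
    have hcard := Finset.card_add_card_compl T
    rw [Fintype.card_fin] at hcard
    refine h.false_of_ratParam (T := T) (s := s) (w := w) (by simp [hT]) hco (n := 2)
      two_ne_zero (by omega) (by omega) (fun i hi => ?_) (Or.inr ?_)
    · simp only [hT, Finset.mem_filter, Finset.mem_univ, true_and] at hi
      rcases hp' i with hpi | hpi
      · exact (mul_eq_zero.1 hpi.2).resolve_left (hGs _)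
      · simpa using congrFun (hi.symm.trans hpi) 2
    · rcases Finset.eq_empty_or_nonempty Tᶜ with hTe | ⟨i, hi⟩
      · rw [hTe, Finset.card_empty] at hcard
        omega
      · refine Or.inr ⟨rfl, by omega, ?_⟩
        simp only [hT, Finset.mem_compl, Finset.mem_filter, Finset.mem_univ, true_and] at hi
        have hpi := (hp i).resolve_left fun hi' => hi hi'.1
        have hwi : w i ≠ 0 := fun h0 =>
          h.ne_zero i (by rw [hpi, h0]; ext k; fin_cases k <;> rfl)
        convert smul_mem_pow (inv_ne_zero hwi) h.homog (h.triple i) using 2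
        rw [hpi]
        congr 1
        ext k
        fin_cases k <;> simp [hwi]
  · obtain ⟨ρ, hρ⟩ := IsAlgClosed.exists_root G (by
      rw [Polynomial.degree_eq_natDegree hG0, hG]; norm_num)
    set T := Finset.univ.filter fun i =>
      p i = ![s i ^ 2, s i, 1, w i] ∧ s i = ρ ∨ p i = ![0, 0, 0, w i] with hT
    have hV : T.card ≤ 2 := h.card_ruling_le (s := s) (w := w) ρ (by simp [hT])
    have hcard := Finset.card_add_card_compl T
    rw [Fintype.card_fin] at hcard
    have hmem : ∀ i ∈ Tᶜ, p i = ![s i ^ 2, s i, 1, w i] ∧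
        β'.eval (s i) * w i + γ'.eval (s i) = 0 := by
      intro i hi
      simp only [hT, Finset.mem_compl, Finset.mem_filter, Finset.mem_univ, true_and, not_or] at hi
      have hpi := (hp' i).resolve_right hi.2
      refine ⟨hpi.1, (mul_eq_zero.1 hpi.2).resolve_left fun h0 => hi.1 ⟨hpi.1, ?_⟩⟩
      obtain ⟨m, b, rfl⟩ := Polynomial.exists_eq_X_add_C_of_natDegree_le_one hG.le
      have hm : m ≠ 0 := by
        rintro rfl
        simp at hG
      simp at h0 hρ
      exact mul_left_cancel₀ hm (by linear_combination h0 - hρ)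
    exact h.false_of_ratParam (fun i hi => (hmem i hi).1) hco one_ne_zero (by omega) (by omega)
      (fun i hi => (hmem i hi).2) (Or.inl ⟨rfl, by omega⟩)
  · have hβ' : β' = Polynomial.C (β'.coeff 0) :=
      Polynomial.eq_C_of_natDegree_eq_zero (by omega)
    have hc : β'.coeff 0 ≠ 0 := fun h0 => hβ'0 (by rw [hβ', h0, map_zero])
    have hG2 : G.coeff 2 ≠ 0 := by
      rw [← hG]
      exact Polynomial.leadingCoeff_ne_zero.2 hG0
    refine h.false_of_cone_of_planes (s := s) (w := w) (fun i => (hp i).imp_left fun hi => hi.1)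
      (ℓ := linearForm (G.coeff 2) (G.coeff 1) (G.coeff 0) 0)
      (ℓ' := linearForm (γ'.coeff 2) (γ'.coeff 1) (γ'.coeff 0) (β'.coeff 0)) (fun i => ?_)
      ⟨![1, 0, 0, (1 - γ'.coeff 2) / β'.coeff 0], by simp, ?_⟩
    · rcases hp' i with ⟨hpi, hw⟩ | hpi
      · rw [eval_eq_of_natDegree_le_two hG.le, hβ', Polynomial.eval_C,
          eval_eq_of_natDegree_le_two (ε := γ') (by omega)] at hw
        simp only [hpi, linearForm_apply, Matrix.cons_val]
        linear_combination hw
      · simp [hpi]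
    · simp [mul_div_cancel₀ _ hc, hG2]

end IsNine

/-- A pencil of quaternary quadratic forms contains a degenerate one. -/
lemma exists_degenerate_quadraticForm {Q₁ Q₂ : QuadraticForm ℂ (Fin 4 → ℂ)} (h₁ : Q₁ ≠ 0)
    (h₂ : ∀ c : ℂ, Q₂ ≠ c • Q₁) : ∃ (Q Q' : QuadraticForm ℂ (Fin 4 → ℂ)) (v : Fin 4 → ℂ),
      v ≠ 0 ∧ (∀ x, QuadraticMap.polar Q v x = 0) ∧
      (∀ x, Q₁ x = 0 → Q₂ x = 0 → Q x = 0 ∧ Q' x = 0) ∧ Q ≠ 0 ∧ ∀ c : ℂ, Q' ≠ c • Q := by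
  by_cases hinj : Function.Injective Q₁.polarBilin
  · set B := LinearMap.linearEquivOfInjective Q₁.polarBilin hinj Subspace.dual_finrank_eq.symm
    obtain ⟨μ, hμ⟩ := Module.End.exists_eigenvalue (B.symm.toLinearMap ∘ₗ Q₂.polarBilin)
    obtain ⟨v, hv⟩ := hμ.exists_hasEigenvector
    have hBv : Q₂.polarBilin v = μ • Q₁.polarBilin v := by
      have := congrArg B hv.apply_eq_smul
      rwa [map_smul, LinearMap.comp_apply, LinearEquiv.coe_coe, LinearEquiv.apply_symm_apply]
        at this
    refine ⟨Q₂ - μ • Q₁, Q₁, v, hv.2, fun x => ?_, fun x hx₁ hx₂ => ⟨by simp [hx₁, hx₂], hx₁⟩,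
      sub_ne_zero.2 (h₂ μ), fun c hc => ?_⟩
    · have := LinearMap.congr_fun hBv x
      simp only [LinearMap.smul_apply, QuadraticMap.polarBilin_apply_apply, smul_eq_mul] at this
      rw [sub_eq_add_neg, FunLike.coe_add, QuadraticMap.polar_add, FunLike.coe_neg,
        QuadraticMap.polar_neg, FunLike.coe_smul, QuadraticMap.polar_smul, this, smul_eq_mul,
        add_neg_cancel]
    · by_cases hc0 : c = 0
      · exact h₁ (by rw [hc, hc0, zero_smul])
      · refine h₂ (c⁻¹ + μ) ?_
        refine QuadraticMap.ext fun x => ?_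
        have := congrArg (fun R => R x) hc
        simp at this ⊢
        field_simp
        linear_combination -this
  · obtain ⟨v, hv, hv0⟩ : ∃ v, Q₁.polarBilin v = 0 ∧ v ≠ 0 := by
      rw [injective_iff_map_eq_zero] at hinj
      push Not at hinj
      exact hinj
    exact ⟨Q₁, Q₂, v, hv0, fun x => LinearMap.congr_fun hv x, fun x hx₁ hx₂ => ⟨hx₁, hx₂⟩, h₁, h₂⟩

namespace IsNine

variable {f : MvPolynomial (Fin 4) ℂ} {p : Fin 9 → Fin 4 → ℂ} {s w : Fin 9 → ℂ}

lemma false_of_cone (h : IsNine f p)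
    (hp : ∀ i, p i = ![s i ^ 2, s i, 1, w i] ∨ p i = ![0, 0, 0, w i])
    {Q : QuadraticForm ℂ (Fin 4 → ℂ)} (hQp : ∀ i, Q (p i) = 0)
    (hne : ∀ c : ℂ, ∃ v, Q v ≠ c * (v 0 * v 2 - v 1 ^ 2))
    (hα : Q (Pi.single 3 1) ≠ 0 →
      ∀ k ≠ 3, QuadraticMap.polar Q (Pi.single 3 1) (Pi.single k 1) = 0)
    (hβ : QuadraticMap.polar Q (Pi.single 3 1) (Pi.single 0 1) = 0 →
      ∀ k ≠ 3, QuadraticMap.polar Q (Pi.single 3 1) (Pi.single k 1) = 0) : False := by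
  obtain ⟨a, b, c, d, e, g, hQ⟩ := exists_quadraticForm_coeff Q
  set α := Q (Pi.single 3 1)
  set b₀ := QuadraticMap.polar Q (Pi.single 3 1) (Pi.single 0 1)
  set b₁ := QuadraticMap.polar Q (Pi.single 3 1) (Pi.single 1 1)
  set b₂ := QuadraticMap.polar Q (Pi.single 3 1) (Pi.single 2 1)
  set γ : Polynomial ℂ := Polynomial.C a * Polynomial.X ^ 4 + Polynomial.C b * Polynomial.X ^ 3 +
    Polynomial.C (c + d) * Polynomial.X ^ 2 + Polynomial.C e * Polynomial.X + Polynomial.C g with hγ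
  have hγ4 : γ.natDegree ≤ 4 := by
    rw [hγ]
    compute_degree
  have hγe : ∀ x, γ.eval x = a * x ^ 4 + b * x ^ 3 + (c + d) * x ^ 2 + e * x + g := fun x => by
    simp [hγ]
  by_cases hα0 : α = 0
  · have hrel : ∀ i, p i = ![s i ^ 2, s i, 1, w i] →
        (b₀ * s i ^ 2 + b₁ * s i + b₂) * w i + γ.eval (s i) = 0 := by
      intro i hi
      have h1 := hQp i
      rw [hQ, hi, hα0] at h1
      simp only [Matrix.cons_val] at h1
      rw [hγe]
      linear_combination h1
    by_cases hb : b₀ = 0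
    · have hb₁ : b₁ = 0 := hβ hb 1 (by decide)
      have hb₂ : b₂ = 0 := hβ hb 2 (by decide)
      refine h.false_of_rulings (γ := γ) (fun h0 => ?_) hγ4 fun i => (hp i).imp_left fun hi =>
        ⟨hi, by simpa [hb, hb₁, hb₂] using hrel i hi⟩
      have hcoeff : ∀ k, γ.coeff k = 0 := by simp [h0]
      have h4 := hcoeff 4
      have h3 := hcoeff 3
      have h2 := hcoeff 2
      have h1 := hcoeff 1
      have h0' := hcoeff 0
      simp [hγ, Polynomial.coeff_X, Polynomial.coeff_C, add_mul] at h4 h3 h2 h1 h0'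
      obtain ⟨v, hv⟩ := hne c
      refine hv ?_
      rw [hQ, hα0, hb, hb₁, hb₂, h4, h3, h1, h0']
      linear_combination v 1 ^ 2 * h2
    · refine h.false_of_cone_of_linear (β := Polynomial.C b₀ * Polynomial.X ^ 2 +
        Polynomial.C b₁ * Polynomial.X + Polynomial.C b₂) (γ := γ)
        (Polynomial.natDegree_quadratic hb) hγ4 fun i => (hp i).imp_left fun hi => ⟨hi, ?_⟩
      simpa using hrel i hi
  · have hb₀ : b₀ = 0 := hα hα0 0 (by decide)
    have hb₁ : b₁ = 0 := hα hα0 1 (by decide)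
    have hb₂ : b₂ = 0 := hα hα0 2 (by decide)
    have hp' : ∀ i, p i = ![s i ^ 2, s i, 1, w i] := by
      intro i
      refine (hp i).resolve_right fun hi => h.ne_zero i ?_
      have h1 := hQp i
      rw [hQ, hi] at h1
      simp [hα0] at h1
      rw [hi, h1]
      ext k
      fin_cases k <;> rfl
    refine h.false_of_cone_of_sq hp' (δ := Polynomial.C (-α⁻¹) * γ)
      ((Polynomial.natDegree_C_mul_le _ _).trans hγ4) fun i => ?_
    have h1 := hQp i
    rw [hQ, hp' i, hb₀, hb₁, hb₂] at h1
    simp only [Matrix.cons_val] at h1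
    rw [Polynomial.eval_mul, Polynomial.eval_C, hγe]
    field_simp
    linear_combination h1

/-- At most one quadric passes through the nine points. -/
lemma exists_eq_smul (h : IsNine f p) {Q₁ Q₂ : QuadraticForm ℂ (Fin 4 → ℂ)} (h₁ : Q₁ ≠ 0)
    (hp₁ : ∀ i, Q₁ (p i) = 0) (hp₂ : ∀ i, Q₂ (p i) = 0) : ∃ c : ℂ, Q₂ = c • Q₁ := by
  by_contra! h₂
  obtain ⟨Q, Q', v, hv, hQv, hcommon, hQ0, hne⟩ := exists_degenerate_quadraticForm h₁ h₂
  have hQp := fun i => (hcommon _ (hp₁ i) (hp₂ i)).1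
  have hQp' := fun i => (hcommon _ (hp₁ i) (hp₂ i)).2
  clear hcommon hp₁ hp₂ h₁ h₂ Q₁ Q₂
  obtain ⟨ℓ, hℓv, hℓ⟩ : ∃ ℓ : (Fin 4 → ℂ) →ₗ[ℂ] ℂ, ℓ v = 1 ∧
      (Q' v ≠ 0 → ∀ x, ℓ x = 0 → QuadraticMap.polar Q' v x = 0) := by
    by_cases hv' : Q' v = 0
    · obtain ⟨ℓ, hℓ⟩ := Module.Projective.exists_dual_eq_one ℂ hv
      exact ⟨ℓ, hℓ, fun h0 => absurd hv' h0⟩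
    · have h2 : QuadraticMap.polar Q' v v ≠ 0 := by
        rw [QuadraticMap.polar_self]
        simpa using hv'
      refine ⟨(QuadraticMap.polar Q' v v)⁻¹ • Q'.polarBilin v, inv_mul_cancel₀ h2, fun _ x hx =>
        (mul_eq_zero.1 hx).resolve_left (inv_ne_zero h2)⟩
  have hℓ0 : ℓ ≠ 0 := by
    rintro rfl
    simp at hℓv
  have hQvv : Q v = 0 := by
    have := hQv v
    rw [QuadraticMap.polar_self] at this
    simpa using this
  have hQt : ∀ x t, Q (x + t • v) = Q x := fun x t => by
    rw [quadraticForm_apply_add_smul, hQv, hQvv]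
    ring
  set W := LinearMap.ker ℓ with hW
  set π : (Fin 4 → ℂ) →ₗ[ℂ] W := LinearMap.codRestrict W (LinearMap.id - ℓ.smulRight v)
    (fun x => by simp [hW, hℓv]) with hπ
  have hπx : ∀ x, x = π x + ℓ x • v := fun x => by
    change x = x - ℓ x • v + ℓ x • v
    rw [sub_add_cancel]
  have hQπ : ∀ x, Q x = Q (π x) := fun x => by
    conv_lhs => rw [hπx x, hQt]
  rcases ternary_normal_form (finrank_ker_eq_three hℓ0) (Q.comp W.subtype) with
    ⟨l₁, l₂, hl⟩ | ⟨b, hb⟩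
  · have hQl : ∀ x, Q x = l₁ (π x) * l₂ (π x) := fun x => (hQπ x).trans (hl (π x))
    obtain ⟨x, hx⟩ : ∃ x, Q x ≠ 0 := by
      by_contra! h0
      exact hQ0 (QuadraticMap.ext h0)
    rw [hQl] at hx
    refine h.false_of_planes_of_quadraticForm (ℓ := l₁ ∘ₗ π) (ℓ' := l₂ ∘ₗ π) (fun h0 => ?_)
      (fun h0 => ?_) (fun i => ?_) hQp' fun c => ?_
    · exact left_ne_zero_of_mul hx (LinearMap.congr_fun h0 x)
    · exact right_ne_zero_of_mul hx (LinearMap.congr_fun h0 x)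
    · exact (hQl _).symm.trans (hQp i)
    · by_contra! h0
      refine hne c (QuadraticMap.ext fun y => ?_)
      rw [h0, smul_apply, hQl]
      rfl
  · obtain ⟨b, hb, ht, hβ⟩ := exists_rotated_basis b hb
      (fun i : {i // π (p i) ≠ 0} => π (p i)) (fun i => i.2) (Q'.polarBilin v ∘ₗ W.subtype)
    have hvW : v ∉ W := by simp [hW, hℓv]
    obtain ⟨M, c, p', hM, hMx, hc, hpM, h', hp2⟩ := h.exists_coords b hvW
    have hπM : ∀ x, π (M.mulVec x) = x 0 • b 0 + x 1 • b 1 + x 2 • b 2 := by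
      intro x
      refine Subtype.ext ?_
      change M.mulVec x - ℓ (M.mulVec x) • v = _
      rw [hMx, map_add, LinearMap.mem_ker.1 (Subtype.property _), map_smul, hℓv]
      simp
    have hQM : ∀ x, Q (M.mulVec x) = x 0 * x 2 - x 1 ^ 2 := fun x => by
      rw [hQπ, hπM, ← hb]
      rfl
    have hM3 : M.mulVec (Pi.single 3 1) = v := by rw [hMx]; simp
    have hMk : ∀ k : Fin 4, ∀ hk : k ≠ 3, M.mulVec (Pi.single k 1) = b (k.castPred hk) := by
      intro k hk
      rw [hMx]
      fin_cases k <;> first | exact absurd rfl hk | (simp; done) | (simp; rfl)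
    set R := Q'.comp M.mulVecLin with hR
    have hpolar : ∀ x y, QuadraticMap.polar R x y =
        QuadraticMap.polar Q' (M.mulVec x) (M.mulVec y) := fun x y => by
      simp [hR, QuadraticMap.polar, Matrix.mulVec_add]
    refine h'.false_of_cone (s := fun i => p' i 1) (w := fun i => p' i 3) (Q := R) (fun i => ?_)
      (fun i => ?_) (fun c' => ?_) (fun hα k hk => ?_) (fun h0 k hk => ?_)
    · have hq : p' i 0 * p' i 2 - p' i 1 ^ 2 = 0 := by
        rw [← hQM, hpM, QuadraticMap.map_smul, hQp, smul_zero]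
      have hvec : p' i = ![p' i 0, p' i 1, p' i 2, p' i 3] := by
        ext j
        fin_cases j <;> rfl
      have hπp : c i • π (p i) = p' i 0 • b 0 + p' i 1 • b 1 + p' i 2 • b 2 := by
        rw [← hπM, hpM, map_smul]
      by_cases hi : π (p i) = 0
      · right
        rw [hi, smul_zero] at hπp
        have hli := Fintype.linearIndependent_iff.1 b.linearIndependent (fun k => p' i k.castSucc)
          (by rw [Fin.sum_univ_three]; exact hπp.symm)
        have h0 : p' i 0 = 0 := hli 0
        have h1 : p' i 1 = 0 := hli 1
        have h2 : p' i 2 = 0 := hli 2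
        rw [hvec, h0, h1, h2]
        simp
      · left
        have h2 : p' i 2 ≠ 0 := by
          intro h2
          refine ht ⟨i, hi⟩ ((c i)⁻¹ * p' i 0) ((c i)⁻¹ * p' i 1) ((c i)⁻¹ * p' i 2) ?_
            (by simp [h2])
          rw [mul_smul, mul_smul, mul_smul, ← smul_add, ← smul_add, ← hπp, smul_smul,
            inv_mul_cancel₀ (hc i), one_smul]
        have h21 := hp2 i h2
        rw [h21, mul_one, sub_eq_zero] at hq
        rw [hvec, h21, hq]
        simp
    · simp [hR, hpM, QuadraticMap.map_smul, hQp']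
    · by_contra! h0
      refine hne c' (QuadraticMap.ext fun y => ?_)
      have := h0 (M⁻¹.mulVec y)
      rw [← hQM] at this
      simpa [hR, Matrix.mul_nonsing_inv _ hM] using this
    · rw [hpolar, hM3, hMk k hk]
      refine hℓ (fun h0 => hα ?_) _ (LinearMap.mem_ker.1 (b _).2)
      simp [hR, hM3, h0]
    · rw [hpolar, hM3, hMk k hk]
      rw [hpolar, hM3, hMk 0 (by decide)] at h0
      by_contra hk0
      exact hβ (fun hz => hk0 (LinearMap.congr_fun hz (b _))) h0

end IsNine

lemma exists_isNine {f : MvPolynomial (Fin 4) ℂ} (hhom : f.IsHomogeneous 6)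
    (hX : OnlyTriplePoints 6 9 f) :
    ∃ p : Fin 9 → Fin 4 → ℂ, IsNine f p ∧
      ∀ q : MvPolynomial (Fin 4) ℂ, (∀ P ∈ SingSet f, eval P.rep q = 0) ↔
        ∀ i, eval (p i) q = 0 := by
  obtain ⟨hfin, hcard, htriple⟩ := hX
  have := hfin.fintype
  rw [Set.ncard_eq_toFinset_card', Set.toFinset_card] at hcard
  set E := (Fintype.equivFinOfCardEq hcard).symm
  refine ⟨fun i => (E i).1.rep, ⟨hhom, fun i j hij c hc => hij ?_, fun i =>
    multAtLeast_iff.1 (htriple _ (E i).2).1, fun v hv hfv => ?_⟩,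
    fun q => ⟨fun hq i => hq _ (E i).2, fun hq P hP => ?_⟩⟩
  · refine E.injective (Subtype.ext ?_)
    rw [← Projectivization.mk_rep (E i).1, ← Projectivization.mk_rep (E j).1,
      Projectivization.mk_eq_mk_iff']
    exact ⟨c, hc.symm⟩
  · obtain ⟨a, ha⟩ := Projectivization.exists_smul_eq_mk_rep ℂ v hv
    have hmem : Projectivization.mk ℂ v hv ∈ SingSet f := by
      refine multAtLeast_iff.2 ?_
      rw [← ha]
      exact smul_mem_pow a.ne_zero hhom hfv
    refine ⟨E.symm ⟨_, hmem⟩, (a⁻¹ : ℂˣ), ?_⟩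
    rw [Equiv.apply_symm_apply, ← ha, ← Units.smul_def, inv_smul_smul]
  · simpa using hq (E.symm ⟨P, hP⟩)

/-- For a sextic whose only singularities are exactly nine ordinary triple
points, the space of quadratic forms vanishing at all nine triple points is
one-dimensional: there is a unique quadric through the nine points. -/
theorem sextic_nine_triple_points_unique_quadric
    (f : MvPolynomial (Fin 4) ℂ) (hf : f ≠ 0) (hhom : f.IsHomogeneous 6)
    (hX : OnlyTriplePoints 6 9 f) :
    (∃ q : MvPolynomial (Fin 4) ℂ, q ≠ 0 ∧ q.IsHomogeneous 2 ∧
      ∀ P ∈ SingSet f, MvPolynomial.eval P.rep q = 0) ∧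
    (∀ q₁ q₂ : MvPolynomial (Fin 4) ℂ,
      q₁.IsHomogeneous 2 → (∀ P ∈ SingSet f, MvPolynomial.eval P.rep q₁ = 0) →
      q₂.IsHomogeneous 2 → (∀ P ∈ SingSet f, MvPolynomial.eval P.rep q₂ = 0) →
      q₁ ≠ 0 → ∃ c : ℂ, q₂ = c • q₁) := by
  obtain ⟨p, h, hp⟩ := exists_isNine hhom hX
  simp only [hp]
  refine ⟨exists_quadric p, fun q₁ q₂ hq₁ hp₁ hq₂ hp₂ hne => ?_⟩
  obtain ⟨Q₁, hQ₁⟩ := exists_quadraticForm hq₁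
  obtain ⟨Q₂, hQ₂⟩ := exists_quadraticForm hq₂
  obtain ⟨c, hc⟩ := h.exists_eq_smul (Q₁ := Q₁) (Q₂ := Q₂) (fun h0 => hne (funext fun v => by
    rw [← hQ₁, h0, map_zero, zero_apply])) (fun i => by rw [hQ₁, hp₁])
    (fun i => by rw [hQ₂, hp₂])
  refine ⟨c, funext fun v => ?_⟩
  rw [smul_eval, ← hQ₁, ← hQ₂, hc]
  rfl
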